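/- There exists a constant 0<C<∞ such that the mixing time of the square plaquette model with periodic boundary conditions on the critical length scale satisfies T_mix^per(L_c) = C·β·e^{4β}·(1+o(1)) as β→∞, i.e. T_mix^per(L_c)/(β e^{4β}) → C. -/

import Mathlib

open scoped BigOperators

attribute [local instance] Classical.propDecidable

noncomputable section

namespace SPMP

/-- Spin configurations on the `L × L` torus; `true` codes spin `+1`. -/
abbrev ConfigP (L : ℕ) := Fin L × Fin L → Bool

/-- The real spin value of a Boolean spin. -/
def sval (b : Bool) : ℝ := if b then 1 else -1

/-- Cyclic successor on `Fin L`. -/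
def fsucc {L : ℕ} (i : Fin L) : Fin L := ⟨(i.val + 1) % L, Nat.mod_lt _ i.pos⟩

/-- The periodic plaquette variable
`p_x(σ) = σ_{(x₁,x₂)} σ_{(x₁+1,x₂)} σ_{(x₁,x₂+1)} σ_{(x₁+1,x₂+1)}` (coordinates mod `L`). -/
def plaqP (L : ℕ) (σ : ConfigP L) (x : Fin L × Fin L) : ℝ :=
  sval (σ x) * sval (σ (fsucc x.1, x.2)) * sval (σ (x.1, fsucc x.2)) *
    sval (σ (fsucc x.1, fsucc x.2))

/-- The periodic Hamiltonian `H(σ) = -(1/2) ∑_x p_x(σ)`. -/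
def hamP (L : ℕ) (σ : ConfigP L) : ℝ := -(1 / 2) * ∑ x : Fin L × Fin L, plaqP L σ x

/-- The Gibbs measure `π(σ) = e^{-βH(σ)}/Z`. -/
def gibbsP (L : ℕ) (β : ℝ) (σ : ConfigP L) : ℝ :=
  Real.exp (-β * hamP L σ) / ∑ η : ConfigP L, Real.exp (-β * hamP L η)

/-- Flip one spin. -/
def flipP (L : ℕ) (σ : ConfigP L) (x : Fin L × Fin L) : ConfigP L :=
  fun i => if i = x then !(σ i) else σ i

/-- Metropolis rate of the move `σ → η`: `min(1, e^{-β(H(η)-H(σ))})`. -/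
def metroRateP (L : ℕ) (β : ℝ) (σ η : ConfigP L) : ℝ :=
  min 1 (Real.exp (-β * (hamP L η - hamP L σ)))

/-- The Glauber generator of the periodic dynamics, as a matrix. -/
def genP (L : ℕ) (β : ℝ) : Matrix (ConfigP L) (ConfigP L) ℝ :=
  fun σ η =>
    if η = σ then -(∑ x : Fin L × Fin L, metroRateP L β σ (flipP L σ x))
    else ∑ x : Fin L × Fin L, if η = flipP L σ x then metroRateP L β σ (flipP L σ x) else 0

/-- Entrywise matrix exponential `∑ₖ Aᵏ/k!`. -/
def mexp {n : Type*} [Fintype n] [DecidableEq n] (A : Matrix n n ℝ) : Matrix n n ℝ :=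
  fun i j => ∑' k : ℕ, (A ^ k) i j / (Nat.factorial k : ℝ)

/-- Total-variation distance between two (probability) vectors. -/
def tv {n : Type*} [Fintype n] (μ ν : n → ℝ) : ℝ := (∑ s, |μ s - ν s|) / 2

/-- The `ε`-mixing time of the periodic Glauber dynamics. -/
def tmixP (L : ℕ) (β ε : ℝ) : ℝ :=
  sInf {t : ℝ | 0 < t ∧ ∀ σ : ConfigP L, tv (mexp (t • genP L β) σ) (gibbsP L β) < ε}

/-- The set of ground states: minimizers of the Hamiltonian. -/
def GroundP (L : ℕ) : Set (ConfigP L) := {σ | ∀ η : ConfigP L, hamP L σ ≤ hamP L η}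

/-- The critical length scale `L_c = ⌊e^{β/2}⌋`. -/
def Lc (β : ℝ) : ℕ := ⌊Real.exp (β / 2)⌋₊

end SPMP

open SPMP

set_option linter.unusedSectionVars false

namespace SPMP

/-! ### Defects -/

section Defects

variable {n : ℕ} [NeZero n]

lemma fsucc_eq (i : Fin n) : fsucc i = i + 1 := by
  apply Fin.ext
  simp [fsucc, Fin.val_add]

/-- `dft σ y` says that the plaquette at `y` is a defect of `σ`. -/
def dft (σ : ConfigP n) (y : Fin n × Fin n) : Bool :=
  ((σ y ^^ σ (y.1 + 1, y.2)) ^^ (σ (y.1, y.2 + 1) ^^ σ (y.1 + 1, y.2 + 1)))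

/-- The number of defects. -/
def ndef (σ : ConfigP n) : ℕ := (Finset.univ.filter fun y => dft σ y = true).card

/-- The unnormalized Gibbs weight, equal to `1` on ground states. -/
def wt (β : ℝ) (σ : ConfigP n) : ℝ := Real.exp (-β * ndef σ)

/-- The edge conductance of the Metropolis dynamics. -/
def cond (β : ℝ) (σ : ConfigP n) (x : Fin n × Fin n) : ℝ := min (wt β σ) (wt β (flipP n σ x))

lemma plaqP_eq (σ : ConfigP n) (y : Fin n × Fin n) :
    plaqP n σ y = 1 - 2 * (if dft σ y = true then 1 else 0) := by
  have key : ∀ s t u v : Bool, sval s * sval t * sval u * sval v =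
      1 - 2 * (if ((s ^^ t) ^^ (u ^^ v)) = true then (1 : ℝ) else 0) := by
    intro s t u v
    cases s <;> cases t <;> cases u <;> cases v <;> norm_num [sval]
  simp only [plaqP, fsucc_eq, key]
  rfl

lemma ndef_cast (σ : ConfigP n) :
    (ndef σ : ℝ) = ∑ y, (if dft σ y = true then (1 : ℝ) else 0) := by
  simp [ndef]

lemma hamP_eq (σ : ConfigP n) :
    hamP n σ = ndef σ - (Fintype.card (Fin n × Fin n) : ℝ) / 2 := by
  simp only [hamP, plaqP_eq, Finset.sum_sub_distrib, ← Finset.mul_sum, ← ndef_cast]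
  simp only [Finset.sum_const, Finset.card_univ, nsmul_eq_mul]
  ring

lemma wt_pos (β : ℝ) (σ : ConfigP n) : 0 < wt β σ := Real.exp_pos _

lemma exp_ham (β : ℝ) (σ : ConfigP n) :
    Real.exp (-β * hamP n σ) =
      Real.exp (β * ((Fintype.card (Fin n × Fin n) : ℝ) / 2)) * wt β σ := by
  rw [wt, ← Real.exp_add, hamP_eq]
  ring_nf

lemma gibbsP_eq (β : ℝ) (σ : ConfigP n) : gibbsP n β σ = wt β σ / ∑ η : ConfigP n, wt β η := by
  simp only [gibbsP, exp_ham, ← Finset.mul_sum]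
  rw [mul_div_mul_left _ _ (Real.exp_pos _).ne']

lemma wt_mul_rate (β : ℝ) (σ : ConfigP n) (x : Fin n × Fin n) :
    wt β σ * metroRateP n β σ (flipP n σ x) = cond β σ x := by
  have h : wt β σ * Real.exp (-β * (hamP n (flipP n σ x) - hamP n σ)) =
      wt β (flipP n σ x) := by
    unfold wt
    rw [← Real.exp_add, hamP_eq, hamP_eq]
    ring_nf
  unfold metroRateP SPMP.cond
  rw [mul_min_of_nonneg _ _ (wt_pos β σ).le, mul_one, h]

lemma flip_flip (σ : ConfigP n) (x : Fin n × Fin n) : flipP n (flipP n σ x) x = σ := by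
  funext y
  by_cases h : y = x <;> simp [flipP, h]

lemma flip_ne (σ : ConfigP n) (x : Fin n × Fin n) : flipP n σ x ≠ σ := by
  intro h
  have := congrFun h x
  simp [flipP] at this

lemma cond_flip (β : ℝ) (σ : ConfigP n) (x : Fin n × Fin n) :
    cond β (flipP n σ x) x = cond β σ x := by
  rw [cond, cond, flip_flip, min_comm]

lemma cond_nonneg (β : ℝ) (σ : ConfigP n) (x : Fin n × Fin n) : 0 ≤ cond β σ x :=
  (lt_min (wt_pos _ _) (wt_pos _ _)).le

/-- The indicator of the two-point set `{a, b}`, empty when `a = b`. -/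
def duo (a b c : Fin n) : Bool := (decide (c = a) ^^ decide (c = b))

lemma xor_box (P Q R S : Prop) {i1 : Decidable (P ∧ Q)} {i2 : Decidable (R ∧ Q)}
    {i3 : Decidable (P ∧ S)} {i4 : Decidable (R ∧ S)} {i5 : Decidable P} {i6 : Decidable Q}
    {i7 : Decidable R} {i8 : Decidable S} (s t u v : Bool) :
    (((@ite _ (P ∧ Q) i1 (!s) s) ^^ (@ite _ (R ∧ Q) i2 (!t) t)) ^^
      ((@ite _ (P ∧ S) i3 (!u) u) ^^ (@ite _ (R ∧ S) i4 (!v) v))) =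
    (((s ^^ t) ^^ (u ^^ v)) ^^ ((@decide R i7 ^^ @decide P i5) && (@decide S i8 ^^ @decide Q i6))) := by
  by_cases hP : P <;> by_cases hQ : Q <;> by_cases hR : R <;> by_cases hS : S <;>
    simp only [hP, hQ, hR, hS, and_self, and_true, and_false,
      if_true, if_false, decide_true, decide_false] <;> revert s t u v <;> decide

lemma dft_flip (σ : ConfigP n) (x y : Fin n × Fin n) :
    dft (flipP n σ x) y = (dft σ y ^^ (duo (x.1 - 1) x.1 y.1 && duo (x.2 - 1) x.2 y.2)) := by
  obtain ⟨x1, x2⟩ := x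
  obtain ⟨y1, y2⟩ := y
  simp only [dft, flipP, duo, Prod.mk.injEq, eq_sub_iff_add_eq]
  exact xor_box _ _ _ _ _ _ _ _

/-- Flip `m` consecutive sites of the line `j + 1`, starting to the right of column `a`. -/
def seg (σ : ConfigP n) (a j : Fin n) : ℕ → ConfigP n
  | 0 => σ
  | m + 1 => flipP n (seg σ a j m) (a + (m + 1) • (1 : Fin n), j + 1)

lemma dft_seg (σ : ConfigP n) (a j : Fin n) (m : ℕ) (y : Fin n × Fin n) :
    dft (seg σ a j m) y =
      (dft σ y ^^ (duo a (a + m • (1 : Fin n)) y.1 && duo j (j + 1) y.2)) := by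
  induction m with
  | zero => simp [seg, duo]
  | succ m ih =>
    rw [seg, dft_flip, ih]
    have h1 : a + (m + 1) • (1 : Fin n) - 1 = a + m • (1 : Fin n) := by rw [succ_nsmul]; abel
    have h2 : j + 1 - 1 = j := by abel
    simp only [h1, h2]
    unfold duo
    generalize decide (y.1 = a) = p1
    generalize decide (y.1 = a + m • (1 : Fin n)) = p2
    generalize decide (y.1 = a + (m + 1) • (1 : Fin n)) = p3
    generalize decide (y.2 = j) = p4
    generalize decide (y.2 = j + 1) = p5
    generalize dft σ y = p6
    revert p1 p2 p3 p4 p5 p6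
    decide

lemma flip_inj {σ τ : ConfigP n} {x : Fin n × Fin n} (h : flipP n σ x = flipP n τ x) : σ = τ := by
  rw [← flip_flip σ x, h, flip_flip]

lemma seg_inj {σ τ : ConfigP n} {a j : Fin n} {m : ℕ} (h : seg σ a j m = seg τ a j m) : σ = τ := by
  induction m with
  | zero => exact h
  | succ m ih => exact ih (flip_inj h)

lemma nsmul_one_val (k : ℕ) : (k • (1 : Fin n)).val = k % n := by
  induction k with
  | zero => simp
  | succ k ih => rw [succ_nsmul, Fin.val_add, ih, Fin.val_one']; simp

lemma add_nsmul_inj {a : Fin n} {k l : ℕ} (hk : k < n) (hl : l < n)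
    (h : a + k • (1 : Fin n) = a + l • (1 : Fin n)) : k = l := by
  have h' := congrArg Fin.val (add_left_cancel h)
  rwa [nsmul_one_val, nsmul_one_val, Nat.mod_eq_of_lt hk, Nat.mod_eq_of_lt hl] at h'

lemma add_nsmul_ne {a : Fin n} {k : ℕ} (hk : 0 < k) (hl : k < n) : a + k • (1 : Fin n) ≠ a := by
  intro h
  have := add_nsmul_inj (a := a) (k := k) (l := 0) hl (hk.trans hl) (by simpa using h)
  omega

lemma nsmul_card : n • (1 : Fin n) = 0 := by
  apply Fin.ext; rw [nsmul_one_val]; simp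

lemma exists_add_nsmul {a b : Fin n} (h : b ≠ a) :
    ∃ k, 0 < k ∧ k < n ∧ b = a + k • (1 : Fin n) := by
  refine ⟨(b - a).val, ?_, (b - a).isLt, ?_⟩
  · rcases Nat.eq_zero_or_pos (b - a).val with h0 | h0
    · exact absurd (sub_eq_zero.1 (Fin.ext h0)) h
    · exact h0
  · have : (b - a).val • (1 : Fin n) = b - a := by
      apply Fin.ext; rw [nsmul_one_val, Nat.mod_eq_of_lt (b - a).isLt]
    rw [this]; abel

lemma succ_ne (hn : 2 ≤ n) (a : Fin n) : a + 1 ≠ a := by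
  have := add_nsmul_ne (a := a) (k := 1) one_pos (by omega)
  simpa using this

lemma pred_ne (hn : 2 ≤ n) (a : Fin n) : a - 1 ≠ a := by
  intro h
  exact succ_ne hn (a - 1) (by rw [sub_add_cancel]; exact h.symm)

/-- A function on the cycle that is invariant under the successor is constant. -/
lemma const_of_succ {α : Type*} {h : Fin n → α} (hs : ∀ i, h (i + 1) = h i) (i j : Fin n) :
    h i = h j := by
  have key : ∀ k : ℕ, h (j + k • (1 : Fin n)) = h j := by
    intro k
    induction k with
    | zero => simp
    | succ k ih => rw [succ_nsmul, ← add_assoc, hs, ih]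
  by_cases hij : i = j
  · rw [hij]
  · obtain ⟨k, -, -, hk⟩ := exists_add_nsmul hij
    rw [hk, key]

/-- `1 - 2 [dft]`, the change of the number of defects when toggling `y`. -/
def gain (σ : ConfigP n) (y : Fin n × Fin n) : ℤ := if dft σ y = true then -1 else 1

lemma ndef_toggle {σ τ : ConfigP n} {a b c d : Fin n} (hab : a ≠ b) (hcd : c ≠ d)
    (h : ∀ y, dft τ y = (dft σ y ^^ (duo a b y.1 && duo c d y.2))) :
    (ndef τ : ℤ) = ndef σ + (gain σ (a, c) + gain σ (a, d) + gain σ (b, c) + gain σ (b, d)) := by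
  have hN : ∀ ρ : ConfigP n, (ndef ρ : ℤ) = ∑ y, (if dft ρ y = true then (1 : ℤ) else 0) := by
    intro ρ; simp [ndef]
  have hterm : ∀ y, (if dft τ y = true then (1 : ℤ) else 0) = (if dft σ y = true then (1 : ℤ) else 0) +
      (if y ∈ ({a, b} : Finset (Fin n)) ×ˢ ({c, d} : Finset (Fin n)) then gain σ y else 0) := by
    intro y
    rw [h y]
    have hd : ∀ {u v t : Fin n}, u ≠ v → duo u v t = decide (t = u ∨ t = v) := by
      intro u v t huv
      unfold duo
      by_cases h1 : t = u <;> by_cases h2 : t = v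
      · exact absurd (h1.symm.trans h2) huv
      · simp [h1, huv]
      · simp [h2, huv.symm]
      · simp [h1, h2]
    rw [hd hab, hd hcd]
    simp only [Finset.mem_product, Finset.mem_insert, Finset.mem_singleton, gain]
    by_cases h1 : (y.1 = a ∨ y.1 = b) <;> by_cases h2 : (y.2 = c ∨ y.2 = d) <;>
      cases dft σ y <;> simp [h1, h2]
  rw [hN, hN, Finset.sum_congr rfl fun y _ => hterm y, Finset.sum_add_distrib]
  congr 1
  rw [Finset.sum_ite_mem, Finset.univ_inter, Finset.sum_product, Finset.sum_pair hab,
    Finset.sum_pair hcd, Finset.sum_pair hcd]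
  ring

/-- Transposition of the torus. -/
def tr (σ : ConfigP n) : ConfigP n := fun y => σ y.swap

lemma tr_tr (σ : ConfigP n) : tr (tr σ) = σ := rfl

lemma dft_tr (σ : ConfigP n) (y : Fin n × Fin n) : dft (tr σ) y = dft σ y.swap := by
  simp only [dft, tr, Prod.swap]
  generalize σ (y.2, y.1) = a
  generalize σ (y.2, y.1 + 1) = b
  generalize σ (y.2 + 1, y.1) = c
  generalize σ (y.2 + 1, y.1 + 1) = d
  revert a b c d
  decide

lemma exists_ne_dft_row {σ : ConfigP n} {a j : Fin n} (h : dft σ (a, j) = true) :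
    ∃ b, b ≠ a ∧ dft σ (b, j) = true := by
  by_contra hcon
  push Not at hcon
  have hprod : ∏ i, plaqP n σ (i, j) = 1 := by
    have hs : ∀ b, sval b * sval b = 1 := by intro b; cases b <;> norm_num [sval]
    simp only [plaqP, fsucc_eq, Finset.prod_mul_distrib]
    have e1 : ∏ i : Fin n, sval (σ (i + 1, j)) = ∏ i, sval (σ (i, j)) :=
      Equiv.prod_comp (Equiv.addRight (1 : Fin n)) (fun i => sval (σ (i, j)))
    have e2 : ∏ i : Fin n, sval (σ (i + 1, j + 1)) = ∏ i, sval (σ (i, j + 1)) :=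
      Equiv.prod_comp (Equiv.addRight (1 : Fin n)) (fun i => sval (σ (i, j + 1)))
    rw [e1, e2, mul_assoc, ← Finset.prod_mul_distrib, ← Finset.prod_mul_distrib]
    simp [hs]
  rw [Finset.prod_eq_single a] at hprod
  · rw [plaqP_eq, if_pos h] at hprod; norm_num at hprod
  · intro b _ hb
    rw [plaqP_eq, if_neg (hcon b hb)]; norm_num
  · simp

lemma exists_ne_dft_col {σ : ConfigP n} {a j : Fin n} (h : dft σ (a, j) = true) :
    ∃ k, k ≠ j ∧ dft σ (a, k) = true := by
  have h' : dft (tr σ) (j, a) = true := by rw [dft_tr]; exact h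
  obtain ⟨b, hb, hd⟩ := exists_ne_dft_row h'
  rw [dft_tr] at hd
  exact ⟨b, hb, hd⟩

/-- The ground states. -/
def Gr (n : ℕ) [NeZero n] : Finset (ConfigP n) := Finset.univ.filter fun σ => ∀ y, dft σ y = false

lemma mem_Gr {σ : ConfigP n} : σ ∈ Gr n ↔ ∀ y, dft σ y = false := by simp [Gr]

lemma ndef_eq_zero {σ : ConfigP n} : ndef σ = 0 ↔ σ ∈ Gr n := by
  simp [ndef, mem_Gr, Finset.filter_eq_empty_iff]

lemma ndef_pos {σ : ConfigP n} (h : σ ∉ Gr n) : 1 ≤ ndef σ :=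
  Nat.one_le_iff_ne_zero.2 fun h0 => h (ndef_eq_zero.1 h0)

lemma wt_Gr {β : ℝ} {σ : ConfigP n} (h : σ ∈ Gr n) : wt β σ = 1 := by
  simp [wt, ndef_eq_zero.2 h]

end Defects

/-! ### A Poincaré type inequality for the number of defects -/

section Iteration

variable {T : Type*} [Fintype T]

lemma sum_inj_le {S : Type*} {s : Finset S} {φ : S → T} {g : T → ℝ}
    (hφ : Set.InjOn φ s) (hg : ∀ t, 0 ≤ g t) : ∑ i ∈ s, g (φ i) ≤ ∑ t, g t := by
  rw [← Finset.sum_image (f := g) hφ]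
  exact Finset.sum_le_sum_of_subset_of_nonneg (Finset.subset_univ _) fun t _ _ => hg t

lemma sq_le_split {L : ℝ} (hL : 0 < L) (x y : ℝ) :
    x ^ 2 ≤ (1 + 1 / L) * y ^ 2 + (1 + L) * (x - y) ^ 2 := by
  have h : (1 + 1 / L) * y ^ 2 + (1 + L) * (x - y) ^ 2 - x ^ 2 =
      (y - L * (x - y)) ^ 2 / L := by field_simp; ring
  have : 0 ≤ (y - L * (x - y)) ^ 2 / L := by positivity
  linarith

/-- The points of `A` that reach `B` after exactly `k` applications of `nx`. -/
def reach (A B : Finset T) (nx : T → T) : ℕ → Finset T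
  | 0 => B
  | k + 1 => A.filter fun s => nx s ∈ reach A B nx k

lemma mem_reach_succ {A B : Finset T} {nx : T → T} {k : ℕ} {s : T} :
    s ∈ reach A B nx (k + 1) ↔ s ∈ A ∧ nx s ∈ reach A B nx k := by simp [reach]

lemma reach_disjoint {A B : Finset T} (hAB : Disjoint A B) (nx : T → T) {k l : ℕ} (hkl : k ≠ l)
    {s : T} (hk : s ∈ reach A B nx k) (hl : s ∈ reach A B nx l) : False := by
  induction k generalizing l s with
  | zero =>
    cases l with
    | zero => exact hkl rfl
    | succ l => exact Finset.disjoint_left.1 hAB (Finset.mem_filter.1 hl).1 hk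
  | succ k ih =>
    cases l with
    | zero => exact Finset.disjoint_left.1 hAB (Finset.mem_filter.1 hk).1 hl
    | succ l =>
      exact ih (fun h => hkl (congrArg _ h)) (Finset.mem_filter.1 hk).2 (Finset.mem_filter.1 hl).2

lemma sum_reach_le {A B D : Finset T} (hAB : Disjoint A B) {nx : T → T} (hinj : Set.InjOn nx A)
    {L : ℕ} (hL : 0 < L) (hD : ∀ s ∈ D, ∃ k < L, s ∈ reach A B nx k)
    {W F : T → ℝ} (hW : ∀ s, 0 ≤ W s) (hWn : ∀ s ∈ A, W (nx s) = W s) :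
    ∑ s ∈ D, W s * F s ^ 2 ≤ 3 * L * (∑ s ∈ B, W s * F s ^ 2 +
      (1 + L) * ∑ s ∈ A, W s * (F s - F (nx s)) ^ 2) := by
  have hL' : (0 : ℝ) < L := by exact_mod_cast hL
  set Δ : ℕ → ℝ := fun k => ∑ s ∈ reach A B nx (k + 1), W s * (F s - F (nx s)) ^ 2 with hΔ
  set G : ℕ → ℝ := fun k => ∑ s ∈ reach A B nx k, W s * F s ^ 2 with hG
  have hΔ0 : ∀ k, 0 ≤ Δ k := fun k =>
    Finset.sum_nonneg fun s _ => mul_nonneg (hW s) (sq_nonneg _)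
  have hG0 : ∀ k, 0 ≤ G k := fun k =>
    Finset.sum_nonneg fun s _ => mul_nonneg (hW s) (sq_nonneg _)
  have hstep : ∀ k, G (k + 1) ≤ (1 + 1 / L) * G k + (1 + L) * Δ k := by
    intro k
    have h1 : ∑ s ∈ reach A B nx (k + 1), W (nx s) * F (nx s) ^ 2 ≤ G k := by
      have hsub : (reach A B nx (k + 1)).image nx ⊆ reach A B nx k := by
        intro t ht
        obtain ⟨s, hs, rfl⟩ := Finset.mem_image.1 ht
        exact (Finset.mem_filter.1 hs).2
      have hinj' : Set.InjOn nx (reach A B nx (k + 1)) :=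
        hinj.mono fun s hs => (Finset.mem_filter.1 hs).1
      rw [← Finset.sum_image (f := fun t => W t * F t ^ 2) hinj']
      exact Finset.sum_le_sum_of_subset_of_nonneg hsub
        fun t _ _ => mul_nonneg (hW t) (sq_nonneg _)
    calc G (k + 1) ≤ ∑ s ∈ reach A B nx (k + 1), ((1 + 1 / L) * (W (nx s) * F (nx s) ^ 2) +
          (1 + L) * (W s * (F s - F (nx s)) ^ 2)) := by
          refine Finset.sum_le_sum fun s hs => ?_
          rw [hWn s (Finset.mem_filter.1 hs).1]
          have := mul_le_mul_of_nonneg_left (sq_le_split hL' (F s) (F (nx s))) (hW s)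
          linarith
      _ ≤ (1 + 1 / L) * G k + (1 + L) * Δ k := by
          rw [Finset.sum_add_distrib, ← Finset.mul_sum, ← Finset.mul_sum]
          gcongr
  have hsumΔ : ∑ k ∈ Finset.range L, Δ k ≤ ∑ s ∈ A, W s * (F s - F (nx s)) ^ 2 := by
    rw [← Finset.sum_biUnion]
    · refine Finset.sum_le_sum_of_subset_of_nonneg ?_
        fun t _ _ => mul_nonneg (hW t) (sq_nonneg _)
      intro s hs
      obtain ⟨k, -, hk⟩ := Finset.mem_biUnion.1 hs
      exact (Finset.mem_filter.1 hk).1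
    · intro k _ l _ hkl
      refine Finset.disjoint_left.2 fun s hk hl => ?_
      exact reach_disjoint hAB nx (fun h => hkl (Nat.succ_injective h)) hk hl
  have hind : ∀ k, G k ≤ (1 + 1 / (L : ℝ)) ^ k * (G 0 + (1 + L) * ∑ i ∈ Finset.range k, Δ i) := by
    intro k
    induction k with
    | zero => simp
    | succ k ih =>
      have hp : (1 : ℝ) ≤ (1 + 1 / (L : ℝ)) ^ (k + 1) := one_le_pow₀ (by simp)
      have h2 : 0 ≤ (1 + (L : ℝ)) * Δ k := mul_nonneg (by positivity) (hΔ0 k)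
      calc G (k + 1) ≤ (1 + 1 / L) * G k + (1 + L) * Δ k := hstep k
        _ ≤ (1 + 1 / L) * ((1 + 1 / (L : ℝ)) ^ k * (G 0 + (1 + L) * ∑ i ∈ Finset.range k, Δ i)) +
            (1 + 1 / (L : ℝ)) ^ (k + 1) * ((1 + L) * Δ k) := by
            refine add_le_add ?_ (le_mul_of_one_le_left h2 hp)
            gcongr
        _ = _ := by rw [Finset.sum_range_succ]; ring
  have hbd : ∀ k < L, G k ≤ 3 * (G 0 + (1 + L) * ∑ s ∈ A, W s * (F s - F (nx s)) ^ 2) := by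
    intro k hk
    have hexp : (1 + 1 / (L : ℝ)) ^ k ≤ 3 := by
      have h1 : (1 + 1 / (L : ℝ)) ≤ Real.exp (1 / L) := by
        have := Real.add_one_le_exp (1 / (L : ℝ)); linarith
      calc (1 + 1 / (L : ℝ)) ^ k ≤ (Real.exp (1 / L)) ^ k := by gcongr
        _ = Real.exp (k * (1 / L)) := by rw [Real.exp_nat_mul]
        _ ≤ Real.exp 1 := by
          apply Real.exp_le_exp.2
          rw [mul_one_div, div_le_one hL']
          exact_mod_cast hk.le
        _ ≤ 3 := Real.exp_one_lt_three.le
    refine (hind k).trans ?_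
    have h3 : ∑ i ∈ Finset.range k, Δ i ≤ ∑ i ∈ Finset.range L, Δ i :=
      Finset.sum_le_sum_of_subset_of_nonneg
        (Finset.range_subset_range.2 hk.le) fun i _ _ => hΔ0 i
    have h4 : 0 ≤ ∑ i ∈ Finset.range k, Δ i := Finset.sum_nonneg fun i _ => hΔ0 i
    have h5 := hG0 0
    gcongr
    exact h3.trans hsumΔ
  calc ∑ s ∈ D, W s * F s ^ 2
      ≤ ∑ s ∈ (Finset.range L).biUnion (reach A B nx), W s * F s ^ 2 := by
        refine Finset.sum_le_sum_of_subset_of_nonneg ?_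
          fun t _ _ => mul_nonneg (hW t) (sq_nonneg _)
        intro s hs
        obtain ⟨k, hk, hs⟩ := hD s hs
        exact Finset.mem_biUnion.2 ⟨k, Finset.mem_range.2 hk, hs⟩
    _ = ∑ k ∈ Finset.range L, G k := by
        rw [Finset.sum_biUnion]
        intro k _ l _ hkl
        exact Finset.disjoint_left.2 fun s hk hl => reach_disjoint hAB nx hkl hk hl
    _ ≤ ∑ k ∈ Finset.range L, 3 * (G 0 + (1 + L) * ∑ s ∈ A, W s * (F s - F (nx s)) ^ 2) :=
        Finset.sum_le_sum fun k hk => hbd k (Finset.mem_range.1 hk)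
    _ = _ := by
        rw [Finset.sum_const, Finset.card_range, nsmul_eq_mul]
        simp only [hG, reach]
        ring

end Iteration

section Flight

variable {n : ℕ} [NeZero n]

/-- The Dirichlet form with respect to the unnormalized weight. -/
def dirE (β : ℝ) (f : ConfigP n → ℝ) : ℝ :=
  (∑ σ : ConfigP n, ∑ x, cond β σ x * (f (flipP n σ x) - f σ) ^ 2) / 2

lemma dirE_nonneg (β : ℝ) (f : ConfigP n → ℝ) : 0 ≤ dirE β f := by
  unfold dirE
  have : 0 ≤ ∑ σ : ConfigP n, ∑ x, cond β σ x * (f (flipP n σ x) - f σ) ^ 2 :=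
    Finset.sum_nonneg fun σ _ => Finset.sum_nonneg fun x _ =>
      mul_nonneg (cond_nonneg β σ x) (sq_nonneg _)
  linarith

lemma duo_left {a b : Fin n} (h : a ≠ b) : duo a b a = true := by simp [duo, h]

lemma duo_right {a b : Fin n} (h : a ≠ b) : duo a b b = true := by simp [duo, h.symm]

lemma duo_of_ne {a b c : Fin n} (h : c ≠ a) (h' : c ≠ b) : duo a b c = false := by
  simp [duo, h, h']

/-- One of the two plaquettes at distance `m` to the right of `s`, in the row of `s` or in the next
row, is a defect. -/
def Hit (τ : ConfigP n) (s : Fin n × Fin n) (m : ℕ) : Prop :=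
  dft τ (s.1 + m • (1 : Fin n), s.2) = true ∨ dft τ (s.1 + m • (1 : Fin n), s.2 + 1) = true

/-- The distance from `s` to the first hit on its right. -/
def len (τ : ConfigP n) (s : Fin n × Fin n) : ℕ := sInf {m | 1 ≤ m ∧ m < n ∧ Hit τ s m}

lemma len_spec {τ : ConfigP n} {s : Fin n × Fin n} (h : dft τ s = true) :
    1 ≤ len τ s ∧ len τ s < n ∧ Hit τ s (len τ s) := by
  obtain ⟨b, hb, hd⟩ := exists_ne_dft_row (a := s.1) (j := s.2) h
  obtain ⟨k, hk, hkn, rfl⟩ := exists_add_nsmul hb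
  exact Nat.sInf_mem (s := {m | 1 ≤ m ∧ m < n ∧ Hit τ s m}) ⟨k, hk, hkn, Or.inl hd⟩

lemma not_hit {τ : ConfigP n} {s : Fin n × Fin n} (h : dft τ s = true) {m : ℕ} (hm : 1 ≤ m)
    (hl : m < len τ s) : ¬ Hit τ s m := fun hh =>
  Nat.notMem_of_lt_sInf hl ⟨hm, hl.trans (len_spec h).2.1, hh⟩

/-- Transport of the defect at `s` to the next row, along the flight of length `len τ s`. -/
def push (τ : ConfigP n) (s : Fin n × Fin n) : ConfigP n := seg τ s.1 s.2 (len τ s)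

/-- The end of the flight. -/
def tip (τ : ConfigP n) (s : Fin n × Fin n) : Fin n := s.1 + len τ s • (1 : Fin n)

lemma dft_push (τ : ConfigP n) (s y : Fin n × Fin n) :
    dft (push τ s) y = (dft τ y ^^ (duo s.1 (tip τ s) y.1 && duo s.2 (s.2 + 1) y.2)) :=
  dft_seg _ _ _ _ _

lemma tip_ne {τ : ConfigP n} {s : Fin n × Fin n} (h : dft τ s = true) : s.1 ≠ tip τ s :=
  (add_nsmul_ne (len_spec h).1 (len_spec h).2.1).symm

lemma hit_tip {τ : ConfigP n} {s : Fin n × Fin n} (h : dft τ s = true) :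
    dft τ (tip τ s, s.2) = true ∨ dft τ (tip τ s, s.2 + 1) = true := (len_spec h).2.2

/-- The pairs of a configuration and one of its defects. -/
def defectPairs (n : ℕ) [NeZero n] : Finset (ConfigP n × (Fin n × Fin n)) :=
  Finset.univ.filter fun q => dft q.1 q.2 = true

/-- The flight annihilates defects. -/
def Term (q : ConfigP n × (Fin n × Fin n)) : Prop :=
  dft q.1 (q.2.1, q.2.2 + 1) = true ∨
    (dft q.1 (tip q.1 q.2, q.2.2) = true ∧ dft q.1 (tip q.1 q.2, q.2.2 + 1) = true)

/-- The pairs whose flight annihilates defects. -/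
def termPairs (n : ℕ) [NeZero n] : Finset (ConfigP n × (Fin n × Fin n)) :=
  (defectPairs n).filter Term

/-- The pairs whose flight preserves the number of defects. -/
def movePairs (n : ℕ) [NeZero n] : Finset (ConfigP n × (Fin n × Fin n)) :=
  (defectPairs n).filter fun q => ¬ Term q

/-- The defect after its flight. -/
def nextPair (q : ConfigP n × (Fin n × Fin n)) : ConfigP n × (Fin n × Fin n) :=
  (push q.1 q.2, (q.2.1, q.2.2 + 1))

lemma mem_defectPairs {q : ConfigP n × (Fin n × Fin n)} :
    q ∈ defectPairs n ↔ dft q.1 q.2 = true := by simp [defectPairs]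

lemma mem_movePairs {q : ConfigP n × (Fin n × Fin n)} : q ∈ movePairs n ↔
    dft q.1 q.2 = true ∧ dft q.1 (q.2.1, q.2.2 + 1) = false ∧
      dft q.1 (tip q.1 q.2, q.2.2) = !dft q.1 (tip q.1 q.2, q.2.2 + 1) := by
  rw [movePairs, Finset.mem_filter, mem_defectPairs, Term]
  constructor
  · rintro ⟨h, h'⟩
    refine ⟨h, ?_⟩
    have := hit_tip h
    revert this h'
    generalize dft q.1 (tip q.1 q.2, q.2.2) = u
    generalize dft q.1 (tip q.1 q.2, q.2.2 + 1) = v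
    generalize dft q.1 (q.2.1, q.2.2 + 1) = w
    cases u <;> cases v <;> cases w <;> simp
  · rintro ⟨h, h1, h2⟩
    refine ⟨h, ?_⟩
    rw [h1, h2]
    cases dft q.1 (tip q.1 q.2, q.2.2 + 1) <;> simp

lemma mem_termPairs {q : ConfigP n × (Fin n × Fin n)} :
    q ∈ termPairs n ↔ dft q.1 q.2 = true ∧ Term q := by simp [termPairs, defectPairs]

lemma ndef_push_move (hn : 2 ≤ n) {q : ConfigP n × (Fin n × Fin n)} (hq : q ∈ movePairs n) :
    ndef (push q.1 q.2) = ndef q.1 := by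
  obtain ⟨h, h1, h2⟩ := mem_movePairs.1 hq
  have := ndef_toggle (tip_ne h) (succ_ne hn q.2.2).symm (dft_push q.1 q.2)
  have hq2 : dft q.1 (q.2.1, q.2.2) = true := h
  simp only [gain, hq2, h1, h2] at this
  have h3 : (ndef (push q.1 q.2) : ℤ) = ndef q.1 := by
    rw [this]
    cases dft q.1 (tip q.1 q.2, q.2.2 + 1) <;> simp
  exact_mod_cast h3

lemma nextPair_mem (hn : 2 ≤ n) {q : ConfigP n × (Fin n × Fin n)} (hq : q ∈ movePairs n) :
    nextPair q ∈ defectPairs n := by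
  obtain ⟨h, h1, h2⟩ := mem_movePairs.1 hq
  simp only [nextPair, mem_defectPairs, dft_push, h1, duo_left (tip_ne h),
    duo_right (succ_ne hn q.2.2).symm]
  rfl

lemma len_push (hn : 2 ≤ n) {q : ConfigP n × (Fin n × Fin n)} (hq : q ∈ movePairs n) :
    len (push q.1 q.2) q.2 = len q.1 q.2 := by
  obtain ⟨h, h1, h2⟩ := mem_movePairs.1 hq
  unfold len
  congr 1
  ext m
  simp only [Set.mem_ofPred_eq]
  refine and_congr_right fun hm1 => and_congr_right fun hmn => ?_
  unfold Hit
  rw [dft_push, dft_push]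
  simp only [duo_left (succ_ne hn q.2.2).symm, duo_right (succ_ne hn q.2.2).symm, Bool.and_true]
  by_cases hm : m = len q.1 q.2
  · subst hm
    change (_ ^^ duo q.2.1 (tip q.1 q.2) (tip q.1 q.2)) = true ∨
      (_ ^^ duo q.2.1 (tip q.1 q.2) (tip q.1 q.2)) = true ↔ dft q.1 (tip q.1 q.2, q.2.2) = true ∨
        dft q.1 (tip q.1 q.2, q.2.2 + 1) = true
    rw [duo_right (tip_ne h)]
    change (dft q.1 (tip q.1 q.2, q.2.2) ^^ true) = true ∨
      (dft q.1 (tip q.1 q.2, q.2.2 + 1) ^^ true) = true ↔ _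
    rw [h2]
    cases dft q.1 (tip q.1 q.2, q.2.2 + 1) <;> simp
  · have hm' : q.2.1 + m • (1 : Fin n) ≠ tip q.1 q.2 :=
      fun hh => hm (add_nsmul_inj hmn (len_spec h).2.1 hh)
    rw [duo_of_ne (add_nsmul_ne hm1 hmn) hm']
    simp

lemma nextPair_injOn (hn : 2 ≤ n) : Set.InjOn (nextPair (n := n)) (movePairs n) := by
  rintro ⟨τ, a, j⟩ hq ⟨τ', a', j'⟩ hq' h
  simp only [nextPair, Prod.mk.injEq, add_left_inj] at h
  obtain ⟨h1, rfl, rfl⟩ := h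
  have e1 := len_push hn hq
  have e2 := len_push hn hq'
  simp only at e1 e2
  have e : len τ (a, j) = len τ' (a, j) := by rw [← e1, h1, e2]
  unfold push at h1
  rw [e] at h1
  rw [seg_inj h1]

lemma exists_reach (hn : 2 ≤ n) {q : ConfigP n × (Fin n × Fin n)} (hq : dft q.1 q.2 = true) :
    ∃ k < n, q ∈ reach (movePairs n) (termPairs n) nextPair k := by
  have key : ∀ (k : ℕ) (q : ConfigP n × (Fin n × Fin n)), dft q.1 q.2 = true → 1 ≤ k → k < n →
      dft q.1 (q.2.1, q.2.2 + k • (1 : Fin n)) = true →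
      ∃ i < k, q ∈ reach (movePairs n) (termPairs n) nextPair i := by
    intro k
    induction k with
    | zero => intro q _ h; omega
    | succ k ih =>
      intro q hq _ hkn hd
      by_cases ht : Term q
      · exact ⟨0, by omega, mem_termPairs.2 ⟨hq, ht⟩⟩
      have hm : q ∈ movePairs n := Finset.mem_filter.2 ⟨mem_defectPairs.2 hq, ht⟩
      have hk : 1 ≤ k := by
        by_contra hk
        have : k = 0 := by omega
        subst this
        exact ht (Or.inl (by simpa using hd))
      have hd' : dft (nextPair q).1 ((nextPair q).2.1, (nextPair q).2.2 + k • (1 : Fin n)) = true := by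
        have e : q.2.2 + 1 + k • (1 : Fin n) = q.2.2 + (k + 1) • (1 : Fin n) := by
          rw [succ_nsmul]; abel
        have e2 : q.2.2 + 1 = q.2.2 + 1 • (1 : Fin n) := by rw [one_nsmul]
        have h1 : q.2.2 + (k + 1) • (1 : Fin n) ≠ q.2.2 := add_nsmul_ne (by omega) hkn
        have h2 : q.2.2 + (k + 1) • (1 : Fin n) ≠ q.2.2 + 1 := by
          intro hh
          rw [e2] at hh
          have := add_nsmul_inj hkn (by omega) hh
          omega
        simp only [nextPair, dft_push, e, duo_of_ne h1 h2, Bool.and_false, Bool.xor_false]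
        exact hd
      obtain ⟨i, hi, hr⟩ := ih (nextPair q) (mem_defectPairs.1 (nextPair_mem hn hm)) hk
        (by omega) hd'
      exact ⟨i + 1, by omega, mem_reach_succ.2 ⟨hm, hr⟩⟩
  obtain ⟨b, hb, hd⟩ := exists_ne_dft_col (a := q.2.1) (j := q.2.2) hq
  obtain ⟨k, hk, hkn, rfl⟩ := exists_add_nsmul hb
  obtain ⟨i, hi, hr⟩ := key k q hq hk hkn hd
  exact ⟨i, by omega, hr⟩

lemma sum_defectPairs (g : ConfigP n → ℝ) :
    ∑ q ∈ defectPairs n, g q.1 = ∑ σ, g σ * ndef σ := by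
  unfold defectPairs
  rw [Finset.sum_filter, Fintype.sum_prod_type]
  refine Finset.sum_congr rfl fun σ _ => ?_
  rw [ndef_cast, Finset.mul_sum]
  refine Finset.sum_congr rfl fun y _ => ?_
  simp only [mul_ite, mul_one, mul_zero]

lemma sum_termPairs_move (hn : 2 ≤ n) (β : ℝ) (f : ConfigP n → ℝ) :
    ∑ σ, wt β σ * ndef σ * f σ ^ 2 ≤ 3 * n * (∑ q ∈ termPairs n, wt β q.1 * f q.1 ^ 2 +
      (1 + n) * ∑ q ∈ movePairs n, wt β q.1 * (f q.1 - f (push q.1 q.2)) ^ 2) := by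
  have hdis : Disjoint (movePairs n) (termPairs n) :=
    Finset.disjoint_left.2 fun q h h' => (Finset.mem_filter.1 h).2 (Finset.mem_filter.1 h').2
  have := sum_reach_le hdis (nextPair_injOn hn) (L := n) (by omega) (D := defectPairs n)
    (fun q hq => exists_reach hn (mem_defectPairs.1 hq)) (W := fun q => wt β q.1)
    (F := fun q => f q.1) (fun q => (wt_pos β q.1).le) (fun q hq => by
      simp only [nextPair, wt, ndef_push_move hn hq])
  rw [sum_defectPairs (fun σ => wt β σ * f σ ^ 2)] at this
  refine le_trans (le_of_eq ?_) this
  exact Finset.sum_congr rfl fun σ _ => by ring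

end Flight

section Poincare

variable {n : ℕ} [NeZero n]

lemma gain_le (σ : ConfigP n) (y : Fin n × Fin n) : gain σ y ≤ 1 := by
  unfold gain; split_ifs <;> norm_num

lemma gain_true {σ : ConfigP n} {y : Fin n × Fin n} (h : dft σ y = true) : gain σ y = -1 := by
  simp [gain, h]

lemma gain_false {σ : ConfigP n} {y : Fin n × Fin n} (h : dft σ y = false) : gain σ y = 1 := by
  simp [gain, h]

lemma ndef_seg {τ : ConfigP n} {a j : Fin n} (hn : 2 ≤ n) {k : ℕ} (hk : 1 ≤ k) (hkn : k < n) :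
    (ndef (seg τ a j k) : ℤ) = ndef τ + (gain τ (a, j) + gain τ (a, j + 1) +
      gain τ (a + k • (1 : Fin n), j) + gain τ (a + k • (1 : Fin n), j + 1)) :=
  ndef_toggle (add_nsmul_ne hk hkn).symm (succ_ne hn j).symm (dft_seg τ a j k)

lemma ndef_seg_le {τ : ConfigP n} {a j : Fin n} (hn : 2 ≤ n) (h : dft τ (a, j) = true) {k : ℕ}
    (hkn : k < n) : ndef (seg τ a j k) ≤ ndef τ + 2 := by
  rcases Nat.eq_zero_or_pos k with rfl | hk
  · simp [seg]
  have h1 := ndef_seg (τ := τ) (a := a) (j := j) hn hk hkn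
  rw [gain_true h] at h1
  have h2 := gain_le τ (a, j + 1)
  have h3 := gain_le τ (a + k • (1 : Fin n), j)
  have h4 := gain_le τ (a + k • (1 : Fin n), j + 1)
  omega

lemma ndef_seg_le' {τ : ConfigP n} {a j : Fin n} (hn : 2 ≤ n) (h : dft τ (a, j) = true)
    (h' : dft τ (a, j + 1) = true) {k : ℕ} (hkn : k < n) : ndef (seg τ a j k) ≤ ndef τ := by
  rcases Nat.eq_zero_or_pos k with rfl | hk
  · simp [seg]
  have h1 := ndef_seg (τ := τ) (a := a) (j := j) hn hk hkn
  rw [gain_true h, gain_true h'] at h1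
  have h3 := gain_le τ (a + k • (1 : Fin n), j)
  have h4 := gain_le τ (a + k • (1 : Fin n), j + 1)
  omega

lemma wt_le_of_ndef {β : ℝ} (hβ : 0 ≤ β) {σ τ : ConfigP n} {k : ℕ} (h : ndef τ ≤ ndef σ + k) :
    wt β σ ≤ Real.exp (k * β) * wt β τ := by
  unfold wt
  rw [← Real.exp_add]
  apply Real.exp_le_exp.2
  have : (ndef τ : ℝ) ≤ ndef σ + k := by exact_mod_cast h
  nlinarith

/-- The edge crossed at step `m` of a flight. -/
def flightEdge (q : (ConfigP n × (Fin n × Fin n)) × Fin n) : ConfigP n × (Fin n × Fin n) :=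
  (seg q.1.1 q.1.2.1 q.1.2.2 q.2, (q.1.2.1 + ((q.2 : ℕ) + 1) • (1 : Fin n), q.1.2.2 + 1))

lemma flightEdge_injOn_aux (hn : 2 ≤ n) {τ τ' : ConfigP n} {a a' j : Fin n} {m m' : ℕ}
    (h : dft τ (a, j) = true) (hl : dft τ (a, j + 1) = false) (hm : m < len τ (a, j))
    (h' : dft τ' (a', j) = true) (hm' : m' < len τ' (a', j))
    (hmm : m < m')
    (e : a + m • (1 : Fin n) = a' + m' • (1 : Fin n)) (eυ : seg τ a j m = seg τ' a' j m') :
    False := by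
  have hj := (succ_ne hn j).symm
  have hmn' : m' < n := hm'.trans (len_spec h').2.1
  have nohit : ∀ k, 1 ≤ k → k < m' → dft (seg τ' a' j m') (a' + k • (1 : Fin n), j + 1) = false := by
    intro k hk hkm
    have := not_hit h' hk (hkm.trans hm')
    simp only [Hit, not_or, Bool.not_eq_true] at this
    rw [dft_seg, this.2, duo_of_ne (add_nsmul_ne hk (hkm.trans hmn'))
      (fun hh => hkm.ne (add_nsmul_inj (hkm.trans hmn') hmn' hh))]
    rfl
  rcases Nat.eq_zero_or_pos m with rfl | hm0
  · have h1 : dft (seg τ' a' j m') (a' + m' • (1 : Fin n), j + 1) = true := by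
      have := not_hit h' hmm hm'
      simp only [Hit, not_or, Bool.not_eq_true] at this
      rw [dft_seg, this.2, duo_right (add_nsmul_ne hmm hmn').symm, duo_right hj]
      rfl
    rw [← e, ← eυ, zero_nsmul, add_zero] at h1
    rw [seg, hl] at h1
    cases h1
  · have hmn : m < n := hm.trans (len_spec h).2.1
    have h1 : dft (seg τ a j m) (a, j + 1) = true := by
      rw [dft_seg, hl, duo_left (add_nsmul_ne hm0 hmn).symm, duo_right hj]
      rfl
    have ea : a = a' + (m' - m) • (1 : Fin n) := by
      have : m' • (1 : Fin n) = (m' - m) • (1 : Fin n) + m • (1 : Fin n) := by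
        rw [← add_nsmul]; congr 1; omega
      rw [this, ← add_assoc] at e
      exact add_right_cancel e
    rw [eυ, ea, nohit (m' - m) (by omega) (by omega)] at h1
    cases h1

lemma flightEdge_injOn (hn : 2 ≤ n) : Set.InjOn (flightEdge (n := n))
    {q | dft q.1.1 q.1.2 = true ∧ dft q.1.1 (q.1.2.1, q.1.2.2 + 1) = false ∧
      (q.2 : ℕ) < len q.1.1 q.1.2} := by
  rintro ⟨⟨τ, a, j⟩, m⟩ ⟨h, hl, hm⟩ ⟨⟨τ', a', j'⟩, m'⟩ ⟨h', hl', hm'⟩ e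
  simp only [flightEdge, Prod.mk.injEq, add_left_inj] at e
  obtain ⟨eυ, e, rfl⟩ := e
  rw [succ_nsmul, succ_nsmul, ← add_assoc, ← add_assoc] at e
  have e := add_right_cancel e
  simp only at h hl hm h' hl' hm'
  rcases lt_trichotomy (m : ℕ) m' with hlt | heq | hgt
  · exact (flightEdge_injOn_aux hn h hl hm h' hm' hlt e eυ).elim
  · have : m = m' := Fin.ext heq
    subst this
    have := add_right_cancel e
    subst this
    rw [seg_inj eυ]
  · exact (flightEdge_injOn_aux hn h' hl' hm' h hm hgt e.symm eυ.symm).elim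

/-- The energy of an edge. -/
def edgeE (β : ℝ) (f : ConfigP n → ℝ) (e : ConfigP n × (Fin n × Fin n)) : ℝ :=
  cond β e.1 e.2 * (f (flipP n e.1 e.2) - f e.1) ^ 2

lemma edgeE_nonneg (β : ℝ) (f : ConfigP n → ℝ) (e : ConfigP n × (Fin n × Fin n)) :
    0 ≤ edgeE β f e := mul_nonneg (cond_nonneg _ _ _) (sq_nonneg _)

lemma sum_edgeE (β : ℝ) (f : ConfigP n → ℝ) : ∑ e, edgeE β f e = 2 * dirE β f := by
  rw [Fintype.sum_prod_type, dirE]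
  simp only [edgeE]
  ring

lemma flight_energy (hn : 2 ≤ n) {β : ℝ} (hβ : 0 ≤ β) (f : ConfigP n → ℝ) :
    ∑ q ∈ defectPairs n, wt β q.1 * (f q.1 - f (push q.1 q.2)) ^ 2 ≤
      n * (Real.exp (2 * β) + n) * (2 * dirE β f) := by
  have hpt : ∀ q ∈ defectPairs n, wt β q.1 * (f q.1 - f (push q.1 q.2)) ^ 2 ≤
      n * ∑ m : Fin n, (if (m : ℕ) < len q.1 q.2 then
        (if dft q.1 (q.2.1, q.2.2 + 1) = false then
          Real.exp (2 * β) * edgeE β f (flightEdge (q, m)) else edgeE β f (flightEdge (q, m)))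
        else 0) := by
    rintro ⟨τ, a, j⟩ hq
    have h : dft τ (a, j) = true := mem_defectPairs.1 hq
    obtain ⟨-, hln, -⟩ := len_spec h
    simp only
    set ℓ := len τ (a, j) with hℓ
    set Δ : ℕ → ℝ := fun m => f (seg τ a j m) - f (seg τ a j (m + 1)) with hΔ
    have h1 : f τ - f (push τ (a, j)) = ∑ m ∈ Finset.range ℓ, Δ m := by
      rw [hΔ, Finset.sum_range_sub']
      rfl
    have h2 : (f τ - f (push τ (a, j))) ^ 2 ≤ n * ∑ m ∈ Finset.range ℓ, Δ m ^ 2 := by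
      rw [h1]
      refine (sq_sum_le_card_mul_sum_sq).trans ?_
      rw [Finset.card_range]
      have : (ℓ : ℝ) ≤ n := by exact_mod_cast hln.le
      have : 0 ≤ ∑ m ∈ Finset.range ℓ, Δ m ^ 2 := Finset.sum_nonneg fun _ _ => sq_nonneg _
      gcongr
    have h3 : ∑ m ∈ Finset.range ℓ, Δ m ^ 2 =
        ∑ m : Fin n, if (m : ℕ) < ℓ then Δ m ^ 2 else 0 := by
      rw [Fin.sum_univ_eq_sum_range (fun m => if m < ℓ then Δ m ^ 2 else 0) n,
        ← Finset.sum_filter]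
      congr 1
      ext m
      simp only [Finset.mem_range, Finset.mem_filter]
      omega
    calc wt β τ * (f τ - f (push τ (a, j))) ^ 2
        ≤ wt β τ * (n * ∑ m ∈ Finset.range ℓ, Δ m ^ 2) :=
          mul_le_mul_of_nonneg_left h2 (wt_pos β τ).le
      _ = n * ∑ m : Fin n, (if (m : ℕ) < ℓ then wt β τ * Δ m ^ 2 else 0) := by
          rw [h3, mul_left_comm, Finset.mul_sum]
          congr 1
          refine Finset.sum_congr rfl fun m _ => ?_
          rw [mul_ite, mul_zero]
      _ ≤ _ := by
          refine mul_le_mul_of_nonneg_left (Finset.sum_le_sum fun m _ => ?_) (by positivity)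
          by_cases hm : (m : ℕ) < ℓ
          swap
          · simp [hm]
          rw [if_pos hm, if_pos hm]
          have hE : edgeE β f (flightEdge ((τ, a, j), m)) =
              min (wt β (seg τ a j m)) (wt β (seg τ a j (m + 1))) * Δ m ^ 2 := by
            simp only [edgeE, flightEdge, cond, hΔ, seg]
            ring
          have hs : (0 : ℝ) ≤ Δ m ^ 2 := sq_nonneg _
          rw [hE]
          by_cases hl : dft τ (a, j + 1) = false
          · rw [if_pos hl, ← mul_assoc]
            refine mul_le_mul_of_nonneg_right ?_ hs
            rw [mul_min_of_nonneg _ _ (Real.exp_pos _).le]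
            have w1 := wt_le_of_ndef hβ (ndef_seg_le hn h (k := m) (by omega))
            have w2 := wt_le_of_ndef hβ (ndef_seg_le hn h (k := m + 1) (by omega))
            push_cast at w1 w2
            exact le_min w1 w2
          · rw [if_neg hl]
            refine mul_le_mul_of_nonneg_right ?_ hs
            have hl' : dft τ (a, j + 1) = true := by simpa using hl
            have w1 := wt_le_of_ndef hβ (k := 0) (ndef_seg_le' hn h hl' (k := m) (by omega))
            have w2 := wt_le_of_ndef hβ (k := 0) (ndef_seg_le' hn h hl' (k := m + 1) (by omega))
            simp only [Nat.cast_zero, zero_mul, Real.exp_zero, one_mul] at w1 w2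
            exact le_min w1 w2
  set S1 : Finset ((ConfigP n × (Fin n × Fin n)) × Fin n) := Finset.univ.filter fun q =>
    dft q.1.1 q.1.2 = true ∧ dft q.1.1 (q.1.2.1, q.1.2.2 + 1) = false ∧
      (q.2 : ℕ) < len q.1.1 q.1.2 with hS1
  set S2 : Finset ((ConfigP n × (Fin n × Fin n)) × Fin n) := Finset.univ.filter fun q =>
    dft q.1.1 q.1.2 = true ∧ ¬ dft q.1.1 (q.1.2.1, q.1.2.2 + 1) = false ∧
      (q.2 : ℕ) < len q.1.1 q.1.2 with hS2
  have hsum1 : ∑ q ∈ S1, edgeE β f (flightEdge q) ≤ 2 * dirE β f := by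
    rw [← sum_edgeE]
    refine sum_inj_le ((flightEdge_injOn hn).mono ?_) (edgeE_nonneg β f)
    intro q hq
    simpa [hS1] using hq
  have hsum2 : ∑ q ∈ S2, edgeE β f (flightEdge q) ≤ n * (2 * dirE β f) := by
    have hinj : Set.InjOn (fun q : (ConfigP n × (Fin n × Fin n)) × Fin n => (flightEdge q, q.2))
        S2 := by
      rintro ⟨⟨τ, a, j⟩, m⟩ - ⟨⟨τ', a', j'⟩, m'⟩ - e
      simp only [flightEdge, Prod.mk.injEq, add_left_inj] at e
      obtain ⟨⟨e1, e2, rfl⟩, rfl⟩ := e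
      have e2 := add_right_cancel e2
      subst e2
      rw [seg_inj e1]
    refine (sum_inj_le (g := fun r : (ConfigP n × (Fin n × Fin n)) × Fin n => edgeE β f r.1) hinj
      fun r => edgeE_nonneg β f r.1).trans ?_
    rw [Fintype.sum_prod_type]
    simp only [Finset.sum_const, Finset.card_univ, Fintype.card_fin, nsmul_eq_mul,
      ← Finset.mul_sum, sum_edgeE]
    exact le_rfl
  have hsplit : ∑ q ∈ defectPairs n, ∑ m : Fin n, (if (m : ℕ) < len q.1 q.2 then
        (if dft q.1 (q.2.1, q.2.2 + 1) = false then
          Real.exp (2 * β) * edgeE β f (flightEdge (q, m)) else edgeE β f (flightEdge (q, m)))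
        else 0) = Real.exp (2 * β) * ∑ q ∈ S1, edgeE β f (flightEdge q) +
          ∑ q ∈ S2, edgeE β f (flightEdge q) := by
    rw [hS1, hS2, Finset.sum_filter, Finset.sum_filter, Finset.mul_sum, ← Finset.sum_add_distrib,
      Fintype.sum_prod_type, defectPairs, Finset.sum_filter]
    refine Finset.sum_congr rfl fun q _ => ?_
    by_cases h1 : dft q.1 q.2 = true
    swap
    · simp [h1]
    rw [if_pos h1]
    refine Finset.sum_congr rfl fun m _ => ?_
    by_cases h2 : dft q.1 (q.2.1, q.2.2 + 1) = false <;>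
      by_cases h3 : (m : ℕ) < len q.1 q.2 <;> simp [h1, h2, h3]
  refine (Finset.sum_le_sum hpt).trans ?_
  rw [← Finset.mul_sum, hsplit, mul_assoc]
  refine mul_le_mul_of_nonneg_left ?_ (by positivity)
  have := mul_le_mul_of_nonneg_left hsum1 (Real.exp_pos (2 * β)).le
  linarith

end Poincare

section Absorption

variable {n : ℕ} [NeZero n]

/-- The indicator of a defect. -/
def ind (σ : ConfigP n) (y : Fin n × Fin n) : ℝ := if dft σ y = true then 1 else 0

lemma ind_nonneg (σ : ConfigP n) (y : Fin n × Fin n) : 0 ≤ ind σ y := by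
  unfold ind; split_ifs <;> norm_num

lemma ind_true {σ : ConfigP n} {y : Fin n × Fin n} (h : dft σ y = true) : ind σ y = 1 := by
  simp [ind, h]

lemma sum_ind (σ : ConfigP n) : ∑ a, ∑ j, ind σ (a, j) = ndef σ := by
  rw [ndef_cast, Fintype.sum_prod_type]; rfl

lemma sum_ind_succ (σ : ConfigP n) : ∑ a, ∑ j, ind σ (a, j + 1) = ndef σ := by
  rw [← sum_ind]
  exact Finset.sum_congr rfl fun a _ =>
    Equiv.sum_comp (Equiv.addRight (1 : Fin n)) (fun j => ind σ (a, j))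

lemma wt_eq_of_ndef {β : ℝ} {σ τ : ConfigP n} {k : ℕ} (h : ndef σ = ndef τ + k) :
    wt β σ = wt β τ * Real.exp (-(k * β)) := by
  unfold wt
  rw [← Real.exp_add, h]
  push_cast
  ring_nf

lemma wt_term_le (hn : 2 ≤ n) (β : ℝ) {τ : ConfigP n} {s : Fin n × Fin n}
    (hq : (τ, s) ∈ termPairs n) :
    wt β τ ≤ wt β (push τ s) * (Real.exp (-(2 * β)) * (ind (push τ s) (s.1, s.2 + 1) +
      ind (push τ s) (tip τ s, s.2) + ind (push τ s) (tip τ s, s.2 + 1)) +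
      Real.exp (-(4 * β))) := by
  obtain ⟨h, ht⟩ := mem_termPairs.1 hq
  simp only at h
  have hj := (succ_ne hn s.2).symm
  have hN := ndef_toggle (tip_ne h) hj (dft_push τ s)
  have i1 := ind_nonneg (push τ s) (s.1, s.2 + 1)
  have i2 := ind_nonneg (push τ s) (tip τ s, s.2)
  have i3 := ind_nonneg (push τ s) (tip τ s, s.2 + 1)
  have e2 := Real.exp_pos (-(2 * β))
  have e4 := Real.exp_pos (-(4 * β))
  have hs : dft τ (s.1, s.2) = true := h
  rw [gain_true hs] at hN
  have two : ndef τ = ndef (push τ s) + 2 → 1 ≤ ind (push τ s) (s.1, s.2 + 1) +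
      ind (push τ s) (tip τ s, s.2) + ind (push τ s) (tip τ s, s.2 + 1) →
      wt β τ ≤ wt β (push τ s) * (Real.exp (-(2 * β)) * (ind (push τ s) (s.1, s.2 + 1) +
      ind (push τ s) (tip τ s, s.2) + ind (push τ s) (tip τ s, s.2 + 1)) +
      Real.exp (-(4 * β))) := by
    intro h2 hi
    rw [wt_eq_of_ndef h2]
    refine mul_le_mul_of_nonneg_left ?_ (wt_pos _ _).le
    push_cast
    nlinarith
  by_cases hl : dft τ (s.1, s.2 + 1) = true
  · rw [gain_true hl] at hN
    by_cases hb1 : dft τ (tip τ s, s.2) = true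
    · by_cases hb2 : dft τ (tip τ s, s.2 + 1) = true
      · rw [gain_true hb1, gain_true hb2] at hN
        rw [wt_eq_of_ndef (show ndef τ = ndef (push τ s) + 4 by omega)]
        refine mul_le_mul_of_nonneg_left ?_ (wt_pos _ _).le
        push_cast
        nlinarith
      · have hb2 : dft τ (tip τ s, s.2 + 1) = false := by simpa using hb2
        rw [gain_true hb1, gain_false hb2] at hN
        refine two (by omega) ?_
        rw [ind_true (y := (tip τ s, s.2 + 1))]
        · linarith
        · rw [dft_push, hb2, duo_right (tip_ne h), duo_right hj]; rfl
    · have hb1 : dft τ (tip τ s, s.2) = false := by simpa using hb1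
      have hb2 : dft τ (tip τ s, s.2 + 1) = true := by
        have := hit_tip h
        rw [hb1] at this
        simpa using this
      rw [gain_false hb1, gain_true hb2] at hN
      refine two (by omega) ?_
      rw [ind_true (y := (tip τ s, s.2))]
      · linarith
      · rw [dft_push, hb1, duo_right (tip_ne h), duo_left hj]; rfl
  · obtain ⟨hb1, hb2⟩ := ht.resolve_left hl
    have hl : dft τ (s.1, s.2 + 1) = false := by simpa using hl
    simp only at hb1 hb2
    rw [gain_false hl, gain_true hb1, gain_true hb2] at hN
    refine two (by omega) ?_
    rw [ind_true (y := (s.1, s.2 + 1))]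
    · linarith
    · rw [dft_push, hl, duo_left (tip_ne h), duo_right hj]; rfl

lemma sum_term_le (hn : 2 ≤ n) (β : ℝ) {F : ConfigP n → ℝ} (hF : ∀ σ, 0 ≤ F σ) :
    ∑ q ∈ termPairs n, wt β q.1 * F (push q.1 q.2) ≤
      ∑ υ, wt β υ * F υ * (3 * n * ndef υ * Real.exp (-(2 * β)) +
        (n : ℝ) ^ 3 * Real.exp (-(4 * β))) := by
  set H : ConfigP n × ((Fin n × Fin n) × Fin n) → ℝ := fun r =>
    wt β r.1 * F r.1 * (Real.exp (-(2 * β)) * (ind r.1 (r.2.1.1, r.2.1.2 + 1) +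
      ind r.1 (r.2.2, r.2.1.2) + ind r.1 (r.2.2, r.2.1.2 + 1)) + Real.exp (-(4 * β))) with hH
  have hH0 : ∀ r, 0 ≤ H r := fun r => by
    have := ind_nonneg r.1 (r.2.1.1, r.2.1.2 + 1)
    have := ind_nonneg r.1 (r.2.2, r.2.1.2)
    have := ind_nonneg r.1 (r.2.2, r.2.1.2 + 1)
    have := wt_pos β r.1
    have := hF r.1
    simp only [hH]
    positivity
  have hinj : Set.InjOn (fun q : ConfigP n × (Fin n × Fin n) =>
      ((push q.1 q.2, (q.2, tip q.1 q.2)) : ConfigP n × ((Fin n × Fin n) × Fin n)))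
      (termPairs n) := by
    rintro ⟨τ, s⟩ hq ⟨τ', s'⟩ hq' e
    simp only [Prod.mk.injEq] at e
    obtain ⟨e1, rfl, e2⟩ := e
    have hlen := add_nsmul_inj (len_spec (mem_termPairs.1 hq).1).2.1
      (len_spec (mem_termPairs.1 hq').1).2.1 e2
    simp only at hlen
    unfold push at e1
    rw [hlen] at e1
    rw [seg_inj e1]
  calc ∑ q ∈ termPairs n, wt β q.1 * F (push q.1 q.2)
      ≤ ∑ q ∈ termPairs n, H (push q.1 q.2, (q.2, tip q.1 q.2)) := by
        refine Finset.sum_le_sum fun q hq => ?_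
        have := mul_le_mul_of_nonneg_right (wt_term_le hn β (s := q.2) hq) (hF (push q.1 q.2))
        simp only [hH]
        linarith
    _ ≤ ∑ r, H r := sum_inj_le hinj hH0
    _ = _ := by
        rw [Fintype.sum_prod_type]
        refine Finset.sum_congr rfl fun υ _ => ?_
        simp only [hH]
        rw [← Finset.mul_sum]
        congr 1
        rw [Finset.sum_add_distrib, ← Finset.mul_sum, Finset.sum_add_distrib,
          Finset.sum_add_distrib]
        have s1 : ∑ r : (Fin n × Fin n) × Fin n, ind υ (r.1.1, r.1.2 + 1) = n * ndef υ := by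
          rw [Fintype.sum_prod_type]
          simp only [Finset.sum_const, Finset.card_univ, Fintype.card_fin, nsmul_eq_mul,
            ← Finset.mul_sum]
          rw [Fintype.sum_prod_type, sum_ind_succ]
        have s2 : ∑ r : (Fin n × Fin n) × Fin n, ind υ (r.2, r.1.2) = n * ndef υ := by
          rw [Fintype.sum_prod_type, Fintype.sum_prod_type]
          simp only [Finset.sum_const, Finset.card_univ, Fintype.card_fin, nsmul_eq_mul]
          rw [Finset.sum_comm, sum_ind]
        have s3 : ∑ r : (Fin n × Fin n) × Fin n, ind υ (r.2, r.1.2 + 1) = n * ndef υ := by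
          rw [Fintype.sum_prod_type, Fintype.sum_prod_type]
          simp only [Finset.sum_const, Finset.card_univ, Fintype.card_fin, nsmul_eq_mul]
          rw [Finset.sum_comm, sum_ind_succ]
        rw [s1, s2, s3]
        simp only [Finset.sum_const, Finset.card_univ, Fintype.card_prod, Fintype.card_fin,
          nsmul_eq_mul]
        push_cast
        ring

/-- Standing assumptions: `β` is large and `n` is a positive multiple, bounded above and below, of
`e^{β/2}`. -/
structure Reg (n : ℕ) (β : ℝ) : Prop where
  beta : 20 ≤ β
  two : 100 ≤ n
  le : (n : ℝ) ≤ Real.exp (β / 2)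

lemma exp_half_sq (β : ℝ) : Real.exp (β / 2) * Real.exp (β / 2) = Real.exp β := by
  rw [← Real.exp_add]; ring_nf

lemma Reg.exp_neg_le {β : ℝ} (h : Reg n β) : Real.exp (-β) ≤ 1 / 1000000 := by
  have h1 : Real.exp (-β) ≤ Real.exp (-20) := Real.exp_le_exp.2 (by linarith [h.beta])
  have h2 : Real.exp (-20) = (Real.exp (-1)) ^ 20 := by rw [← Real.exp_nat_mul]; norm_num
  have h3 : Real.exp (-1) ≤ 1 / 2 := by
    rw [Real.exp_neg, inv_eq_one_div]
    exact one_div_le_one_div_of_le (by norm_num) Real.exp_one_gt_two.le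
  have h4 : (Real.exp (-1)) ^ 20 ≤ (1 / 2) ^ 20 := by gcongr
  rw [h2] at h1
  exact h1.trans (h4.trans (by norm_num))

lemma Reg.sq_le {β : ℝ} (h : Reg n β) : (n : ℝ) * n ≤ Real.exp β := by
  rw [← exp_half_sq]
  exact mul_le_mul h.le h.le (by positivity) (Real.exp_pos _).le

lemma Reg.absorb_le {β : ℝ} (h : Reg n β) (υ : ConfigP n) :
    n * (3 * n * ndef υ * Real.exp (-(2 * β)) + (n : ℝ) ^ 3 * Real.exp (-(4 * β))) ≤
      3 * ndef υ * Real.exp (-β) + Real.exp (-(2 * β)) := by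
  have e1 : Real.exp (-(2 * β)) = Real.exp (-β) * Real.exp (-β) := by
    rw [← Real.exp_add]; ring_nf
  have e2 : Real.exp (-(4 * β)) = (Real.exp (-β)) ^ 2 * (Real.exp (-β)) ^ 2 := by
    rw [← pow_add, ← Real.exp_nat_mul]; norm_num
  have e3 : (n : ℝ) * n * Real.exp (-β) ≤ 1 := by
    have := mul_le_mul_of_nonneg_right h.sq_le (Real.exp_pos (-β)).le
    rwa [← Real.exp_add, add_neg_cancel, Real.exp_zero] at this
  have e0 := Real.exp_pos (-β)
  have hN : (0 : ℝ) ≤ ndef υ := by positivity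
  rw [e1, e2]
  set z := Real.exp (-β)
  have e4 : 0 ≤ (n : ℝ) * n * z := by positivity
  have e5 : ((n : ℝ) * n * z) ^ 2 ≤ 1 := by nlinarith
  have t1 : (n : ℝ) * (3 * n * ndef υ * (z * z)) = 3 * ndef υ * z * (n * n * z) := by ring
  have t2 : (n : ℝ) * (n ^ 3 * (z ^ 2 * z ^ 2)) = z * z * (n * n * z) ^ 2 := by ring
  have t3 : 3 * ndef υ * z * (n * n * z) ≤ 3 * ndef υ * z * 1 := by gcongr
  have t4 : z * z * ((n : ℝ) * n * z) ^ 2 ≤ z * z * 1 := by gcongr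
  rw [mul_add, t1, t2]
  linarith

lemma sum_split_Gr (β : ℝ) (g : ConfigP n → ℝ) (hg : ∀ σ, 0 ≤ g σ) :
    ∑ σ, wt β σ * g σ ≤ ∑ σ ∈ Gr n, g σ + ∑ σ, wt β σ * ndef σ * g σ := by
  rw [← Finset.sum_add_sum_compl (Gr n) (fun σ => wt β σ * g σ)]
  refine add_le_add (le_of_eq ?_) ?_
  · exact Finset.sum_congr rfl fun σ hσ => by rw [wt_Gr hσ, one_mul]
  · refine (Finset.sum_le_sum fun σ hσ => ?_).trans
      (Finset.sum_le_sum_of_subset_of_nonneg (Finset.subset_univ _) fun σ _ _ => by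
        have := wt_pos β σ
        have := hg σ
        positivity)
    have : (1 : ℝ) ≤ ndef σ := by exact_mod_cast ndef_pos (Finset.mem_compl.1 hσ)
    have h1 := wt_pos β σ
    have h2 := hg σ
    nlinarith [mul_nonneg h1.le h2]

lemma Reg.flight_coeff {β : ℝ} (h : Reg n β) : (n : ℝ) * (1 + n) * (n * (Real.exp (2 * β) + n)) ≤
    (103 / 100) * Real.exp (7 / 2 * β) := by
  have hx : 100 ≤ (n : ℝ) := by exact_mod_cast h.two
  have hnx := h.le
  have e4 : Real.exp (7 / 2 * β) = Real.exp (β / 2) ^ 3 * Real.exp (2 * β) := by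
    rw [← Real.exp_nat_mul, ← Real.exp_add]; push_cast; ring_nf
  have h1 : (n : ℝ) * (1 + n) * n ≤ 101 / 100 * Real.exp (β / 2) ^ 3 := by
    have a1 : (n : ℝ) ^ 3 ≤ Real.exp (β / 2) ^ 3 := by gcongr
    have a2 : (n : ℝ) * (1 + n) * n ≤ 101 / 100 * (n : ℝ) ^ 3 := by nlinarith [sq_nonneg (n : ℝ)]
    linarith
  have h2 : Real.exp (2 * β) + n ≤ 101 / 100 * Real.exp (2 * β) := by
    have a1 : Real.exp (2 * β) = Real.exp β * Real.exp β := by rw [← Real.exp_add]; ring_nf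
    have a2 := h.sq_le
    have a3 : Real.exp (β) ≥ 10000 := by nlinarith
    have a4 : (n : ℝ) ≤ Real.exp β := by nlinarith
    nlinarith
  rw [e4]
  calc (n : ℝ) * (1 + n) * (n * (Real.exp (2 * β) + n)) =
      ((n : ℝ) * (1 + n) * n) * (Real.exp (2 * β) + n) := by ring
    _ ≤ (101 / 100 * Real.exp (β / 2) ^ 3) * (101 / 100 * Real.exp (2 * β)) := by
        apply mul_le_mul h1 h2 (by positivity) (by positivity)
    _ ≤ _ := by
        have : 0 ≤ Real.exp (β / 2) ^ 3 * Real.exp (2 * β) := by positivity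
        linarith

/-- The defects of a function are controlled by its energy and its values on ground states. -/
lemma poincare {β : ℝ} (h : Reg n β) (f : ConfigP n → ℝ) :
    ∑ σ, wt β σ * ndef σ * f σ ^ 2 ≤ 60 * Real.exp (7 / 2 * β) * dirE β f +
      20 * Real.exp (-(2 * β)) * ∑ σ ∈ Gr n, f σ ^ 2 := by
  have hn : 2 ≤ n := by have := h.two; omega
  have hβ : 0 ≤ β := by have := h.beta; linarith
  set S := ∑ σ, wt β σ * ndef σ * f σ ^ 2 with hS
  set G := ∑ σ ∈ Gr n, f σ ^ 2 with hG
  set E := dirE β f with hE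
  have hE0 : 0 ≤ E := dirE_nonneg β f
  have hS0 : 0 ≤ S := Finset.sum_nonneg fun σ _ => by have := wt_pos β σ; positivity
  have hG0 : 0 ≤ G := Finset.sum_nonneg fun σ _ => sq_nonneg _
  have main := sum_termPairs_move hn β f
  have hfl := flight_energy hn hβ f
  set Φ : ConfigP n × (Fin n × Fin n) → ℝ := fun q => wt β q.1 * (f q.1 - f (push q.1 q.2)) ^ 2
    with hΦ
  have hΦ0 : ∀ q, 0 ≤ Φ q := fun q => mul_nonneg (wt_pos _ _).le (sq_nonneg _)
  have hadd : ∑ q ∈ termPairs n, Φ q + ∑ q ∈ movePairs n, Φ q = ∑ q ∈ defectPairs n, Φ q := by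
    unfold termPairs movePairs
    exact Finset.sum_filter_add_sum_filter_not _ _ _
  have ht0 : 0 ≤ ∑ q ∈ termPairs n, Φ q := Finset.sum_nonneg fun q _ => hΦ0 q
  have hm0 : 0 ≤ ∑ q ∈ movePairs n, Φ q := Finset.sum_nonneg fun q _ => hΦ0 q
  have hterm : ∑ q ∈ termPairs n, wt β q.1 * f q.1 ^ 2 ≤
      2 * ∑ q ∈ termPairs n, wt β q.1 * f (push q.1 q.2) ^ 2 + 2 * ∑ q ∈ termPairs n, Φ q := by
    rw [Finset.mul_sum, Finset.mul_sum, ← Finset.sum_add_distrib]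
    refine Finset.sum_le_sum fun q _ => ?_
    have := wt_pos β q.1
    simp only [hΦ]
    nlinarith [mul_nonneg this.le (sq_nonneg (f q.1 - 2 * f (push q.1 q.2)))]
  have hab := sum_term_le hn β (F := fun σ => f σ ^ 2) (fun σ => sq_nonneg _)
  have hab2 : (n : ℝ) * ∑ υ, wt β υ * f υ ^ 2 * (3 * n * ndef υ * Real.exp (-(2 * β)) +
      (n : ℝ) ^ 3 * Real.exp (-(4 * β))) ≤ 3 * Real.exp (-β) * S +
        Real.exp (-(2 * β)) * (G + S) := by
    have hsp := sum_split_Gr β (fun σ => f σ ^ 2) (fun σ => sq_nonneg _)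
    calc (n : ℝ) * ∑ υ, wt β υ * f υ ^ 2 * (3 * n * ndef υ * Real.exp (-(2 * β)) +
      (n : ℝ) ^ 3 * Real.exp (-(4 * β)))
        ≤ ∑ υ, (3 * Real.exp (-β) * (wt β υ * ndef υ * f υ ^ 2) +
            Real.exp (-(2 * β)) * (wt β υ * f υ ^ 2)) := by
          rw [Finset.mul_sum]
          refine Finset.sum_le_sum fun υ _ => ?_
          have h1 : 0 ≤ wt β υ * f υ ^ 2 := mul_nonneg (wt_pos _ _).le (sq_nonneg _)
          have := mul_le_mul_of_nonneg_left (h.absorb_le υ) h1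
          linarith
      _ ≤ _ := by
          rw [Finset.sum_add_distrib, ← Finset.mul_sum, ← Finset.mul_sum]
          have := mul_le_mul_of_nonneg_left hsp (Real.exp_pos (-(2 * β))).le
          linarith
  have hz := h.exp_neg_le
  have e1 : Real.exp (-(2 * β)) = Real.exp (-β) * Real.exp (-β) := by
    rw [← Real.exp_add]; ring_nf
  have hz0 := Real.exp_pos (-β)
  have e2 : Real.exp (-(2 * β)) ≤ 1 / 1000000 := by rw [e1]; nlinarith
  have hcoef := h.flight_coeff
  have hn1 : (2 : ℝ) ≤ 1 + n := by
    have : (2 : ℝ) ≤ n := by exact_mod_cast hn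
    linarith
  have hn0 : (0 : ℝ) ≤ n := by positivity
  have hΦall : ∑ q ∈ termPairs n, wt β q.1 * f q.1 ^ 2 + (1 + n) * ∑ q ∈ movePairs n, Φ q ≤
      2 * ∑ q ∈ termPairs n, wt β q.1 * f (push q.1 q.2) ^ 2 +
        (1 + n) * (n * (Real.exp (2 * β) + n) * (2 * E)) := by
    have a1 := mul_le_mul_of_nonneg_right hn1 ht0
    have a2 := mul_le_mul_of_nonneg_left hfl (show (0 : ℝ) ≤ 1 + n by linarith)
    rw [← hadd, mul_add] at a2
    linarith
  have hfin : S ≤ 6 * (3 * Real.exp (-β) * S + Real.exp (-(2 * β)) * (G + S)) +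
      6 * (103 / 100 * Real.exp (7 / 2 * β)) * E := by
    have a1 := mul_le_mul_of_nonneg_left hΦall (show (0 : ℝ) ≤ 3 * n by positivity)
    have a2 := mul_le_mul_of_nonneg_left hab (show (0 : ℝ) ≤ n by positivity)
    have a3 := mul_le_mul_of_nonneg_right hcoef hE0
    have a4 := main.trans a1
    have : 3 * (n : ℝ) * (2 * ∑ q ∈ termPairs n, wt β q.1 * f (push q.1 q.2) ^ 2 +
        (1 + n) * (n * (Real.exp (2 * β) + n) * (2 * E))) =
        6 * (n * ∑ q ∈ termPairs n, wt β q.1 * f (push q.1 q.2) ^ 2) +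
          6 * (n * (1 + n) * (n * (Real.exp (2 * β) + n)) * E) := by ring
    linarith
  have b1 : Real.exp (-β) * S ≤ 1 / 1000000 * S := mul_le_mul_of_nonneg_right hz hS0
  have b2 : Real.exp (-(2 * β)) * S ≤ 1 / 1000000 * S := mul_le_mul_of_nonneg_right e2 hS0
  have b3 : 0 ≤ Real.exp (-(2 * β)) * G := by positivity
  have b4 : 0 ≤ Real.exp (7 / 2 * β) * E := by positivity
  linarith

end Absorption

/-! ### Semigroups of reversible chains -/

section Semigroup

open Matrix NormedSpace

variable {Ω : Type*} [Fintype Ω] [DecidableEq Ω]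

/-- The generator `A` is a rate matrix, reversible with respect to the weight `w`. -/
structure RevChain (A : Matrix Ω Ω ℝ) (w : Ω → ℝ) : Prop where
  pos : ∀ σ, 0 < w σ
  symm : ∀ σ η, w σ * A σ η = w η * A η σ
  off : ∀ σ η, σ ≠ η → 0 ≤ A σ η
  row : ∀ σ, ∑ η, A σ η = 0

/-- The semigroup acting on functions. -/
def sgp (A : Matrix Ω Ω ℝ) (t : ℝ) (f : Ω → ℝ) : Ω → ℝ := mexp (t • A) *ᵥ f

/-- The weighted inner product. -/
def ip (w f g : Ω → ℝ) : ℝ := ∑ σ, w σ * (f σ * g σ)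

section Norm

attribute [local instance] Matrix.linftyOpNormedRing Matrix.linftyOpNormedAlgebra

lemma mexp_eq_exp (A : Matrix Ω Ω ℝ) : mexp A = exp A := by
  have hs : Summable fun k : ℕ => ((Nat.factorial k : ℝ)⁻¹) • A ^ k :=
    expSeries_summable' (𝕂 := ℝ) A
  ext i j
  rw [exp_eq_tsum ℝ]
  have h1 := hs.hasSum.map (Matrix.entryAddMonoidHom ℝ i j)
    (show Continuous fun M : Matrix Ω Ω ℝ => M i j from continuous_id.matrix_elem i j)
  have h2 : (∑' k : ℕ, ((Nat.factorial k : ℝ)⁻¹) • A ^ k) i j =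
      ∑' k : ℕ, (((Nat.factorial k : ℝ)⁻¹) • A ^ k) i j := h1.tsum_eq.symm
  simp only [h2, mexp, Matrix.smul_apply, smul_eq_mul]
  exact tsum_congr fun k => by rw [div_eq_inv_mul]

lemma mexp_hasDerivAt (A : Matrix Ω Ω ℝ) (t : ℝ) :
    HasDerivAt (fun s : ℝ => mexp (s • A)) (mexp (t • A) * A) t := by
  simp only [mexp_eq_exp]
  exact hasDerivAt_exp_smul_const A t

lemma mexp_hasDerivAt_apply (A : Matrix Ω Ω ℝ) (t : ℝ) (i j : Ω) :
    HasDerivAt (fun s : ℝ => mexp (s • A) i j) ((mexp (t • A) * A) i j) t := by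
  have h := mexp_hasDerivAt A t
  let l : Matrix Ω Ω ℝ →ₗ[ℝ] ℝ := Matrix.entryLinearMap ℝ ℝ i j
  have hl := (LinearMap.toContinuousLinearMap l).hasFDerivAt (x := mexp (t • A))
  exact hl.comp_hasDerivAt t h

lemma mexp_add (A : Matrix Ω Ω ℝ) (s t : ℝ) :
    mexp ((s + t) • A) = mexp (s • A) * mexp (t • A) := by
  simp only [mexp_eq_exp]
  rw [add_smul]
  exact exp_add_of_commute (((Commute.refl A).smul_left s).smul_right t)

lemma mexp_zero : mexp (0 : Matrix Ω Ω ℝ) = 1 := by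
  rw [mexp_eq_exp, exp_zero]

lemma mexp_comm (A : Matrix Ω Ω ℝ) (t : ℝ) : mexp (t • A) * A = A * mexp (t • A) := by
  rw [mexp_eq_exp]
  exact (((Commute.refl A).smul_right t).exp_right).eq.symm

lemma mexp_smul_one_add (A : Matrix Ω Ω ℝ) (c : ℝ) :
    mexp (c • (1 : Matrix Ω Ω ℝ) + A) = Real.exp c • mexp A := by
  simp only [mexp_eq_exp]
  have h0 : exp (c • (1 : Matrix Ω Ω ℝ) + A) = exp (c • (1 : Matrix Ω Ω ℝ)) * exp A :=
    exp_add_of_commute ((Commute.one_left A).smul_left c)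
  rw [h0]
  have : exp (c • (1 : Matrix Ω Ω ℝ)) = Real.exp c • (1 : Matrix Ω Ω ℝ) := by
    have h := algebraMap_exp_comm (𝕂 := ℝ) (𝔸 := Matrix Ω Ω ℝ) c
    rw [Algebra.algebraMap_eq_smul_one, Algebra.algebraMap_eq_smul_one] at h
    rw [Real.exp_eq_exp_ℝ]
    exact h.symm
  rw [this, smul_mul_assoc, one_mul]

end Norm

lemma mexp_nonneg_of_nonneg {A : Matrix Ω Ω ℝ} (h : ∀ i j, 0 ≤ A i j) (i j : Ω) :
    0 ≤ mexp A i j := by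
  refine tsum_nonneg fun k => div_nonneg ?_ (by positivity)
  induction k generalizing i j with
  | zero => rw [pow_zero, Matrix.one_apply]; split_ifs <;> norm_num
  | succ k ih =>
    rw [pow_succ, Matrix.mul_apply]
    exact Finset.sum_nonneg fun l _ => mul_nonneg (ih i l) (h l j)

lemma RevChain.mexp_nonneg {A : Matrix Ω Ω ℝ} {w : Ω → ℝ} (hA : RevChain A w) {t : ℝ}
    (ht : 0 ≤ t) (i j : Ω) : 0 ≤ mexp (t • A) i j := by
  set c : ℝ := ∑ σ, t * |A σ σ| with hc
  have h1 : ∀ i j, 0 ≤ (c • (1 : Matrix Ω Ω ℝ) + t • A) i j := by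
    intro i j
    simp only [Matrix.add_apply, Matrix.smul_apply, smul_eq_mul]
    by_cases hij : i = j
    · subst hij
      rw [Matrix.one_apply_eq, mul_one]
      have h2 : t * |A i i| ≤ c :=
        Finset.single_le_sum (f := fun σ => t * |A σ σ|)
          (fun σ _ => mul_nonneg ht (abs_nonneg _)) (Finset.mem_univ i)
      have h3 := mul_le_mul_of_nonneg_left (neg_abs_le (A i i)) ht
      linarith
    · rw [Matrix.one_apply_ne hij, mul_zero, zero_add]
      exact mul_nonneg ht (hA.off i j hij)
  have h2 := mexp_nonneg_of_nonneg h1 i j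
  rw [mexp_smul_one_add, Matrix.smul_apply, smul_eq_mul] at h2
  exact nonneg_of_mul_nonneg_right h2 (Real.exp_pos c)

lemma RevChain.mexp_symm {A : Matrix Ω Ω ℝ} {w : Ω → ℝ} (hA : RevChain A w) (t : ℝ) (i j : Ω) :
    w i * mexp (t • A) i j = w j * mexp (t • A) j i := by
  have hp : ∀ (k : ℕ) (i j : Ω), w i * (A ^ k) i j = w j * (A ^ k) j i := by
    intro k
    induction k with
    | zero =>
      intro i j
      by_cases hij : i = j
      · rw [hij]
      · rw [pow_zero, Matrix.one_apply_ne hij, Matrix.one_apply_ne (Ne.symm hij)]; simp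
    | succ k ih =>
      intro i j
      rw [pow_succ, Matrix.mul_apply, ← pow_succ, pow_succ', Matrix.mul_apply, Finset.mul_sum,
        Finset.mul_sum]
      refine Finset.sum_congr rfl fun l _ => ?_
      rw [← mul_assoc, ih i l, ← mul_assoc, ← hA.symm l j]
      ring
  simp only [mexp]
  rw [← tsum_mul_left, ← tsum_mul_left]
  refine tsum_congr fun k => ?_
  rw [smul_pow, Matrix.smul_apply, Matrix.smul_apply, smul_eq_mul, smul_eq_mul]
  have := hp k i j
  calc _ = t ^ k * (w i * (A ^ k) i j) / (Nat.factorial k : ℝ) := by ring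
    _ = _ := by rw [this]; ring

lemma mexp_equiv {A : Matrix Ω Ω ℝ} (e : Ω ≃ Ω) (hA : ∀ i j, A (e i) (e j) = A i j) (t : ℝ)
    (i j : Ω) : mexp (t • A) (e i) (e j) = mexp (t • A) i j := by
  have hp : ∀ (k : ℕ) (i j : Ω), (A ^ k) (e i) (e j) = (A ^ k) i j := by
    intro k
    induction k with
    | zero => intro i j; simp [Matrix.one_apply]
    | succ k ih =>
      intro i j
      rw [pow_succ, Matrix.mul_apply, Matrix.mul_apply, ← Equiv.sum_comp e]
      exact Finset.sum_congr rfl fun l _ => by rw [ih, hA]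
  simp only [mexp, smul_pow, Matrix.smul_apply, hp]

lemma sgp_zero (A : Matrix Ω Ω ℝ) (f : Ω → ℝ) : sgp A 0 f = f := by
  rw [sgp, zero_smul, mexp_zero, Matrix.one_mulVec]

lemma sgp_sgp (A : Matrix Ω Ω ℝ) (s t : ℝ) (f : Ω → ℝ) : sgp A s (sgp A t f) = sgp A (s + t) f := by
  rw [sgp, sgp, sgp, mexp_add, Matrix.mulVec_mulVec]

lemma mulVec_sgp (A : Matrix Ω Ω ℝ) (t : ℝ) (f : Ω → ℝ) : A *ᵥ sgp A t f = sgp A t (A *ᵥ f) := by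
  rw [sgp, sgp, Matrix.mulVec_mulVec, Matrix.mulVec_mulVec, mexp_comm]

lemma sgp_add (A : Matrix Ω Ω ℝ) (t : ℝ) (f g : Ω → ℝ) :
    sgp A t (f + g) = sgp A t f + sgp A t g := Matrix.mulVec_add _ _ _

lemma sgp_sub (A : Matrix Ω Ω ℝ) (t : ℝ) (f g : Ω → ℝ) :
    sgp A t (f - g) = sgp A t f - sgp A t g := Matrix.mulVec_sub _ _ _

lemma sgp_smul (A : Matrix Ω Ω ℝ) (t c : ℝ) (f : Ω → ℝ) :
    sgp A t (c • f) = c • sgp A t f := Matrix.mulVec_smul _ _ _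

lemma sgp_hasDerivAt (A : Matrix Ω Ω ℝ) (f : Ω → ℝ) (t : ℝ) (σ : Ω) :
    HasDerivAt (fun s => sgp A s f σ) ((A *ᵥ sgp A t f) σ) t := by
  have h : HasDerivAt (fun s => ∑ η, mexp (s • A) σ η * f η)
      (∑ η, (mexp (t • A) * A) σ η * f η) t :=
    HasDerivAt.fun_sum fun η _ => (mexp_hasDerivAt_apply A t σ η).mul_const (f η)
  have e : (A *ᵥ sgp A t f) σ = ∑ η, (mexp (t • A) * A) σ η * f η := by
    rw [sgp, Matrix.mulVec_mulVec, ← mexp_comm]; rfl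
  rw [e]
  exact h

lemma sgp_comp_equiv {A : Matrix Ω Ω ℝ} (e : Ω ≃ Ω) (hA : ∀ i j, A (e i) (e j) = A i j) (t : ℝ)
    (f : Ω → ℝ) (σ : Ω) : sgp A t f (e σ) = sgp A t (fun η => f (e η)) σ := by
  simp only [sgp, Matrix.mulVec, dotProduct]
  rw [← Equiv.sum_comp e]
  exact Finset.sum_congr rfl fun η _ => by rw [mexp_equiv e hA]

lemma ip_comm (w f g : Ω → ℝ) : ip w f g = ip w g f := by
  simp only [ip]; exact Finset.sum_congr rfl fun σ _ => by ring

lemma ip_add_right (w f g h : Ω → ℝ) : ip w f (g + h) = ip w f g + ip w f h := by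
  simp only [ip, ← Finset.sum_add_distrib, Pi.add_apply]
  exact Finset.sum_congr rfl fun σ _ => by ring

lemma ip_add_left (w f g h : Ω → ℝ) : ip w (f + g) h = ip w f h + ip w g h := by
  rw [ip_comm, ip_add_right, ip_comm w h f, ip_comm w h g]

lemma ip_smul_right (w f g : Ω → ℝ) (c : ℝ) : ip w f (c • g) = c * ip w f g := by
  simp only [ip, Finset.mul_sum, Pi.smul_apply, smul_eq_mul]
  exact Finset.sum_congr rfl fun σ _ => by ring

lemma ip_smul_left (w f g : Ω → ℝ) (c : ℝ) : ip w (c • f) g = c * ip w f g := by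
  rw [ip_comm, ip_smul_right, ip_comm]

variable {A : Matrix Ω Ω ℝ} {w : Ω → ℝ}

lemma RevChain.ip_self_nonneg (hA : RevChain A w) (f : Ω → ℝ) : 0 ≤ ip w f f :=
  Finset.sum_nonneg fun σ _ => mul_nonneg (hA.pos σ).le (mul_self_nonneg _)

lemma RevChain.ip_sgp (hA : RevChain A w) (t : ℝ) (f g : Ω → ℝ) :
    ip w f (sgp A t g) = ip w (sgp A t f) g := by
  simp only [ip, sgp, Matrix.mulVec, dotProduct]
  have h1 : ∀ σ, w σ * (f σ * ∑ η, mexp (t • A) σ η * g η) =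
      ∑ η, (w σ * mexp (t • A) σ η) * (f σ * g η) := by
    intro σ; rw [Finset.mul_sum, Finset.mul_sum]
    exact Finset.sum_congr rfl fun η _ => by ring
  have h2 : ∀ σ, w σ * ((∑ η, mexp (t • A) σ η * f η) * g σ) =
      ∑ η, (w σ * mexp (t • A) σ η) * (f η * g σ) := by
    intro σ; rw [Finset.sum_mul, Finset.mul_sum]
    exact Finset.sum_congr rfl fun η _ => by ring
  simp only [h1, h2]
  rw [Finset.sum_comm]
  refine Finset.sum_congr rfl fun σ _ => Finset.sum_congr rfl fun η _ => ?_
  rw [hA.mexp_symm]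

lemma RevChain.ip_mulVec (hA : RevChain A w) (f g : Ω → ℝ) :
    ip w f (A *ᵥ g) = ip w (A *ᵥ f) g := by
  simp only [ip, Matrix.mulVec, dotProduct]
  have h1 : ∀ σ, w σ * (f σ * ∑ η, A σ η * g η) = ∑ η, (w σ * A σ η) * (f σ * g η) := by
    intro σ; rw [Finset.mul_sum, Finset.mul_sum]
    exact Finset.sum_congr rfl fun η _ => by ring
  have h2 : ∀ σ, w σ * ((∑ η, A σ η * f η) * g σ) = ∑ η, (w σ * A σ η) * (f η * g σ) := by
    intro σ; rw [Finset.sum_mul, Finset.mul_sum]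
    exact Finset.sum_congr rfl fun η _ => by ring
  simp only [h1, h2]
  rw [Finset.sum_comm]
  refine Finset.sum_congr rfl fun σ _ => Finset.sum_congr rfl fun η _ => ?_
  rw [hA.symm]

lemma RevChain.mulVec_one (hA : RevChain A w) : A *ᵥ (fun _ => (1 : ℝ)) = 0 := by
  funext σ
  simp [Matrix.mulVec, dotProduct, hA.row]

lemma RevChain.sgp_one (hA : RevChain A w) (t : ℝ) : sgp A t (fun _ => (1 : ℝ)) = fun _ => 1 := by
  funext σ
  have hd : ∀ s, HasDerivAt (fun s => sgp A s (fun _ => (1 : ℝ)) σ) 0 s := by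
    intro s
    have := sgp_hasDerivAt A (fun _ => (1 : ℝ)) s σ
    rw [mulVec_sgp, hA.mulVec_one] at this
    simpa [sgp] using this
  have hdiff : Differentiable ℝ (fun s => sgp A s (fun _ => (1 : ℝ)) σ) :=
    fun s => (hd s).differentiableAt
  have := is_const_of_deriv_eq_zero hdiff (fun s => (hd s).deriv) t 0
  rw [this, sgp_zero]

lemma RevChain.row_sum (hA : RevChain A w) (t : ℝ) (σ : Ω) : ∑ η, mexp (t • A) σ η = 1 := by
  have := congrFun (hA.sgp_one t) σ
  simpa [sgp, Matrix.mulVec, dotProduct] using this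

lemma RevChain.sgp_nonneg (hA : RevChain A w) {t : ℝ} (ht : 0 ≤ t) {f : Ω → ℝ}
    (hf : ∀ σ, 0 ≤ f σ) (σ : Ω) : 0 ≤ sgp A t f σ :=
  Finset.sum_nonneg fun η _ => mul_nonneg (hA.mexp_nonneg ht σ η) (hf η)

lemma RevChain.ip_sgp_self (hA : RevChain A w) (t : ℝ) (f g : Ω → ℝ) :
    ip w f (sgp A t g) = ip w (sgp A (t / 2) f) (sgp A (t / 2) g) := by
  rw [← hA.ip_sgp, sgp_sgp, add_halves]

lemma ip_sgp_hasDerivAt (f g : Ω → ℝ) (t : ℝ) :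
    HasDerivAt (fun s => ip w f (sgp A s g)) (ip w f (A *ᵥ sgp A t g)) t := by
  simp only [ip]
  exact HasDerivAt.fun_sum fun σ _ => ((sgp_hasDerivAt A g t σ).const_mul (f σ)).const_mul (w σ)

lemma ip_sgp_sgp_hasDerivAt (f : Ω → ℝ) (t : ℝ) :
    HasDerivAt (fun s => ip w (sgp A s f) (sgp A s f))
      (2 * ip w (sgp A t f) (A *ᵥ sgp A t f)) t := by
  have h : HasDerivAt (fun s => ∑ σ, w σ * (sgp A s f σ * sgp A s f σ))
      (∑ σ, w σ * ((A *ᵥ sgp A t f) σ * sgp A t f σ + sgp A t f σ * (A *ᵥ sgp A t f) σ)) t :=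
    HasDerivAt.fun_sum fun σ _ =>
      ((sgp_hasDerivAt A f t σ).mul (sgp_hasDerivAt A f t σ)).const_mul (w σ)
  have e : 2 * ip w (sgp A t f) (A *ᵥ sgp A t f) =
      ∑ σ, w σ * ((A *ᵥ sgp A t f) σ * sgp A t f σ + sgp A t f σ * (A *ᵥ sgp A t f) σ) := by
    rw [ip, Finset.mul_sum]
    exact Finset.sum_congr rfl fun σ _ => by ring
  rw [e]
  exact h

/-- Exponential decay in `L²` along a trajectory on which a spectral gap inequality holds. -/
lemma sgp_decay {f : Ω → ℝ} {lam : ℝ}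
    (hgap : ∀ t, 0 ≤ t → lam * ip w (sgp A t f) (sgp A t f) ≤
      -ip w (sgp A t f) (A *ᵥ sgp A t f)) {t : ℝ} (ht : 0 ≤ t) :
    ip w (sgp A t f) (sgp A t f) ≤ Real.exp (-(2 * lam * t)) * ip w f f := by
  set F : ℝ → ℝ := fun s => Real.exp (2 * lam * s) * ip w (sgp A s f) (sgp A s f) with hF
  have hd : ∀ s, HasDerivAt F (Real.exp (2 * lam * s) * (2 * lam) *
      ip w (sgp A s f) (sgp A s f) +
      Real.exp (2 * lam * s) * (2 * ip w (sgp A s f) (A *ᵥ sgp A s f))) s := by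
    intro s
    have h1 : HasDerivAt (fun s => Real.exp (2 * lam * s)) (Real.exp (2 * lam * s) * (2 * lam)) s := by
      have := ((hasDerivAt_id s).const_mul (2 * lam)).exp
      simpa using this
    exact h1.mul (ip_sgp_sgp_hasDerivAt f s)
  have hanti : AntitoneOn F (Set.Ici 0) := by
    refine antitoneOn_of_deriv_nonpos (convex_Ici 0)
      (fun s _ => (hd s).continuousAt.continuousWithinAt)
      (fun s _ => (hd s).differentiableAt.differentiableWithinAt) fun s hs => ?_
    rw [interior_Ici] at hs
    rw [(hd s).deriv]
    have h1 := hgap s (le_of_lt hs)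
    have h2 := Real.exp_pos (2 * lam * s)
    nlinarith
  have h0 := hanti (Set.mem_Ici.2 le_rfl) (Set.mem_Ici.2 ht) ht
  simp only [hF, mul_zero, Real.exp_zero, one_mul, sgp_zero] at h0
  have h3 := mul_le_mul_of_nonneg_left h0 (Real.exp_pos (-(2 * lam * t))).le
  rwa [← mul_assoc, ← Real.exp_add, neg_add_cancel, Real.exp_zero, one_mul] at h3

/-- A convexity lower bound for the autocorrelation. -/
lemma RevChain.autocorr_ge (hA : RevChain A w) (f : Ω → ℝ) (c : ℝ) {t : ℝ} (ht : 0 ≤ t) :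
    Real.exp (-(c * t)) * (ip w f f + t * (c * ip w f f + ip w f (A *ᵥ f))) ≤
      ip w f (sgp A t f) := by
  have hexp : ∀ s, HasDerivAt (fun s => Real.exp (c * s)) (Real.exp (c * s) * c) s := by
    intro s
    have := ((hasDerivAt_id s).const_mul c).exp
    simpa using this
  set B : (Ω → ℝ) → (Ω → ℝ) := fun g => c • g + A *ᵥ g with hB
  set k : ℝ → ℝ := fun s => Real.exp (c * s) * ip w f (sgp A s f) with hk
  set k1 : ℝ → ℝ := fun s => Real.exp (c * s) * ip w f (sgp A s (B f)) with hk1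
  have hsB : ∀ (g : Ω → ℝ) s, sgp A s (B g) = c • sgp A s g + A *ᵥ sgp A s g := by
    intro g s
    rw [hB, sgp_add, sgp_smul, mulVec_sgp]
  have hder : ∀ g s, HasDerivAt (fun s => Real.exp (c * s) * ip w f (sgp A s g))
      (Real.exp (c * s) * ip w f (sgp A s (B g))) s := by
    intro g s
    have h := (hexp s).mul (ip_sgp_hasDerivAt (w := w) (A := A) f g s)
    have e : Real.exp (c * s) * ip w f (sgp A s (B g)) = Real.exp (c * s) * c *
        ip w f (sgp A s g) + Real.exp (c * s) * ip w f (A *ᵥ sgp A s g) := by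
      rw [hsB, ip_add_right, ip_smul_right]; ring
    rw [e]
    exact h
  have hBs : ∀ g h, ip w g (B h) = ip w (B g) h := by
    intro g h
    simp only [hB]
    rw [ip_add_right, ip_add_left, ip_smul_left, ip_smul_right, hA.ip_mulVec]
  have hpos : ∀ s, 0 ≤ ip w f (sgp A s (B (B f))) := by
    intro s
    have e1 : sgp A s (B (B f)) = B (sgp A s (B f)) := hsB (B f) s
    rw [e1, hBs, hA.ip_sgp_self]
    exact hA.ip_self_nonneg _
  have hmono : Monotone k1 := by
    refine monotone_of_deriv_nonneg (fun s => (hder (B f) s).differentiableAt) fun s => ?_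
    rw [(hder (B f) s).deriv]
    exact mul_nonneg (Real.exp_pos _).le (hpos s)
  have hm2 : MonotoneOn (fun s => k s - s * k1 0) (Set.Ici 0) := by
    have hd : ∀ s, HasDerivAt (fun s => k s - s * k1 0) (k1 s - 1 * k1 0) s := fun s =>
      (hder f s).sub ((hasDerivAt_id s).mul_const (k1 0))
    refine monotoneOn_of_deriv_nonneg (convex_Ici 0)
      (fun s _ => (hd s).continuousAt.continuousWithinAt)
      (fun s _ => (hd s).differentiableAt.differentiableWithinAt) fun s hs => ?_
    rw [interior_Ici] at hs
    rw [(hd s).deriv]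
    have := hmono (le_of_lt hs)
    linarith
  have h0 := hm2 (Set.mem_Ici.2 le_rfl) (Set.mem_Ici.2 ht) ht
  simp only [hk, hk1, hB, mul_zero, Real.exp_zero, one_mul, sgp_zero, zero_mul, sub_zero,
    ip_add_right, ip_smul_right] at h0
  have h1 : ip w f f + t * (c * ip w f f + ip w f (A *ᵥ f)) ≤
      Real.exp (c * t) * ip w f (sgp A t f) := by linarith
  have h3 := mul_le_mul_of_nonneg_left h1 (Real.exp_pos (-(c * t))).le
  rwa [← mul_assoc (Real.exp _), ← Real.exp_add, neg_add_cancel, Real.exp_zero, one_mul] at h3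

lemma RevChain.sq_ip_le (hA : RevChain A w) (f g : Ω → ℝ) : ip w f g ^ 2 ≤ ip w f f * ip w g g := by
  have h := Finset.sum_mul_sq_le_sq_mul_sq Finset.univ
    (fun σ => Real.sqrt (w σ) * f σ) (fun σ => Real.sqrt (w σ) * g σ)
  have e : ∀ u v : Ω → ℝ, ∑ σ, Real.sqrt (w σ) * u σ * (Real.sqrt (w σ) * v σ) = ip w u v := by
    intro u v
    refine Finset.sum_congr rfl fun σ _ => ?_
    have := Real.mul_self_sqrt (hA.pos σ).le
    calc _ = Real.sqrt (w σ) * Real.sqrt (w σ) * (u σ * v σ) := by ring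
      _ = _ := by rw [this]
  simp only [sq] at h ⊢
  rwa [e, e, e] at h

end Semigroup

/-! ### The plaquette chain -/

section Chain

open Matrix

variable {n : ℕ} [NeZero n]

lemma genP_apply (β : ℝ) (σ η : ConfigP n) : genP n β σ η =
    (if η = σ then -(∑ x, metroRateP n β σ (flipP n σ x)) else 0) +
      ∑ x, (if η = flipP n σ x then metroRateP n β σ (flipP n σ x) else 0) := by
  unfold genP
  by_cases h : η = σ
  · subst h
    rw [if_pos rfl, if_pos rfl, left_eq_add]
    exact Finset.sum_eq_zero fun x _ => if_neg (flip_ne η x).symm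
  · rw [if_neg h, if_neg h, zero_add]

lemma genP_mulVec (β : ℝ) (f : ConfigP n → ℝ) (σ : ConfigP n) :
    (genP n β *ᵥ f) σ = ∑ x, metroRateP n β σ (flipP n σ x) * (f (flipP n σ x) - f σ) := by
  simp only [Matrix.mulVec, dotProduct, genP_apply, add_mul, Finset.sum_add_distrib, ite_mul,
    zero_mul, Finset.sum_ite_eq', Finset.mem_univ, if_true, Finset.sum_mul]
  rw [Finset.sum_comm]
  simp only [Finset.sum_ite_eq', Finset.mem_univ, if_true, mul_sub, Finset.sum_sub_distrib]
  rw [neg_mul, Finset.sum_mul]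
  ring

lemma ip_genP (β : ℝ) (f : ConfigP n → ℝ) :
    ip (wt β) f (genP n β *ᵥ f) = -dirE β f := by
  have h1 : ip (wt β) f (genP n β *ᵥ f) =
      ∑ σ : ConfigP n, ∑ x, cond β σ x * (f σ * (f (flipP n σ x) - f σ)) := by
    unfold ip
    refine Finset.sum_congr rfl fun σ _ => ?_
    rw [genP_mulVec, Finset.mul_sum, Finset.mul_sum]
    refine Finset.sum_congr rfl fun x _ => ?_
    rw [← wt_mul_rate]; ring
  have h2 : ∑ σ : ConfigP n, ∑ x, cond β σ x * (f σ * (f (flipP n σ x) - f σ)) =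
      ∑ σ : ConfigP n, ∑ x, cond β σ x * (f (flipP n σ x) * (f σ - f (flipP n σ x))) := by
    rw [Finset.sum_comm]
    conv_rhs => rw [Finset.sum_comm]
    refine Finset.sum_congr rfl fun x _ => ?_
    have hinv : Function.Involutive fun σ : ConfigP n => flipP n σ x := fun σ => flip_flip σ x
    rw [← Equiv.sum_comp hinv.toPerm]
    refine Finset.sum_congr rfl fun σ _ => ?_
    simp only [Function.Involutive.coe_toPerm]
    rw [cond_flip, flip_flip]
  have h3 : 2 * ip (wt β) f (genP n β *ᵥ f) = -(2 * dirE β f) := by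
    rw [two_mul]
    nth_rewrite 2 [h1]
    rw [h2, h1, ← Finset.sum_add_distrib]
    unfold dirE
    rw [mul_div_cancel₀ _ (two_ne_zero), ← Finset.sum_neg_distrib]
    refine Finset.sum_congr rfl fun σ _ => ?_
    rw [← Finset.sum_add_distrib, ← Finset.sum_neg_distrib]
    exact Finset.sum_congr rfl fun x _ => by ring
  linarith

lemma eq_flip_iff {σ η : ConfigP n} {x : Fin n × Fin n} : η = flipP n σ x ↔ σ = flipP n η x :=
  ⟨fun h => by rw [h, flip_flip], fun h => by rw [h, flip_flip]⟩

lemma metroRateP_nonneg (β : ℝ) (σ η : ConfigP n) : 0 ≤ metroRateP n β σ η :=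
  le_min zero_le_one (Real.exp_pos _).le

lemma revChain (n : ℕ) [NeZero n] (β : ℝ) : RevChain (genP n β) (wt β) where
  pos := wt_pos β
  symm σ η := by
    by_cases h : η = σ
    · rw [h]
    · rw [genP_apply, genP_apply, if_neg h, if_neg (Ne.symm h), zero_add, zero_add, Finset.mul_sum,
        Finset.mul_sum]
      refine Finset.sum_congr rfl fun x _ => ?_
      by_cases hx : η = flipP n σ x
      · have hx' := eq_flip_iff.1 hx
        rw [if_pos hx, if_pos hx', wt_mul_rate, wt_mul_rate, hx, cond_flip]
      · rw [if_neg hx, if_neg fun h => hx (eq_flip_iff.2 h)]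
        simp
  off σ η h := by
    rw [genP_apply, if_neg (Ne.symm h), zero_add]
    exact Finset.sum_nonneg fun x _ => by
      split_ifs
      · exact metroRateP_nonneg β _ _
      · exact le_rfl
  row σ := by
    have h := genP_mulVec β (fun _ => (1 : ℝ)) σ
    simpa [Matrix.mulVec, dotProduct] using h

/-! ### Line flips -/

/-- Flip all the lines selected by `u` and `v`. -/
def act (u v : Fin n → Bool) (σ : ConfigP n) : ConfigP n := fun y => (σ y ^^ (u y.1 ^^ v y.2))

lemma act_act (u v u' v' : Fin n → Bool) (σ : ConfigP n) :
    act u v (act u' v' σ) = act (fun i => (u i ^^ u' i)) (fun j => (v j ^^ v' j)) σ := by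
  funext y
  simp only [act]
  generalize σ y = a
  generalize u y.1 = b
  generalize v y.2 = c
  generalize u' y.1 = d
  generalize v' y.2 = e
  revert a b c d e
  decide

lemma act_self (u v : Fin n → Bool) (σ : ConfigP n) : act u v (act u v σ) = σ := by
  funext y
  simp [act]

/-- `act u v` as a permutation. -/
def actE (u v : Fin n → Bool) : ConfigP n ≃ ConfigP n :=
  Function.Involutive.toPerm (act u v) (act_self u v)

lemma actE_apply (u v : Fin n → Bool) (σ : ConfigP n) : actE u v σ = act u v σ := rfl

lemma dft_act (u v : Fin n → Bool) (σ : ConfigP n) (y : Fin n × Fin n) :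
    dft (act u v σ) y = dft σ y := by
  simp only [dft, act]
  generalize u y.1 = a
  generalize u (y.1 + 1) = b
  generalize v y.2 = c
  generalize v (y.2 + 1) = d
  generalize σ y = e
  generalize σ (y.1 + 1, y.2) = f
  generalize σ (y.1, y.2 + 1) = g
  generalize σ (y.1 + 1, y.2 + 1) = h
  revert a b c d e f g h
  decide

lemma ndef_congr {σ τ : ConfigP n} (h : ∀ y, dft σ y = dft τ y) : ndef σ = ndef τ := by
  simp [ndef, h]

lemma ndef_act (u v : Fin n → Bool) (σ : ConfigP n) : ndef (act u v σ) = ndef σ :=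
  ndef_congr (dft_act u v σ)

lemma wt_act (β : ℝ) (u v : Fin n → Bool) (σ : ConfigP n) : wt β (act u v σ) = wt β σ := by
  rw [wt, wt, ndef_act]

lemma act_mem_Gr {u v : Fin n → Bool} {σ : ConfigP n} : act u v σ ∈ Gr n ↔ σ ∈ Gr n := by
  simp [mem_Gr, dft_act]

lemma flip_act (u v : Fin n → Bool) (σ : ConfigP n) (x : Fin n × Fin n) :
    flipP n (act u v σ) x = act u v (flipP n σ x) := by
  funext y
  by_cases h : y = x <;> simp [flipP, act, h]

lemma act_injective (u v : Fin n → Bool) : Function.Injective (act (n := n) u v) :=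
  (actE u v).injective

lemma genP_act (β : ℝ) (u v : Fin n → Bool) (σ η : ConfigP n) :
    genP n β (actE u v σ) (actE u v η) = genP n β σ η := by
  have hr : ∀ x, metroRateP n β (act u v σ) (act u v (flipP n σ x)) =
      metroRateP n β σ (flipP n σ x) := by
    intro x
    unfold metroRateP
    rw [hamP_eq, hamP_eq, hamP_eq, hamP_eq, ndef_act, ndef_act]
  simp only [genP_apply, actE_apply, flip_act, hr, (act_injective u v).eq_iff]

/-- Configurations with the same defects differ by line flips. -/
lemma exists_act {σ τ : ConfigP n} (h : ∀ y, dft σ y = dft τ y) : ∃ u v, τ = act u v σ := by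
  set e : ConfigP n := fun y => (σ y ^^ τ y) with he
  have h1 : ∀ i j, (e (i, j) ^^ e (i + 1, j)) = (e (i, j + 1) ^^ e (i + 1, j + 1)) := by
    intro i j
    have := h (i, j)
    simp only [dft, he] at this ⊢
    revert this
    generalize σ (i, j) = a
    generalize σ (i + 1, j) = b
    generalize σ (i, j + 1) = c
    generalize σ (i + 1, j + 1) = d
    generalize τ (i, j) = a'
    generalize τ (i + 1, j) = b'
    generalize τ (i, j + 1) = c'
    generalize τ (i + 1, j + 1) = d'
    revert a b c d a' b' c' d'
    decide
  have h2 : ∀ i j, (e (i, j) ^^ e (i + 1, j)) = (e (i, 0) ^^ e (i + 1, 0)) := fun i j =>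
    const_of_succ (h := fun j => (e (i, j) ^^ e (i + 1, j))) (fun j => (h1 i j).symm) j 0
  have h3 : ∀ i j, (e (i, j) ^^ e (i, 0)) = (e (0, j) ^^ e (0, 0)) := fun i j =>
    const_of_succ (h := fun i => (e (i, j) ^^ e (i, 0))) (fun i => by
      have := h2 i j
      revert this
      generalize e (i, j) = a
      generalize e (i + 1, j) = b
      generalize e (i, 0) = c
      generalize e (i + 1, 0) = d
      revert a b c d
      decide) i 0
  refine ⟨fun i => e (i, 0), fun j => (e (0, j) ^^ e (0, 0)), ?_⟩
  funext y
  have h4 := h3 y.1 y.2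
  have h5 : e y = (σ y ^^ τ y) := rfl
  simp only [act]
  rw [← h4, show e (y.1, y.2) = e y from rfl, h5]
  generalize σ y = a
  generalize τ y = b
  generalize e (y.1, 0) = c
  revert a b c
  decide

lemma sgp_act (β t : ℝ) (f : ConfigP n → ℝ) (u v : Fin n → Bool) (σ : ConfigP n) :
    sgp (genP n β) t f (act u v σ) = sgp (genP n β) t (fun η => f (act u v η)) σ :=
  sgp_comp_equiv (actE u v) (genP_act β u v) t f σ

lemma const_mem_Gr : (fun _ => true : ConfigP n) ∈ Gr n := by simp [mem_Gr, dft]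

lemma Gr_card_pos : 0 < ((Gr n).card : ℝ) :=
  Nat.cast_pos.2 (Finset.card_pos.2 ⟨_, const_mem_Gr⟩)

end Chain

/-! ### Consequences of the Poincaré inequality -/

section Consequences

open Matrix

variable {n : ℕ} [NeZero n] {β : ℝ}

lemma dirE_const (β c : ℝ) : dirE (n := n) β (fun _ => c) = 0 := by simp [dirE]

lemma Reg.exp_two_le (h : Reg n β) : Real.exp (-(2 * β)) ≤ 1 / 1000000 := by
  refine le_trans (Real.exp_le_exp.2 ?_) h.exp_neg_le
  have := h.beta
  linarith

lemma Reg.sum_ndef_le (h : Reg n β) :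
    ∑ σ : ConfigP n, wt β σ * ndef σ ≤ 20 * Real.exp (-(2 * β)) * (Gr n).card := by
  have := poincare h (fun _ => (1 : ℝ))
  rw [dirE_const] at this
  simpa using this

lemma card_Gr_le_sum (β : ℝ) : ((Gr n).card : ℝ) ≤ ∑ σ : ConfigP n, wt β σ := by
  calc ((Gr n).card : ℝ) = ∑ σ ∈ Gr n, wt β σ := by
        rw [Finset.sum_congr rfl fun σ hσ => wt_Gr hσ]; simp
    _ ≤ _ := Finset.sum_le_sum_of_subset_of_nonneg (Finset.subset_univ _)
        fun σ _ _ => (wt_pos β σ).le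

lemma Reg.sum_compl_le (h : Reg n β) :
    ∑ σ ∈ (Gr n)ᶜ, wt β σ ≤ 20 * Real.exp (-(2 * β)) * (Gr n).card := by
  refine le_trans ?_ h.sum_ndef_le
  refine (Finset.sum_le_sum fun σ hσ => ?_).trans
    (Finset.sum_le_sum_of_subset_of_nonneg (Finset.subset_univ _) fun σ _ _ =>
      mul_nonneg (wt_pos β σ).le (Nat.cast_nonneg _))
  have h1 : (1 : ℝ) ≤ ndef σ := by exact_mod_cast ndef_pos (Finset.mem_compl.1 hσ)
  nlinarith [wt_pos β σ]

lemma sum_wt_Gr (β : ℝ) (f : ConfigP n → ℝ) :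
    ∑ σ : ConfigP n, wt β σ * f σ = ∑ σ ∈ Gr n, f σ + ∑ σ ∈ (Gr n)ᶜ, wt β σ * f σ := by
  rw [← Finset.sum_add_sum_compl (Gr n)]
  congr 1
  exact Finset.sum_congr rfl fun σ hσ => by rw [wt_Gr hσ, one_mul]

lemma Reg.sum_wt_le (h : Reg n β) :
    ∑ σ : ConfigP n, wt β σ ≤ (1 + 20 * Real.exp (-(2 * β))) * (Gr n).card := by
  have h1 := sum_wt_Gr (n := n) β (fun _ => (1 : ℝ))
  simp only [mul_one] at h1
  rw [h1]
  have h2 := h.sum_compl_le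
  simp only [Finset.sum_const, nsmul_eq_mul, mul_one]
  linarith

lemma Reg.sum_wt_le_two (h : Reg n β) : ∑ σ : ConfigP n, wt β σ ≤ 2 * (Gr n).card := by
  refine h.sum_wt_le.trans (mul_le_mul_of_nonneg_right ?_ (Nat.cast_nonneg _))
  have := h.exp_two_le
  linarith

lemma Reg.norm_le (h : Reg n β) (f : ConfigP n → ℝ) :
    ip (wt β) f f ≤ 60 * Real.exp (7 / 2 * β) * dirE β f +
      (1 + 20 * Real.exp (-(2 * β))) * ∑ σ ∈ Gr n, f σ ^ 2 := by
  have h1 := poincare h f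
  have h2 := sum_split_Gr β (fun σ => f σ ^ 2) (fun σ => sq_nonneg _)
  have h3 : ip (wt β) f f = ∑ σ, wt β σ * f σ ^ 2 := by
    unfold ip; exact Finset.sum_congr rfl fun σ _ => by ring
  rw [h3]
  linarith

end Consequences

/-! ### Lower bound of the Dirichlet form on symmetry sectors -/

section Sector

variable {n : ℕ} [NeZero n] {β : ℝ}

/-- The selector of a single line. -/
def sing (r : Fin n) : Fin n → Bool := fun i => decide (i = r)

/-- The selector of no line. -/
def nul : Fin n → Bool := fun _ => false

lemma seg_apply (σ : ConfigP n) (a j : Fin n) {m : ℕ} (hm : m ≤ n) (y : Fin n × Fin n) :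
    seg σ a j m y =
      (σ y ^^ (decide (y.2 = j + 1) && decide (∃ k, k < m ∧ y.1 = a + (k + 1) • (1 : Fin n)))) := by
  induction m with
  | zero => simp [seg]
  | succ m ih =>
    have hex : (∃ k, k < m + 1 ∧ y.1 = a + (k + 1) • (1 : Fin n)) ↔
        (y.1 = a + (m + 1) • (1 : Fin n)) ∨ (∃ k, k < m ∧ y.1 = a + (k + 1) • (1 : Fin n)) := by
      constructor
      · rintro ⟨k, hk, h⟩
        rcases Nat.lt_succ_iff_lt_or_eq.1 hk with h' | rfl
        · exact Or.inr ⟨k, h', h⟩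
        · exact Or.inl h
      · rintro (h | ⟨k, hk, h⟩)
        · exact ⟨m, Nat.lt_succ_self m, h⟩
        · exact ⟨k, hk.trans (Nat.lt_succ_self m), h⟩
    have hno : y.1 = a + (m + 1) • (1 : Fin n) →
        ¬ ∃ k, k < m ∧ y.1 = a + (k + 1) • (1 : Fin n) := by
      rintro h ⟨k, hk, h'⟩
      have e : (a + 1) + m • (1 : Fin n) = (a + 1) + k • (1 : Fin n) := by
        rw [h, succ_nsmul', succ_nsmul'] at h'
        rw [add_assoc, add_assoc]; exact h'
      have := add_nsmul_inj (by omega) (by omega) e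
      omega
    rw [seg, flipP]
    have hy : y = (a + (m + 1) • (1 : Fin n), j + 1) ↔
        y.1 = a + (m + 1) • (1 : Fin n) ∧ y.2 = j + 1 := by
      rw [Prod.ext_iff]
    by_cases h1 : y.1 = a + (m + 1) • (1 : Fin n) <;> by_cases h2 : y.2 = j + 1
    · rw [if_pos (hy.2 ⟨h1, h2⟩), ih (by omega), decide_eq_true (hex.2 (Or.inl h1)),
        decide_eq_false (hno h1), decide_eq_true h2]
      simp
    · rw [if_neg fun h => h2 (hy.1 h).2, ih (by omega), decide_eq_false h2]
      simp
    · rw [if_neg fun h => h1 (hy.1 h).1, ih (by omega)]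
      congr 2
      simp only [hex, h1, false_or]
    · rw [if_neg fun h => h1 (hy.1 h).1, ih (by omega)]
      congr 2
      simp only [hex, h1, false_or]

lemma seg_full (σ : ConfigP n) (a j : Fin n) : seg σ a j n = act nul (sing (j + 1)) σ := by
  funext y
  rw [seg_apply σ a j le_rfl]
  have : ∃ k, k < n ∧ y.1 = a + (k + 1) • (1 : Fin n) := by
    refine ⟨(y.1 - (a + 1)).val, (y.1 - (a + 1)).isLt, ?_⟩
    have e : (y.1 - (a + 1)).val • (1 : Fin n) = y.1 - (a + 1) := by
      apply Fin.ext; rw [nsmul_one_val, Nat.mod_eq_of_lt (y.1 - (a + 1)).isLt]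
    rw [succ_nsmul, e]; abel
  rw [decide_eq_true this]
  simp [act, sing, nul]

lemma wt_four {σ : ConfigP n} (h : ndef σ = 4) : wt β σ = Real.exp (-(4 * β)) := by
  rw [wt, h]; congr 1; push_cast; ring

lemma ndef_seg_Gr (hn : 2 ≤ n) {g : ConfigP n} (hg : g ∈ Gr n) (a j : Fin n) {m : ℕ} (h1 : 1 ≤ m)
    (h2 : m < n) : ndef (seg g a j m) = 4 := by
  have h := ndef_seg (τ := g) (a := a) (j := j) hn h1 h2
  have hg' := mem_Gr.1 hg
  rw [gain_false (hg' _), gain_false (hg' _), gain_false (hg' _), gain_false (hg' _),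
    ndef_eq_zero.2 hg] at h
  omega

lemma cond_seg_Gr (hn : 2 ≤ n) (hβ : 0 ≤ β) {g : ConfigP n} (hg : g ∈ Gr n) (a j : Fin n) {m : ℕ}
    (hm : m < n) : min (wt β (seg g a j m)) (wt β (seg g a j (m + 1))) = Real.exp (-(4 * β)) := by
  have hle : Real.exp (-(4 * β)) ≤ 1 := by rw [Real.exp_le_one_iff]; linarith
  rcases Nat.eq_zero_or_pos m with rfl | h0
  · rw [wt_four (ndef_seg_Gr hn hg a j le_rfl (by omega)), seg, wt_Gr hg, min_eq_right hle]
  · rw [wt_four (ndef_seg_Gr hn hg a j h0 hm)]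
    by_cases h1 : m + 1 = n
    · rw [h1, seg_full, wt_act, wt_Gr hg, min_eq_left hle]
    · rw [wt_four (ndef_seg_Gr hn hg a j (by omega) (by omega)), min_self]

lemma edgeE_flip (β : ℝ) (f : ConfigP n → ℝ) (σ : ConfigP n) (x : Fin n × Fin n) :
    edgeE β f (flipP n σ x, x) = edgeE β f (σ, x) := by
  simp only [edgeE, cond_flip, flip_flip]
  ring

lemma sq_three_le {k : ℕ} (hk : 0 < k) (x z : ℝ) (y : ℕ → ℝ) :
    (x + ∑ m ∈ Finset.range k, y m + z) ^ 2 ≤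
      (k + 8) * ((x ^ 2 + z ^ 2) / 4 + ∑ m ∈ Finset.range k, y m ^ 2) := by
  have h := sq_sum_le_card_mul_sum_sq (s := Finset.range k) (f := y)
  rw [Finset.card_range] at h
  generalize ∑ m ∈ Finset.range k, y m = Y at *
  generalize ∑ m ∈ Finset.range k, y m ^ 2 = Q at *
  have hk' : (0 : ℝ) < k := Nat.cast_pos.2 hk
  generalize (k : ℝ) = K at *
  have hQ : Y ^ 2 / K ≤ Q := by rw [div_le_iff₀ hk']; linarith
  have key : (x + Y + z) ^ 2 ≤ (K + 8) * ((x ^ 2 + z ^ 2) / 4 + Y ^ 2 / K) := by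
    have : (K + 8) * ((x ^ 2 + z ^ 2) / 4 + Y ^ 2 / K) - (x + Y + z) ^ 2 =
        (K * x - 4 * Y) ^ 2 / (4 * K) + (K * z - 4 * Y) ^ 2 / (4 * K) + (x - z) ^ 2 := by
      field_simp; ring
    have h1 : 0 ≤ (K * x - 4 * Y) ^ 2 / (4 * K) := by positivity
    have h2 : 0 ≤ (K * z - 4 * Y) ^ 2 / (4 * K) := by positivity
    nlinarith [sq_nonneg (x - z)]
  refine key.trans (mul_le_mul_of_nonneg_left (by linarith) (by linarith))

/-- The edges along which a vertical pair of defects moves to the right. -/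
def LeftPat (e : ConfigP n × (Fin n × Fin n)) : Prop :=
  dft e.1 (e.2.1 - 1, e.2.2 - 1) = true ∧ dft e.1 (e.2.1 - 1, e.2.2) = true ∧
    dft e.1 (e.2.1, e.2.2 - 1) = false ∧ dft e.1 (e.2.1, e.2.2) = false

/-- The edges along which a horizontal pair of defects moves up. -/
def DownPat (e : ConfigP n × (Fin n × Fin n)) : Prop :=
  dft e.1 (e.2.1 - 1, e.2.2 - 1) = true ∧ dft e.1 (e.2.1, e.2.2 - 1) = true ∧
    dft e.1 (e.2.1 - 1, e.2.2) = false ∧ dft e.1 (e.2.1, e.2.2) = false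

/-- The edges creating four defects. -/
def NonePat (e : ConfigP n × (Fin n × Fin n)) : Prop :=
  dft e.1 (e.2.1 - 1, e.2.2 - 1) = false ∧ dft e.1 (e.2.1, e.2.2 - 1) = false ∧
    dft e.1 (e.2.1 - 1, e.2.2) = false ∧ dft e.1 (e.2.1, e.2.2) = false

/-- One step of the path flipping the line `j + 1`; the parameters are `(g, a, j, m)`. -/
def lineEdge (q : ConfigP n × (Fin n × (Fin n × ℕ))) : ConfigP n × (Fin n × Fin n) :=
  (seg q.1 q.2.1 q.2.2.1 (q.2.2.2 + 1), (q.2.1 + (q.2.2.2 + 1 + 1) • (1 : Fin n), q.2.2.1 + 1))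

lemma dft_seg_Gr {g : ConfigP n} (hg : g ∈ Gr n) (a j : Fin n) (m : ℕ) (y : Fin n × Fin n) :
    dft (seg g a j m) y = (duo a (a + m • (1 : Fin n)) y.1 && duo j (j + 1) y.2) := by
  rw [dft_seg, mem_Gr.1 hg]
  simp

lemma leftPat_lineEdge (hn : 2 ≤ n) {g : ConfigP n} (hg : g ∈ Gr n) (a j : Fin n) {m : ℕ}
    (hm : m < n - 2) : LeftPat (lineEdge (g, a, j, m)) := by
  have e1 : a + (m + 1 + 1) • (1 : Fin n) - 1 = a + (m + 1) • (1 : Fin n) := by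
    rw [succ_nsmul _ (m + 1)]; abel
  have e2 : j + 1 - 1 = j := by abel
  have hj := (succ_ne hn j).symm
  have ha : a ≠ a + (m + 1) • (1 : Fin n) := (add_nsmul_ne (by omega) (by omega)).symm
  have hb : duo a (a + (m + 1) • (1 : Fin n)) (a + (m + 1 + 1) • (1 : Fin n)) = false := by
    refine duo_of_ne (add_nsmul_ne (by omega) (by omega)) fun h => ?_
    have := add_nsmul_inj (by omega) (by omega) h
    omega
  simp only [LeftPat, lineEdge, dft_seg_Gr hg, e1, e2, duo_right ha, duo_left hj, duo_right hj, hb]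
  simp

lemma lineEdge_injOn (hn : 2 ≤ n) : Set.InjOn (lineEdge (n := n))
    {q | q.1 ∈ Gr n ∧ q.2.2.2 < n - 2} := by
  rintro ⟨g, a, j, m⟩ ⟨hg, hm⟩ ⟨g', a', j', m'⟩ ⟨hg', hm'⟩ h
  simp only at hg hm hg' hm'
  simp only [lineEdge, Prod.mk.injEq] at h
  obtain ⟨h1, h2, h3⟩ := h
  have hj : j = j' := add_right_cancel h3
  subst hj
  have hj' := (succ_ne hn j).symm
  have h4 : a + (m + 1) • (1 : Fin n) = a' + (m' + 1) • (1 : Fin n) := by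
    rw [succ_nsmul _ (m + 1), succ_nsmul _ (m' + 1), ← add_assoc, ← add_assoc] at h2
    exact add_right_cancel h2
  have ha : a ≠ a + (m + 1) • (1 : Fin n) := (add_nsmul_ne (by omega) (by omega)).symm
  have h5 := congrArg (fun τ => dft τ (a, j)) h1
  simp only [dft_seg_Gr hg, dft_seg_Gr hg', duo_left ha, duo_left hj', Bool.and_true] at h5
  have haa : a = a' := by
    by_contra hne
    rw [duo_of_ne hne (by rw [← h4]; exact ha)] at h5
    cases h5
  subst haa
  have hmm : m + 1 = m' + 1 := add_nsmul_inj (by omega) (by omega) h4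
  have hmm' : m = m' := by omega
  subst hmm'
  rw [seg_inj h1]

lemma line_le (hn : 3 ≤ n) (hβ : 0 ≤ β) {f : ConfigP n → ℝ} {g : ConfigP n} (hg : g ∈ Gr n)
    (a j : Fin n) (hf : f (act nul (sing (j + 1)) g) = -f g) :
    4 * Real.exp (-(4 * β)) * f g ^ 2 ≤ (n + 6) *
      ((edgeE β f (g, (a + 1, j + 1)) + edgeE β f (act nul (sing (j + 1)) g, (a, j + 1))) / 4 +
        ∑ m ∈ Finset.range (n - 2), edgeE β f (lineEdge (g, a, j, m))) := by
  obtain ⟨k, rfl⟩ : ∃ k, n = k + 1 + 1 := ⟨n - 2, by omega⟩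
  have hk : 0 < k := by omega
  set D : ℕ → ℝ := fun m => f (seg g a j (m + 1)) - f (seg g a j m) with hD
  have hE : ∀ m, m < k + 1 + 1 → edgeE β f (seg g a j m, (a + (m + 1) • (1 : Fin (k + 1 + 1)), j + 1)) =
      Real.exp (-(4 * β)) * D m ^ 2 := by
    intro m hm
    rw [← cond_seg_Gr (by omega) hβ hg a j hm]
    simp only [edgeE, SPMP.cond, hD, seg]
  have hsum : ∑ m ∈ Finset.range (k + 1 + 1), D m = -(2 * f g) := by
    rw [Finset.sum_range_sub (fun m => f (seg g a j m)), seg_full, hf, seg]; ring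
  rw [Finset.sum_range_succ, Finset.sum_range_succ'] at hsum
  have hcs := sq_three_le hk (D 0) (D (k + 1)) (fun m => D (m + 1))
  rw [add_comm (D 0), hsum] at hcs
  have e0 : edgeE β f (g, (a + 1, j + 1)) = Real.exp (-(4 * β)) * D 0 ^ 2 := by
    have := hE 0 (by omega)
    rw [zero_add, one_nsmul, seg] at this
    exact this
  have e1 : edgeE β f (act nul (sing (j + 1)) g, (a, j + 1)) = Real.exp (-(4 * β)) * D (k + 1) ^ 2 := by
    have := hE (k + 1) (by omega)
    rw [← edgeE_flip] at this
    rw [← this]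
    have h1 := seg_full g a j
    rw [seg] at h1
    rw [h1, nsmul_card, add_zero]
  have e2 : ∀ m ∈ Finset.range k, edgeE β f (lineEdge (g, a, j, m)) =
      Real.exp (-(4 * β)) * D (m + 1) ^ 2 := by
    intro m hm
    exact hE (m + 1) (by have := Finset.mem_range.1 hm; omega)
  have hk2 : k + 1 + 1 - 2 = k := by omega
  rw [hk2, Finset.sum_congr rfl e2, ← Finset.mul_sum, e0, e1]
  have hpos := Real.exp_pos (-(4 * β))
  have := mul_le_mul_of_nonneg_left hcs hpos.le
  push_cast
  linarith

/-- The energy of `f` on the edges with a given pattern. -/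
def patE (β : ℝ) (f : ConfigP n → ℝ) (P : ConfigP n × (Fin n × Fin n) → Prop) : ℝ :=
  ∑ e, if P e then edgeE β f e else 0

lemma sum_le_patE {S : Type*} {s : Finset S} {φ : S → ConfigP n × (Fin n × Fin n)}
    {P : ConfigP n × (Fin n × Fin n) → Prop} (f : ConfigP n → ℝ) (hφ : Set.InjOn φ s)
    (hP : ∀ i ∈ s, P (φ i)) : ∑ i ∈ s, edgeE β f (φ i) ≤ patE β f P := by
  have h := sum_inj_le (g := fun e => if P e then edgeE β f e else 0) hφ fun e => by
    split_ifs
    · exact edgeE_nonneg β f e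
    · exact le_rfl
  refine le_trans (le_of_eq (Finset.sum_congr rfl fun i hi => ?_)) h
  rw [if_pos (hP i hi)]

lemma lines_le (hn : 3 ≤ n) (hβ : 0 ≤ β) {f : ConfigP n → ℝ} (J : Finset (Fin n))
    (hf : ∀ j ∈ J, ∀ g ∈ Gr n, f (act nul (sing (j + 1)) g) = -f g) :
    n * (J.card * (4 * Real.exp (-(4 * β)) * ∑ g ∈ Gr n, f g ^ 2)) ≤
      (n + 6) * (patE β f LeftPat + patE β f NonePat / 2) := by
  set S := Gr n ×ˢ ((Finset.univ : Finset (Fin n)) ×ˢ J) with hS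
  have hmem : ∀ q, q ∈ S ↔ q.1 ∈ Gr n ∧ q.2.2 ∈ J := by
    intro q; simp [hS, Finset.mem_product]
  have hl : n * (J.card * (4 * Real.exp (-(4 * β)) * ∑ g ∈ Gr n, f g ^ 2)) =
      ∑ q ∈ S, 4 * Real.exp (-(4 * β)) * f q.1 ^ 2 := by
    rw [hS, Finset.sum_product]
    simp only [Finset.sum_const, Finset.card_product, Finset.card_univ, Fintype.card_fin,
      nsmul_eq_mul, ← Finset.mul_sum]
    push_cast
    ring
  have hnone : ∀ g ∈ Gr n, ∀ x, NonePat (g, x) := by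
    intro g hg x
    simp [NonePat, mem_Gr.1 hg]
  have i1 : ∑ q ∈ S, edgeE β f (q.1, (q.2.1 + 1, q.2.2 + 1)) ≤ patE β f NonePat := by
    refine sum_le_patE (φ := fun q : ConfigP n × (Fin n × Fin n) => (q.1, (q.2.1 + 1, q.2.2 + 1)))
      f ?_ fun q hq => hnone _ ((hmem q).1 hq).1 _
    rintro ⟨g, a, j⟩ - ⟨g', a', j'⟩ - h
    simp only [Prod.mk.injEq, add_left_inj] at h
    simp [h]
  have i2 : ∑ q ∈ S, edgeE β f (act nul (sing (q.2.2 + 1)) q.1, (q.2.1, q.2.2 + 1)) ≤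
      patE β f NonePat := by
    refine sum_le_patE (φ := fun q : ConfigP n × (Fin n × Fin n) =>
      (act nul (sing (q.2.2 + 1)) q.1, (q.2.1, q.2.2 + 1)))
      f ?_ fun q hq => hnone _ (act_mem_Gr.2 ((hmem q).1 hq).1) _
    rintro ⟨g, a, j⟩ - ⟨g', a', j'⟩ - h
    simp only [Prod.mk.injEq, add_left_inj] at h
    obtain ⟨h1, h2, h3⟩ := h
    subst h2 h3
    rw [act_injective _ _ h1]
  have i3 : ∑ q ∈ S, ∑ m ∈ Finset.range (n - 2), edgeE β f (lineEdge (q.1, q.2.1, q.2.2, m)) ≤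
      patE β f LeftPat := by
    rw [← Finset.sum_product']
    refine sum_le_patE (φ := fun p : (ConfigP n × (Fin n × Fin n)) × ℕ =>
      lineEdge (p.1.1, p.1.2.1, p.1.2.2, p.2)) f ?_ ?_
    · rintro ⟨⟨g, a, j⟩, m⟩ hp ⟨⟨g', a', j'⟩, m'⟩ hp' h
      rw [Finset.mem_coe, Finset.mem_product, hmem, Finset.mem_range] at hp hp'
      have := lineEdge_injOn (n := n) (by omega) ⟨hp.1.1, hp.2⟩ ⟨hp'.1.1, hp'.2⟩ h
      simp only [Prod.mk.injEq] at this
      simp [this]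
    · rintro ⟨⟨g, a, j⟩, m⟩ hp
      rw [Finset.mem_product, hmem, Finset.mem_range] at hp
      exact leftPat_lineEdge (by omega) hp.1.1 a j hp.2
  rw [hl]
  calc ∑ q ∈ S, 4 * Real.exp (-(4 * β)) * f q.1 ^ 2
      ≤ ∑ q ∈ S, ((n : ℝ) + 6) * ((edgeE β f (q.1, (q.2.1 + 1, q.2.2 + 1)) +
          edgeE β f (act nul (sing (q.2.2 + 1)) q.1, (q.2.1, q.2.2 + 1))) / 4 +
          ∑ m ∈ Finset.range (n - 2), edgeE β f (lineEdge (q.1, q.2.1, q.2.2, m))) :=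
        Finset.sum_le_sum fun q hq =>
          line_le hn hβ ((hmem q).1 hq).1 q.2.1 q.2.2 (hf _ ((hmem q).1 hq).2 _ ((hmem q).1 hq).1)
    _ = (n + 6) * ((∑ q ∈ S, edgeE β f (q.1, (q.2.1 + 1, q.2.2 + 1)) +
          ∑ q ∈ S, edgeE β f (act nul (sing (q.2.2 + 1)) q.1, (q.2.1, q.2.2 + 1))) / 4 +
          ∑ q ∈ S, ∑ m ∈ Finset.range (n - 2), edgeE β f (lineEdge (q.1, q.2.1, q.2.2, m))) := by
        rw [← Finset.mul_sum, Finset.sum_add_distrib, ← Finset.sum_div, Finset.sum_add_distrib]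
    _ ≤ _ := by
        refine mul_le_mul_of_nonneg_left ?_ (by positivity)
        linarith

end Sector

section SectorGap

open Matrix

variable {n : ℕ} [NeZero n] {β : ℝ}

lemma tr_flip (σ : ConfigP n) (x : Fin n × Fin n) : tr (flipP n σ x) = flipP n (tr σ) x.swap := by
  funext y
  have : y.swap = x ↔ y = x.swap := by
    constructor
    · intro h; rw [← h, Prod.swap_swap]
    · intro h; rw [h, Prod.swap_swap]
  simp only [tr, flipP, this]

lemma tr_act (u v : Fin n → Bool) (σ : ConfigP n) : tr (act u v σ) = act v u (tr σ) := by
  funext y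
  simp only [tr, act, Prod.fst_swap, Prod.snd_swap, Bool.xor_comm (u y.2)]

lemma ndef_tr (σ : ConfigP n) : ndef (tr σ) = ndef σ := by
  have h : (ndef (tr σ) : ℝ) = ndef σ := by
    rw [ndef_cast, ndef_cast]
    simp only [dft_tr]
    exact Equiv.sum_comp (Equiv.prodComm (Fin n) (Fin n)) fun y => if dft σ y = true then (1 : ℝ) else 0
  exact_mod_cast h

lemma tr_mem_Gr {σ : ConfigP n} : tr σ ∈ Gr n ↔ σ ∈ Gr n := by
  rw [← ndef_eq_zero, ndef_tr, ndef_eq_zero]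

lemma cond_tr (β : ℝ) (σ : ConfigP n) (x : Fin n × Fin n) :
    cond β (tr σ) x.swap = cond β σ x := by
  rw [cond, cond, ← tr_flip, wt, wt, wt, wt, ndef_tr, ndef_tr]

/-- Transposition as a permutation. -/
def trE : ConfigP n ≃ ConfigP n := Function.Involutive.toPerm tr tr_tr

lemma patE_tr_left (β : ℝ) (f : ConfigP n → ℝ) :
    patE β (fun σ => f (tr σ)) LeftPat = patE β f DownPat := by
  unfold patE
  conv_rhs => rw [← Equiv.sum_comp (trE.prodCongr (Equiv.prodComm (Fin n) (Fin n)))]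
  refine Finset.sum_congr rfl fun e _ => ?_
  obtain ⟨σ, x⟩ := e
  have h1 : DownPat (tr σ, x.swap) ↔ LeftPat (σ, x) := by
    simp [DownPat, LeftPat, dft_tr]
  have h2 : edgeE β f (tr σ, x.swap) = edgeE β (fun σ => f (tr σ)) (σ, x) := by
    simp only [edgeE, cond_tr, tr_flip]
  show (if LeftPat (σ, x) then _ else _) = if DownPat (tr σ, x.swap) then edgeE β f (tr σ, x.swap) else 0
  rw [h2]
  by_cases h : LeftPat (σ, x)
  · rw [if_pos h, if_pos (h1.2 h)]
  · rw [if_neg h, if_neg fun h' => h (h1.1 h')]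

lemma patE_tr_none (β : ℝ) (f : ConfigP n → ℝ) :
    patE β (fun σ => f (tr σ)) NonePat = patE β f NonePat := by
  unfold patE
  conv_rhs => rw [← Equiv.sum_comp (trE.prodCongr (Equiv.prodComm (Fin n) (Fin n)))]
  refine Finset.sum_congr rfl fun e _ => ?_
  obtain ⟨σ, x⟩ := e
  have h1 : NonePat (tr σ, x.swap) ↔ NonePat (σ, x) := by
    simp only [NonePat, dft_tr, Prod.fst_swap, Prod.snd_swap, Prod.swap_prod_mk]
    tauto
  have h2 : edgeE β f (tr σ, x.swap) = edgeE β (fun σ => f (tr σ)) (σ, x) := by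
    simp only [edgeE, cond_tr, tr_flip]
  show (if NonePat (σ, x) then _ else _) = if NonePat (tr σ, x.swap) then edgeE β f (tr σ, x.swap) else 0
  rw [h2]
  by_cases h : NonePat (σ, x)
  · rw [if_pos h, if_pos (h1.2 h)]
  · rw [if_neg h, if_neg fun h' => h (h1.1 h')]

lemma ite_six_le (a b c d : Bool) {E : ℝ} (hE : 0 ≤ E) {P Q R P' Q' R' : Prop}
    (hP : P ↔ a = true ∧ b = true ∧ c = false ∧ d = false)
    (hQ : Q ↔ a = true ∧ c = true ∧ b = false ∧ d = false)
    (hR : R ↔ a = false ∧ c = false ∧ b = false ∧ d = false)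
    (hP' : P' ↔ (!a) = true ∧ (!b) = true ∧ (!c) = false ∧ (!d) = false)
    (hQ' : Q' ↔ (!a) = true ∧ (!c) = true ∧ (!b) = false ∧ (!d) = false)
    (hR' : R' ↔ (!a) = false ∧ (!c) = false ∧ (!b) = false ∧ (!d) = false) :
    (if P then E else 0) + (if Q then E else 0) + (if R then E else 0) +
    ((if P' then E else 0) + (if Q' then E else 0) + (if R' then E else 0)) ≤ E := by
  cases a <;> cases b <;> cases c <;> cases d <;> simp [hE, hP, hQ, hR, hP', hQ', hR']

lemma sum_edge_flip (F : ConfigP n × (Fin n × Fin n) → ℝ) :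
    ∑ e : ConfigP n × (Fin n × Fin n), F (flipP n e.1 e.2, e.2) = ∑ e, F e := by
  have hinv : Function.Involutive fun e : ConfigP n × (Fin n × Fin n) => (flipP n e.1 e.2, e.2) := by
    rintro ⟨σ, x⟩
    simp [flip_flip]
  exact Equiv.sum_comp hinv.toPerm F

lemma patE_add_le (hn : 2 ≤ n) (β : ℝ) (f : ConfigP n → ℝ) :
    patE β f LeftPat + patE β f DownPat + patE β f NonePat ≤ dirE β f := by
  have h2 : 2 * (patE β f LeftPat + patE β f DownPat + patE β f NonePat) ≤ 2 * dirE β f := by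
    have hrev : ∀ P : ConfigP n × (Fin n × Fin n) → Prop, patE β f P =
        ∑ e : ConfigP n × (Fin n × Fin n), if P (flipP n e.1 e.2, e.2) then edgeE β f e else 0 := by
      intro P
      rw [patE, ← sum_edge_flip (fun e => if P e then edgeE β f e else 0)]
      exact Finset.sum_congr rfl fun e _ => by rw [edgeE_flip]
    have hsplit : 2 * (patE β f LeftPat + patE β f DownPat + patE β f NonePat) =
        (∑ e, if LeftPat e then edgeE β f e else 0) + (∑ e, if DownPat e then edgeE β f e else 0) +
        (∑ e, if NonePat e then edgeE β f e else 0) +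
        ((∑ e : ConfigP n × (Fin n × Fin n), if LeftPat (flipP n e.1 e.2, e.2) then edgeE β f e else 0) +
        (∑ e : ConfigP n × (Fin n × Fin n), if DownPat (flipP n e.1 e.2, e.2) then edgeE β f e else 0) +
        (∑ e : ConfigP n × (Fin n × Fin n), if NonePat (flipP n e.1 e.2, e.2) then edgeE β f e else 0)) := by
      rw [← hrev, ← hrev, ← hrev, two_mul]
      rfl
    rw [hsplit, ← sum_edgeE]
    simp only [← Finset.sum_add_distrib]
    refine Finset.sum_le_sum fun e _ => ?_
    obtain ⟨σ, x⟩ := e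
    have hd1 : duo (x.1 - 1) x.1 (x.1 - 1) = true := duo_left (pred_ne hn _)
    have hd2 : duo (x.1 - 1) x.1 x.1 = true := duo_right (pred_ne hn _)
    have hd3 : duo (x.2 - 1) x.2 (x.2 - 1) = true := duo_left (pred_ne hn _)
    have hd4 : duo (x.2 - 1) x.2 x.2 = true := duo_right (pred_ne hn _)
    refine ite_six_le (dft σ (x.1 - 1, x.2 - 1)) (dft σ (x.1 - 1, x.2)) (dft σ (x.1, x.2 - 1))
      (dft σ (x.1, x.2)) (edgeE_nonneg β f (σ, x)) Iff.rfl Iff.rfl Iff.rfl ?_ ?_ ?_ <;>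
    simp only [LeftPat, DownPat, NonePat, dft_flip, hd1, hd2, hd3, hd4, Bool.and_true, Bool.xor_true]
  linarith

lemma sector_dirE (hn : 3 ≤ n) (hβ : 0 ≤ β) {f : ConfigP n → ℝ} {A B : Finset (Fin n)}
    (hA : ∀ a ∈ A, ∀ g ∈ Gr n, f (act (sing a) nul g) = -f g)
    (hB : ∀ b ∈ B, ∀ g ∈ Gr n, f (act nul (sing b) g) = -f g) :
    n * ((A.card + B.card) * (4 * Real.exp (-(4 * β)) * ∑ g ∈ Gr n, f g ^ 2)) ≤
      (n + 6) * dirE β f := by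
  set sh : Finset (Fin n) → Finset (Fin n) := fun B => B.map (Equiv.subRight (1 : Fin n)).toEmbedding
    with hsh
  have hmem : ∀ (B : Finset (Fin n)) j, j ∈ sh B → j + 1 ∈ B := by
    intro B j hj
    simp only [hsh, Finset.mem_map, Equiv.coe_toEmbedding, Equiv.subRight_apply] at hj
    obtain ⟨b, hb, rfl⟩ := hj
    rwa [sub_add_cancel]
  have hcard : ∀ B, (sh B).card = B.card := fun B => Finset.card_map _
  have h1 := lines_le hn hβ (f := f) (sh B) fun j hj g hg => hB _ (hmem B j hj) g hg
  have h2 := lines_le hn hβ (f := fun σ => f (tr σ)) (sh A) fun j hj g hg => by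
    show f (tr (act nul (sing (j + 1)) g)) = -f (tr g)
    rw [tr_act]
    exact hA _ (hmem A j hj) _ (tr_mem_Gr.2 hg)
  have h3 : ∑ g ∈ Gr n, f (tr g) ^ 2 = ∑ g ∈ Gr n, f g ^ 2 :=
    Finset.sum_nbij' tr tr (fun g hg => tr_mem_Gr.2 hg) (fun g hg => tr_mem_Gr.2 hg)
      (fun g _ => tr_tr g) (fun g _ => tr_tr g) fun g _ => rfl
  rw [hcard] at h1 h2
  rw [h3, patE_tr_left, patE_tr_none] at h2
  have h4 := mul_le_mul_of_nonneg_left (patE_add_le (by omega) β f)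
    (show (0 : ℝ) ≤ n + 6 by positivity)
  linarith

lemma Reg.exp_neg_half_le (h : Reg n β) : Real.exp (-(β / 2)) ≤ 1 / n := by
  have hn : (0 : ℝ) < n := by have := h.two; exact_mod_cast (by omega : 0 < n)
  rw [le_div_iff₀ hn]
  calc Real.exp (-(β / 2)) * n ≤ Real.exp (-(β / 2)) * Real.exp (β / 2) :=
        mul_le_mul_of_nonneg_left h.le (Real.exp_pos _).le
    _ = 1 := by rw [← Real.exp_add, neg_add_cancel, Real.exp_zero]

/-- The spectral gap on the sector of characters with `k` lines. -/
lemma sector_gap (h : Reg n β) {f : ConfigP n → ℝ} {A B : Finset (Fin n)}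
    (hA : ∀ a ∈ A, ∀ g ∈ Gr n, f (act (sing a) nul g) = -f g)
    (hB : ∀ b ∈ B, ∀ g ∈ Gr n, f (act nul (sing b) g) = -f g) (hk : 1 ≤ A.card + B.card) :
    4 * ((A.card + B.card : ℕ) : ℝ) * Real.exp (-(4 * β)) * ip (wt β) f f ≤
      (1 + 247 * ((A.card + B.card : ℕ) : ℝ) / n) * dirE β f := by
  have hn := h.two
  have hnpos : (0 : ℝ) < n := by exact_mod_cast (by omega : 0 < n)
  have hn100 : (100 : ℝ) ≤ n := by exact_mod_cast hn
  have hβ := h.beta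
  have h1 := sector_dirE (by omega) (by linarith) hA hB
  have h2 := h.norm_le f
  have hE := dirE_nonneg β f
  have hkk : (1 : ℝ) ≤ ((A.card + B.card : ℕ) : ℝ) := by exact_mod_cast hk
  have hcast : (A.card : ℝ) + B.card = ((A.card + B.card : ℕ) : ℝ) := by push_cast; ring
  rw [hcast] at h1
  generalize ((A.card + B.card : ℕ) : ℝ) = k at *
  generalize hG : ∑ g ∈ Gr n, f g ^ 2 = G at *
  generalize dirE β f = E at *
  generalize ip (wt β) f f = I at *
  have hx : Real.exp (-(4 * β)) * Real.exp (7 / 2 * β) = Real.exp (-(β / 2)) := by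
    rw [← Real.exp_add]; congr 1; ring
  have hq := h.exp_neg_half_le
  have hp : Real.exp (-(2 * β)) ≤ 1 / (100 * n) := by
    have h3 : Real.exp (-(2 * β)) = Real.exp (-(β / 2)) ^ 4 := by
      rw [← Real.exp_nat_mul]; congr 1; push_cast; ring
    have h0 := (Real.exp_pos (-(β / 2))).le
    have h4 : Real.exp (-(β / 2)) ≤ 1 / 100 := hq.trans (one_div_le_one_div_of_le (by norm_num) hn100)
    have h5 : Real.exp (-(β / 2)) ^ 3 ≤ 1 / 100 := by
      calc Real.exp (-(β / 2)) ^ 3 ≤ (1 / 100) ^ 3 := pow_le_pow_left₀ h0 h4 3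
        _ ≤ 1 / 100 := by norm_num
    calc Real.exp (-(2 * β)) = Real.exp (-(β / 2)) ^ 3 * Real.exp (-(β / 2)) := by rw [h3]; ring
      _ ≤ (1 / 100) * (1 / n) := mul_le_mul h5 hq h0 (by norm_num)
      _ = _ := by field_simp
  have hX := Real.exp_pos (-(4 * β))
  -- the ground state part
  have h6 : 4 * k * Real.exp (-(4 * β)) * G ≤ (1 + 6 / n) * E := by
    rw [show (1 + 6 / (n : ℝ)) * E = (n + 6) * E / n by field_simp, le_div_iff₀ hnpos]
    linarith
  have h7 : 4 * k * Real.exp (-(4 * β)) * I ≤ 240 * k * Real.exp (-(β / 2)) * E +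
      (1 + 20 * Real.exp (-(2 * β))) * ((1 + 6 / n) * E) := by
    have h8 := mul_le_mul_of_nonneg_left h2 (show 0 ≤ 4 * k * Real.exp (-(4 * β)) by positivity)
    have h9 := mul_le_mul_of_nonneg_left h6
      (show 0 ≤ 1 + 20 * Real.exp (-(2 * β)) by positivity)
    calc _ ≤ _ := h8
      _ = 240 * k * (Real.exp (-(4 * β)) * Real.exp (7 / 2 * β)) * E +
          (1 + 20 * Real.exp (-(2 * β))) * (4 * k * Real.exp (-(4 * β)) * G) := by ring
      _ ≤ _ := by rw [hx]; linarith
  refine h7.trans ?_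
  have h10 : 240 * k * Real.exp (-(β / 2)) * E ≤ 240 * k * (1 / n) * E := by gcongr
  have h11 : (1 + 20 * Real.exp (-(2 * β))) * (1 + 6 / n) ≤ 1 + 7 / (n : ℝ) := by
    calc (1 + 20 * Real.exp (-(2 * β))) * (1 + 6 / n) ≤ (1 + 20 * (1 / (100 * n))) * (1 + 6 / n) := by
          gcongr
      _ ≤ 1 + 7 / (n : ℝ) := by
          rw [← sub_nonneg]
          have : 1 + 7 / (n : ℝ) - (1 + 20 * (1 / (100 * n))) * (1 + 6 / n) =
            (80 * n - 120) / (100 * n * n) := by field_simp; ring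
          rw [this]
          apply div_nonneg <;> nlinarith
  have h12 : 7 / (n : ℝ) ≤ 7 * k / n := by gcongr; linarith
  calc _ ≤ 240 * k * (1 / n) * E + (1 + 7 * k / n) * E := by
        have := mul_le_mul_of_nonneg_right (h11.trans (by linarith : 1 + 7 / (n : ℝ) ≤ 1 + 7 * k / n)) hE
        linarith
    _ = _ := by field_simp; ring

/-- The sign character attached to a set of lines. -/
def chi (A : Finset (Fin n)) (u : Fin n → Bool) : ℝ := ∏ i ∈ A, if u i = true then -1 else 1

/-- The sector of functions transforming under line flips by the character `(A, B)`. -/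
def Sec (A B : Finset (Fin n)) (f : ConfigP n → ℝ) : Prop :=
  ∀ u v σ, f (act u v σ) = chi A u * chi B v * f σ

lemma chi_nul (A : Finset (Fin n)) : chi A nul = 1 := by simp [chi, nul]

lemma chi_sing {A : Finset (Fin n)} {a : Fin n} (h : a ∈ A) : chi A (sing a) = -1 := by
  unfold chi
  rw [Finset.prod_eq_single_of_mem a h]
  · simp [sing]
  · intro b _ hb; simp [sing, hb]

lemma chi_sq (A : Finset (Fin n)) (u : Fin n → Bool) : chi A u * chi A u = 1 := by
  unfold chi
  rw [← Finset.prod_mul_distrib]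
  exact Finset.prod_eq_one fun i _ => by split_ifs <;> norm_num

lemma abs_chi (A : Finset (Fin n)) (u : Fin n → Bool) : |chi A u| = 1 := by
  have h := chi_sq A u
  rw [← abs_mul_abs_self] at h
  nlinarith [abs_nonneg (chi A u)]

lemma Sec.sgp {A B : Finset (Fin n)} {f : ConfigP n → ℝ} (h : Sec A B f) (t : ℝ) :
    Sec A B (SPMP.sgp (genP n β) t f) := by
  intro u v σ
  rw [sgp_act]
  have : (fun η => f (act u v η)) = (chi A u * chi B v) • f := by
    funext η; rw [h u v η]; rfl
  rw [this, sgp_smul]; rfl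

/-- The decay rate on the sector of characters with `k` lines. -/
def rate (n : ℕ) (β : ℝ) (k : ℕ) : ℝ := 4 * k * Real.exp (-(4 * β)) / (1 + 247 * k / n)

lemma Sec.decay (h : Reg n β) {A B : Finset (Fin n)} {f : ConfigP n → ℝ} (hf : Sec A B f)
    (hk : 1 ≤ A.card + B.card) {t : ℝ} (ht : 0 ≤ t) :
    ip (wt β) (SPMP.sgp (genP n β) t f) (SPMP.sgp (genP n β) t f) ≤
      Real.exp (-(2 * rate n β (A.card + B.card) * t)) * ip (wt β) f f := by
  refine sgp_decay (fun s _ => ?_) ht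
  have hs : Sec A B (SPMP.sgp (genP n β) s f) := hf.sgp s
  have hg := sector_gap h (f := SPMP.sgp (genP n β) s f) (A := A) (B := B)
    (fun a ha g _ => by rw [hs, chi_sing ha, chi_nul]; ring)
    (fun b hb g _ => by rw [hs, chi_sing hb, chi_nul]; ring) hk
  rw [ip_genP, neg_neg, rate, div_mul_eq_mul_div, div_le_iff₀ (by positivity)]
  linarith

lemma Sec.const_Gr {f : ConfigP n → ℝ} (hf : Sec ∅ ∅ f) {σ τ : ConfigP n}
    (h : ∀ y, dft σ y = dft τ y) : f σ = f τ := by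
  obtain ⟨u, v, rfl⟩ := exists_act h
  rw [hf]; simp [chi]

lemma dirE_sub_const (β c : ℝ) (f : ConfigP n → ℝ) : dirE β (fun σ => f σ - c) = dirE β f := by
  simp [dirE]

/-- The spectral gap on functions invariant under line flips. -/
lemma invariant_gap (h : Reg n β) {f : ConfigP n → ℝ} (hf : Sec ∅ ∅ f)
    (hm : ip (wt β) (fun _ => 1) f = 0) :
    ip (wt β) f f ≤ 60 * Real.exp (7 / 2 * β) * dirE β f := by
  set c := f (fun _ => true) with hc
  have h1 := h.norm_le (fun σ => f σ - c)
  rw [dirE_sub_const] at h1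
  have h2 : ∑ σ ∈ Gr n, (f σ - c) ^ 2 = 0 := by
    refine Finset.sum_eq_zero fun σ hσ => ?_
    rw [hc, hf.const_Gr (σ := σ) (τ := fun _ => true), sub_self]
    · norm_num
    · intro y; rw [mem_Gr.1 hσ, mem_Gr.1 const_mem_Gr]
  rw [h2, mul_zero, add_zero] at h1
  refine le_trans ?_ h1
  have h3 : ip (wt β) (fun σ => f σ - c) (fun σ => f σ - c) =
      ip (wt β) f f - 2 * c * ip (wt β) (fun _ => 1) f + c ^ 2 * ∑ σ : ConfigP n, wt β σ := by
    simp only [ip, Finset.mul_sum, ← Finset.sum_sub_distrib, ← Finset.sum_add_distrib]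
    exact Finset.sum_congr rfl fun σ _ => by ring
  rw [h3, hm]
  have : 0 ≤ c ^ 2 * ∑ σ : ConfigP n, wt β σ :=
    mul_nonneg (sq_nonneg _) (Finset.sum_nonneg fun σ _ => (wt_pos β σ).le)
  linarith

end SectorGap

/-! ### Convergence started from a ground state -/

section GroundStart

open Matrix

variable {n : ℕ} [NeZero n] {β : ℝ}

lemma chi_xor (A : Finset (Fin n)) (u u' : Fin n → Bool) :
    chi A (fun i => (u i ^^ u' i)) = chi A u * chi A u' := by
  unfold chi
  rw [← Finset.prod_mul_distrib]
  refine Finset.prod_congr rfl fun i _ => ?_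
  have h : ∀ a b : Bool, (if (a ^^ b) = true then (-1 : ℝ) else 1) =
      (if a = true then -1 else 1) * (if b = true then -1 else 1) := by
    intro a b
    rcases a with _ | _ <;> rcases b with _ | _ <;> norm_num
  exact h _ _

lemma sum_chi (u : Fin n → Bool) : ∑ A : Finset (Fin n), chi A u = if u = nul then (2 : ℝ) ^ n else 0 := by
  have h : ∑ A : Finset (Fin n), chi A u = ∏ i, (1 + if u i = true then (-1 : ℝ) else 1) := by
    rw [Finset.prod_one_add, Finset.powerset_univ]; rfl
  rw [h]
  split_ifs with hu
  · subst hu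
    simp [nul]
    norm_num
  · obtain ⟨i, hi⟩ := Function.ne_iff.1 hu
    have hi' : u i = true := by
      rcases Bool.eq_false_or_eq_true (u i) with h | h
      · exact h
      · exact absurd h hi
    exact Finset.prod_eq_zero (Finset.mem_univ i) (by rw [if_pos hi']; norm_num)

/-- The component of `f` in the sector `(A, B)`. -/
def proj (A B : Finset (Fin n)) (f : ConfigP n → ℝ) (σ : ConfigP n) : ℝ :=
  (∑ u, ∑ v, chi A u * chi B v * f (act u v σ)) / 4 ^ n

/-- Translation of line selectors. -/
def xorE (u' : Fin n → Bool) : (Fin n → Bool) ≃ (Fin n → Bool) :=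
  Function.Involutive.toPerm (fun u i => (u i ^^ u' i)) (fun u => by funext i; simp)

lemma sec_proj (A B : Finset (Fin n)) (f : ConfigP n → ℝ) : Sec A B (proj A B f) := by
  intro u' v' σ
  unfold proj
  rw [← mul_div_assoc]
  congr 1
  rw [← Equiv.sum_comp (xorE u'), Finset.mul_sum]
  refine Finset.sum_congr rfl fun u _ => ?_
  rw [← Equiv.sum_comp (xorE v'), Finset.mul_sum]
  refine Finset.sum_congr rfl fun v _ => ?_
  have e1 : xorE u' u = fun i => (u i ^^ u' i) := rfl
  have e2 : xorE v' v = fun i => (v i ^^ v' i) := rfl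
  rw [e1, e2, chi_xor, chi_xor, act_act]
  simp only [Bool.xor_assoc, Bool.xor_self, Bool.xor_false]
  ring

lemma sum_proj (f : ConfigP n → ℝ) (σ : ConfigP n) :
    ∑ A : Finset (Fin n), ∑ B : Finset (Fin n), proj A B f σ = f σ := by
  unfold proj
  simp only [← Finset.sum_div]
  have h : ∑ A : Finset (Fin n), ∑ B : Finset (Fin n), ∑ u, ∑ v, chi A u * chi B v * f (act u v σ) =
      ∑ u, ∑ v, (∑ A : Finset (Fin n), chi A u) * (∑ B : Finset (Fin n), chi B v) * f (act u v σ) := by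
    have h1 : ∀ A : Finset (Fin n), ∑ B : Finset (Fin n), ∑ u, ∑ v, chi A u * chi B v * f (act u v σ) =
        ∑ u, ∑ v, chi A u * (∑ B : Finset (Fin n), chi B v) * f (act u v σ) := by
      intro A
      rw [Finset.sum_comm]
      refine Finset.sum_congr rfl fun u _ => ?_
      rw [Finset.sum_comm]
      refine Finset.sum_congr rfl fun v _ => ?_
      rw [Finset.mul_sum, Finset.sum_mul]
    rw [Finset.sum_congr rfl fun A _ => h1 A, Finset.sum_comm]
    refine Finset.sum_congr rfl fun u _ => ?_
    rw [Finset.sum_comm]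
    refine Finset.sum_congr rfl fun v _ => ?_
    rw [Finset.sum_mul, Finset.sum_mul]
  rw [h]
  simp only [sum_chi, ite_mul, zero_mul, mul_ite, mul_zero, Finset.sum_ite_eq', Finset.mem_univ, if_true]
  have e : act nul nul σ = σ := by funext y; simp [act, nul]
  rw [e, ← mul_pow]
  norm_num

/-- The indicator of a point. -/
def pt (g : ConfigP n) : ConfigP n → ℝ := fun σ => if σ = g then 1 else 0

lemma card_act_eq_le (σ g : ConfigP n) :
    (Finset.univ.filter fun p : (Fin n → Bool) × (Fin n → Bool) => act p.1 p.2 σ = g).card ≤ 2 := by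
  rw [← Fintype.card_bool, ← Finset.card_univ]
  refine Finset.card_le_card_of_injOn (fun p => p.1 0) (fun _ _ => Finset.mem_coe.2 (Finset.mem_univ _)) ?_
  rintro ⟨u, v⟩ h ⟨u', v'⟩ h' h0
  simp only [Finset.coe_filter, Finset.mem_univ, true_and, Set.mem_ofPred_eq] at h h' h0
  have hh : ∀ i j, (u i ^^ v j) = (u' i ^^ v' j) := by
    intro i j
    have := congrFun (h.trans h'.symm) (i, j)
    simp only [act] at this
    exact (Bool.xor_right_inj).1 this
  have hv : v = v' := by
    funext j
    have := hh 0 j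
    rw [h0] at this
    exact (Bool.xor_right_inj).1 this
  subst hv
  have hu : u = u' := by
    funext i
    exact (Bool.xor_left_inj).1 (hh i 0)
  rw [hu]

lemma abs_proj_pt_le (A B : Finset (Fin n)) (g σ : ConfigP n) : |proj A B (pt g) σ| ≤ 2 / 4 ^ n := by
  unfold proj
  rw [abs_div, abs_of_pos (show (0 : ℝ) < 4 ^ n by positivity)]
  gcongr
  rw [← Finset.sum_product']
  refine (Finset.abs_sum_le_sum_abs _ _).trans ?_
  have h : ∀ p : (Fin n → Bool) × (Fin n → Bool),
      |chi A p.1 * chi B p.2 * pt g (act p.1 p.2 σ)| = if act p.1 p.2 σ = g then 1 else 0 := by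
    intro p
    rw [abs_mul, abs_mul, abs_chi, abs_chi, one_mul, one_mul, pt]
    split_ifs <;> simp
  rw [Finset.sum_congr rfl fun p _ => h p, Finset.univ_product_univ, Finset.sum_boole]
  exact_mod_cast card_act_eq_le σ g

lemma proj_pt_eq_zero (A B : Finset (Fin n)) {g σ : ConfigP n} (hg : g ∈ Gr n) (hσ : σ ∉ Gr n) :
    proj A B (pt g) σ = 0 := by
  unfold proj
  rw [Finset.sum_eq_zero, zero_div]
  intro u _
  refine Finset.sum_eq_zero fun v _ => ?_
  have : act u v σ ≠ g := by
    rintro rfl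
    exact hσ (act_mem_Gr.1 hg)
  rw [pt, if_neg this, mul_zero]

lemma card_Gr_le : ((Gr n).card : ℝ) ≤ 4 ^ n := by
  have h : (Gr n).card ≤ Fintype.card ((Fin n → Bool) × (Fin n → Bool)) := by
    rw [← Finset.card_univ]
    refine Finset.card_le_card_of_surjOn (fun p => act p.1 p.2 (fun _ => true)) ?_
    intro σ hσ
    obtain ⟨u, v, h⟩ := exists_act (σ := fun _ => true) (τ := σ) fun y => by
      rw [mem_Gr.1 const_mem_Gr, mem_Gr.1 (Finset.mem_coe.1 hσ)]
    exact ⟨(u, v), Finset.mem_coe.2 (Finset.mem_univ _), h.symm⟩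
  rw [Fintype.card_prod, Fintype.card_fun, Fintype.card_bool, Fintype.card_fin, ← mul_pow] at h
  exact_mod_cast h

lemma ip_proj_pt_le (A B : Finset (Fin n)) {g : ConfigP n} (hg : g ∈ Gr n) :
    ip (wt β) (proj A B (pt g)) (proj A B (pt g)) ≤ (Gr n).card * (2 / 4 ^ n) ^ 2 := by
  unfold ip
  rw [sum_wt_Gr β (fun σ => proj A B (pt g) σ * proj A B (pt g) σ)]
  rw [Finset.sum_eq_zero (s := (Gr n)ᶜ) fun σ hσ => by
    rw [proj_pt_eq_zero A B hg (Finset.mem_compl.1 hσ)]; ring, add_zero, ← nsmul_eq_mul]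
  refine Finset.sum_le_card_nsmul _ _ _ fun σ _ => ?_
  rw [← abs_mul_abs_self, ← sq]
  exact pow_le_pow_left₀ (abs_nonneg _) (abs_proj_pt_le A B g σ) 2

lemma Sec.sq_mul_card_le {A B : Finset (Fin n)} {f : ConfigP n → ℝ} (hf : Sec A B f) {g : ConfigP n}
    (hg : g ∈ Gr n) : f g ^ 2 * (Gr n).card ≤ ip (wt β) f f := by
  have h : ∀ σ ∈ Gr n, f σ * f σ = f g ^ 2 := by
    intro σ hσ
    obtain ⟨u, v, rfl⟩ := exists_act (σ := g) (τ := σ) fun y => by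
      rw [mem_Gr.1 hg, mem_Gr.1 hσ]
    rw [hf]
    calc _ = (chi A u * chi A u) * (chi B v * chi B v) * f g ^ 2 := by ring
      _ = _ := by rw [chi_sq, chi_sq]; ring
  unfold ip
  rw [sum_wt_Gr β (fun σ => f σ * f σ), Finset.sum_congr rfl h, Finset.sum_const, nsmul_eq_mul, mul_comm]
  exact le_add_of_nonneg_right (Finset.sum_nonneg fun σ _ =>
    mul_nonneg (wt_pos β σ).le (mul_self_nonneg _))

lemma abs_le_of_sector_bound {x e c N : ℝ} (hN : 0 < N) (hc : 0 ≤ c)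
    (h : x ^ 2 * N ≤ Real.exp (2 * e) * (N * c ^ 2)) : |x| ≤ Real.exp e * c := by
  refine abs_le_of_sq_le_sq ?_ (mul_nonneg (Real.exp_pos _).le hc)
  have h1 : x ^ 2 ≤ Real.exp (2 * e) * c ^ 2 := by nlinarith
  calc x ^ 2 ≤ Real.exp (2 * e) * c ^ 2 := h1
    _ = _ := by rw [mul_pow, two_mul, Real.exp_add]; ring

lemma sgp_proj_le (h : Reg n β) {A B : Finset (Fin n)} (hk : 1 ≤ A.card + B.card) {g : ConfigP n}
    (hg : g ∈ Gr n) {t : ℝ} (ht : 0 ≤ t) :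
    |sgp (genP n β) (2 * t) (proj A B (pt g)) g| ≤
      Real.exp (-(2 * rate n β (A.card + B.card) * t)) * (2 / 4 ^ n) := by
  have h1 := (sec_proj A B (pt g)).decay h hk (show 0 ≤ 2 * t by linarith)
  have h2 := ((sec_proj A B (pt g)).sgp (β := β) (2 * t)).sq_mul_card_le (β := β) hg
  refine abs_le_of_sector_bound (N := (Gr n).card) Gr_card_pos (by positivity) (h2.trans (h1.trans ?_))
  refine le_of_eq_of_le ?_ (mul_le_mul_of_nonneg_left (ip_proj_pt_le (β := β) A B hg) (Real.exp_pos _).le)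
  congr 2; ring

/-- The decay rate of functions invariant under line flips. -/
def kap (β : ℝ) : ℝ := Real.exp (-(7 / 2 * β)) / 60

lemma invariant_decay (h : Reg n β) {f : ConfigP n → ℝ} (hf : Sec ∅ ∅ f)
    (hm : ip (wt β) (fun _ => 1) f = 0) {t : ℝ} (ht : 0 ≤ t) :
    ip (wt β) (sgp (genP n β) t f) (sgp (genP n β) t f) ≤
      Real.exp (-(2 * kap β * t)) * ip (wt β) f f := by
  refine sgp_decay (fun s _ => ?_) ht
  have hs : Sec ∅ ∅ (sgp (genP n β) s f) := hf.sgp s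
  have hms : ip (wt β) (fun _ => 1) (sgp (genP n β) s f) = 0 := by
    rw [(revChain n β).ip_sgp, (revChain n β).sgp_one, hm]
  have hg := invariant_gap h hs hms
  rw [ip_genP, neg_neg, kap, div_mul_eq_mul_div, div_le_iff₀ (by norm_num)]
  have := mul_le_mul_of_nonneg_left hg (Real.exp_pos (-(7 / 2 * β))).le
  refine this.trans (le_of_eq ?_)
  have e : Real.exp (-(7 / 2 * β)) * Real.exp (7 / 2 * β) = 1 := by
    rw [← Real.exp_add, neg_add_cancel, Real.exp_zero]
  linear_combination (60 * dirE β (sgp (genP n β) s f)) * e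

lemma ip_one_pt {g : ConfigP n} (hg : g ∈ Gr n) : ip (wt β) (fun _ => 1) (pt g) = 1 := by
  simp [ip, pt, wt_Gr hg]

lemma ip_one_proj (g : ConfigP n) :
    ip (wt β) (fun _ => 1) (proj ∅ ∅ (pt g)) = ip (wt β) (fun _ => 1) (pt g) := by
  have h : ∀ σ, wt β σ * (1 * proj ∅ ∅ (pt g) σ) =
      (∑ u, ∑ v, wt β (act u v σ) * pt g (act u v σ)) / 4 ^ n := by
    intro σ
    simp only [proj, wt_act, ← Finset.mul_sum, chi, Finset.prod_empty, one_mul]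
    ring
  unfold ip
  rw [Finset.sum_congr rfl fun σ _ => h σ, ← Finset.sum_div, Finset.sum_comm]
  have h2 : ∀ u : Fin n → Bool, ∑ σ : ConfigP n, ∑ v, wt β (act u v σ) * pt g (act u v σ) =
      2 ^ n * ∑ σ, wt β σ * pt g σ := by
    intro u
    have h3 : ∀ v, ∑ σ : ConfigP n, wt β (act u v σ) * pt g (act u v σ) = ∑ σ, wt β σ * pt g σ :=
      fun v => Equiv.sum_comp (actE u v) (fun σ => wt β σ * pt g σ)
    rw [Finset.sum_comm, Finset.sum_congr rfl fun v _ => h3 v]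
    simp
  rw [Finset.sum_congr rfl fun u _ => h2 u]
  simp only [Finset.sum_const, Finset.card_univ, Fintype.card_fun, Fintype.card_bool, Fintype.card_fin,
    nsmul_eq_mul, one_mul]
  rw [div_eq_iff (by positivity), show (4 : ℝ) = 2 * 2 by norm_num, mul_pow]
  push_cast
  ring

lemma sum_wt_pos (n : ℕ) [NeZero n] (β : ℝ) : 0 < ∑ σ : ConfigP n, wt β σ :=
  Finset.sum_pos (fun σ _ => wt_pos β σ) Finset.univ_nonempty

lemma sgp_invariant_proj_le (h : Reg n β) {g : ConfigP n} (hg : g ∈ Gr n) {t : ℝ} (ht : 0 ≤ t) :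
    |sgp (genP n β) (2 * t) (proj ∅ ∅ (pt g)) g - 1 / ∑ σ : ConfigP n, wt β σ| ≤
      Real.exp (-(2 * kap β * t)) * (2 / 4 ^ n) := by
  set Z := ∑ σ : ConfigP n, wt β σ with hZ
  have hZ0 : 0 < Z := sum_wt_pos n β
  set f : ConfigP n → ℝ := proj ∅ ∅ (pt g) - (1 / Z) • (fun _ => (1 : ℝ)) with hf
  have hone : ip (wt β) (fun _ : ConfigP n => (1 : ℝ)) (fun _ => 1) = Z := by simp [ip, hZ]
  have hsec : Sec ∅ ∅ f := by
    intro u v σ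
    have := sec_proj ∅ ∅ (pt g) u v σ
    simp only [chi, Finset.prod_empty, one_mul] at this ⊢
    simp [hf, this]
  have hp1 := (ip_one_proj (β := β) g).trans (ip_one_pt hg)
  have hsub : ∀ k : ConfigP n → ℝ, ip (wt β) k f = ip (wt β) k (proj ∅ ∅ (pt g)) -
      1 / Z * ip (wt β) k (fun _ => 1) := by
    intro k
    rw [hf, sub_eq_add_neg, ← neg_smul, ip_add_right, ip_smul_right]; ring
  have hm : ip (wt β) (fun _ => 1) f = 0 := by
    rw [hsub, hp1, hone]; field_simp; ring
  have hnorm : ip (wt β) f f ≤ ip (wt β) (proj ∅ ∅ (pt g)) (proj ∅ ∅ (pt g)) := by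
    rw [hsub, ip_comm _ f (fun _ => 1), hm, ip_comm, hsub, ip_comm _ _ (fun _ => 1), hp1]
    have : 0 ≤ 1 / Z * 1 := by positivity
    linarith
  have h1 := invariant_decay h hsec hm (show 0 ≤ 2 * t by linarith)
  have h2 := (hsec.sgp (β := β) (2 * t)).sq_mul_card_le (β := β) hg
  have e : sgp (genP n β) (2 * t) f g =
      sgp (genP n β) (2 * t) (proj ∅ ∅ (pt g)) g - 1 / Z := by
    rw [hf, sgp_sub, sgp_smul, (revChain n β).sgp_one]
    simp
  rw [← e]
  refine abs_le_of_sector_bound (N := (Gr n).card) Gr_card_pos (by positivity) (h2.trans (h1.trans ?_))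
  refine le_of_eq_of_le ?_ (mul_le_mul_of_nonneg_left (hnorm.trans (ip_proj_pt_le (β := β) ∅ ∅ hg))
    (Real.exp_pos _).le)
  congr 2; ring

lemma sgp_sum {Ω : Type*} [Fintype Ω] [DecidableEq Ω] {ι : Type*} (A : Matrix Ω Ω ℝ) (t : ℝ)
    (s : Finset ι) (f : ι → Ω → ℝ) (σ : Ω) :
    sgp A t (fun η => ∑ i ∈ s, f i η) σ = ∑ i ∈ s, sgp A t (f i) σ := by
  simp only [sgp, Matrix.mulVec, dotProduct, Finset.mul_sum]
  exact Finset.sum_comm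

lemma return_le (h : Reg n β) {g : ConfigP n} (hg : g ∈ Gr n) {t : ℝ} (ht : 0 ≤ t) :
    (∑ σ : ConfigP n, wt β σ) * sgp (genP n β) (2 * t) (pt g) g - 1 ≤
      4 * ∑ p ∈ Finset.univ.erase ((∅, ∅) : Finset (Fin n) × Finset (Fin n)),
        Real.exp (-(2 * rate n β (p.1.card + p.2.card) * t)) + 4 * Real.exp (-(2 * kap β * t)) := by
  set Z := ∑ σ : ConfigP n, wt β σ with hZ
  have hZ0 : 0 < Z := sum_wt_pos n β
  have hZ4 : Z * (2 / 4 ^ n) ≤ 4 := by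
    have h1 : Z ≤ 2 * 4 ^ n := h.sum_wt_le_two.trans (by have := card_Gr_le (n := n); linarith)
    calc Z * (2 / 4 ^ n) ≤ 2 * 4 ^ n * (2 / 4 ^ n) := by gcongr
      _ = 4 := by field_simp; norm_num
  have h1 : sgp (genP n β) (2 * t) (pt g) g =
      ∑ p : Finset (Fin n) × Finset (Fin n), sgp (genP n β) (2 * t) (proj p.1 p.2 (pt g)) g := by
    rw [← sgp_sum]
    congr 1
    funext η
    rw [Fintype.sum_prod_type, sum_proj]
  rw [h1, ← Finset.add_sum_erase _ _ (Finset.mem_univ ((∅, ∅) : Finset (Fin n) × Finset (Fin n)))]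
  have h2 := (abs_le.1 (sgp_invariant_proj_le h hg ht)).2
  have h3 : ∑ p ∈ Finset.univ.erase ((∅, ∅) : Finset (Fin n) × Finset (Fin n)),
      sgp (genP n β) (2 * t) (proj p.1 p.2 (pt g)) g ≤
      (2 / 4 ^ n) * ∑ p ∈ Finset.univ.erase ((∅, ∅) : Finset (Fin n) × Finset (Fin n)),
        Real.exp (-(2 * rate n β (p.1.card + p.2.card) * t)) := by
    rw [Finset.mul_sum]
    refine Finset.sum_le_sum fun p hp => ?_
    have hk : 1 ≤ p.1.card + p.2.card := by
      by_contra hcon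
      apply Finset.ne_of_mem_erase hp
      have h1 : p.1.card = 0 := by omega
      have h2 : p.2.card = 0 := by omega
      rw [Finset.card_eq_zero] at h1 h2
      exact Prod.ext h1 h2
    have := (abs_le.1 (sgp_proj_le h hk hg ht)).2
    rw [mul_comm (2 / 4 ^ n : ℝ)]; exact this
  set S := ∑ p ∈ Finset.univ.erase ((∅, ∅) : Finset (Fin n) × Finset (Fin n)),
        Real.exp (-(2 * rate n β (p.1.card + p.2.card) * t)) with hS
  have hS0 : 0 ≤ S := Finset.sum_nonneg fun p _ => (Real.exp_pos _).le
  rw [mul_add]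
  have h4 := mul_le_mul_of_nonneg_left h3 hZ0.le
  have h5 := mul_le_mul_of_nonneg_right hZ4 hS0
  have h6 := mul_le_mul_of_nonneg_right hZ4 (Real.exp_pos (-(2 * kap β * t))).le
  have h7 := mul_le_mul_of_nonneg_left h2 hZ0.le
  have h8 : Z * (1 / Z) = 1 := by field_simp
  nlinarith

lemma tv_sq_le (β : ℝ) {g : ConfigP n} (hg : g ∈ Gr n) (t : ℝ) :
    (2 * tv (mexp (t • genP n β) g) (gibbsP n β)) ^ 2 ≤
      (∑ σ : ConfigP n, wt β σ) * sgp (genP n β) (2 * t) (pt g) g - 1 := by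
  set Z := ∑ σ : ConfigP n, wt β σ with hZ
  have hZ0 : 0 < Z := sum_wt_pos n β
  have hA := revChain n β
  set x : ConfigP n → ℝ := sgp (genP n β) t (pt g) - (1 / Z) • (fun _ => (1 : ℝ)) with hx
  have hpt : ∀ (f : ConfigP n → ℝ), ip (wt β) (pt g) f = f g := by
    intro f
    simp [ip, pt, wt_Gr hg]
  have hcol : ∀ η, wt β η * sgp (genP n β) t (pt g) η = mexp (t • genP n β) g η := by
    intro η
    have e : sgp (genP n β) t (pt g) η = mexp (t • genP n β) η g := by
      simp [sgp, Matrix.mulVec, dotProduct, pt]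
    rw [e, hA.mexp_symm, wt_Gr hg, one_mul]
  have h1 : 2 * tv (mexp (t • genP n β) g) (gibbsP n β) = ip (wt β) (fun η => |x η|) (fun _ => 1) := by
    rw [tv, mul_div_cancel₀ _ (two_ne_zero), ip]
    refine Finset.sum_congr rfl fun η _ => ?_
    rw [← hcol, gibbsP_eq, mul_one, ← abs_of_pos (wt_pos β η), ← abs_mul, abs_of_pos (wt_pos β η)]
    congr 1
    simp [hx, hZ]
    ring
  have hone : ip (wt β) (fun _ : ConfigP n => (1 : ℝ)) (fun _ => 1) = Z := by simp [ip, hZ]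
  have hsub : ∀ k : ConfigP n → ℝ, ip (wt β) k x = ip (wt β) k (sgp (genP n β) t (pt g)) -
      1 / Z * ip (wt β) k (fun _ => 1) := by
    intro k
    rw [hx, sub_eq_add_neg, ← neg_smul, ip_add_right, ip_smul_right]; ring
  have hm : ip (wt β) (fun _ => 1) (sgp (genP n β) t (pt g)) = 1 := by
    rw [hA.ip_sgp, hA.sgp_one, ip_one_pt hg]
  have h2 : ip (wt β) (fun η => |x η|) (fun η => |x η|) = ip (wt β) x x := by
    unfold ip; exact Finset.sum_congr rfl fun η _ => by rw [abs_mul_abs_self]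
  have h3 : ip (wt β) x x = sgp (genP n β) (2 * t) (pt g) g - 1 / Z := by
    rw [hsub, ip_comm _ x, hsub, ip_comm _ x (fun _ => 1), hsub, hm, hone, ← hA.ip_sgp, sgp_sgp, hpt,
      ip_comm _ _ (fun _ => 1), hm, ← two_mul]
    field_simp
    ring
  rw [h1]
  refine (hA.sq_ip_le _ _).trans (le_of_eq ?_)
  rw [h2, h3, hone]
  field_simp

end GroundStart

/-! ### Reaching the ground states from an arbitrary configuration -/

section Reaching

open Matrix

variable {n : ℕ} [NeZero n] {β : ℝ}

lemma Sec.mul_card_le {f : ConfigP n → ℝ} (hf : Sec ∅ ∅ f) (hf0 : ∀ σ, 0 ≤ f σ) (σ : ConfigP n) :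
    wt β σ * f σ * (Gr n).card ≤ ip (wt β) (fun _ => 1) f := by
  have hx : ∀ g ∈ Gr n, ∃ u v, (fun y => (σ y ^^ g y)) = act u v σ := by
    intro g hg
    obtain ⟨u, v, rfl⟩ := exists_act (σ := fun _ => false) (τ := g) fun y => by
      rw [mem_Gr.1 hg]; rfl
    exact ⟨u, v, by funext y; simp [act]⟩
  have h1 : ∀ g ∈ Gr n, wt β (fun y => (σ y ^^ g y)) * f (fun y => (σ y ^^ g y)) = wt β σ * f σ := by
    intro g hg
    obtain ⟨u, v, h⟩ := hx g hg
    rw [h, wt_act, hf]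
    simp [chi]
  calc wt β σ * f σ * (Gr n).card = ∑ g ∈ Gr n, wt β σ * f σ := by
        rw [Finset.sum_const, nsmul_eq_mul, mul_comm]
    _ = ∑ g ∈ Gr n, wt β (fun y => (σ y ^^ g y)) * f (fun y => (σ y ^^ g y)) :=
        (Finset.sum_congr rfl h1).symm
    _ = ∑ η ∈ (Gr n).image (fun g y => (σ y ^^ g y)), wt β η * f η := by
        rw [Finset.sum_image]
        intro g _ g' _ h
        funext y
        exact Bool.xor_right_inj.1 (congrFun h y)
    _ ≤ ∑ η, wt β η * f η := Finset.sum_le_sum_of_subset_of_nonneg (Finset.subset_univ _)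
        fun η _ _ => mul_nonneg (wt_pos β η).le (hf0 η)
    _ = _ := by simp [ip]

lemma Sec.le_exp (h : Reg n β) {f : ConfigP n → ℝ} (hf : Sec ∅ ∅ f) (hf0 : ∀ σ, 0 ≤ f σ)
    (hm : ip (wt β) (fun _ => 1) f = ∑ σ : ConfigP n, wt β σ) (σ : ConfigP n) :
    f σ ≤ 2 * Real.exp (β * ndef σ) := by
  have h1 := hf.mul_card_le (β := β) hf0 σ
  rw [hm] at h1
  have h2 : wt β σ * f σ ≤ 2 := by
    have := h1.trans h.sum_wt_le_two
    exact le_of_mul_le_mul_right this Gr_card_pos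
  have e : Real.exp (β * ndef σ) * wt β σ = 1 := by
    rw [wt, ← Real.exp_add, neg_mul, add_neg_cancel, Real.exp_zero]
  have := mul_le_mul_of_nonneg_left h2 (Real.exp_pos (β * ndef σ)).le
  rw [← mul_assoc, e] at this
  linarith

lemma dirE_posPart_le (c : ℝ) (f : ConfigP n → ℝ) :
    dirE β (fun σ => max (f σ - c) 0) ≤ dirE β f := by
  unfold dirE
  refine div_le_div_of_nonneg_right ?_ (by norm_num)
  refine Finset.sum_le_sum fun σ _ => Finset.sum_le_sum fun x _ =>
    mul_le_mul_of_nonneg_left ?_ (cond_nonneg _ _ _)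
  refine sq_le_sq.2 ?_
  have := abs_max_sub_max_le_abs (f (flipP n σ x) - c) (f σ - c) 0
  rwa [sub_sub_sub_cancel_right] at this

/-- A super-Poincaré type bound: densities with a large second moment dissipate faster. -/
lemma Sec.dirE_ge (h : Reg n β) {f : ConfigP n → ℝ} (hf : Sec ∅ ∅ f) (hf0 : ∀ σ, 0 ≤ f σ)
    (hm : ip (wt β) (fun _ => 1) f = ∑ σ : ConfigP n, wt β σ) {M : ℝ}
    (hM : ip (wt β) f f = M * ∑ σ : ConfigP n, wt β σ) (h8 : 8 ≤ M) :
    kap β * (Real.log (M / 8) / β) * (M * (∑ σ : ConfigP n, wt β σ) / 2) ≤ dirE β f := by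
  set Z := ∑ σ : ConfigP n, wt β σ with hZ
  have hβ : 0 < β := by have := h.beta; linarith
  set g : ConfigP n → ℝ := fun σ => max (f σ - M / 4) 0 with hg
  have hgr : ∑ σ ∈ Gr n, g σ ^ 2 = 0 := by
    refine Finset.sum_eq_zero fun σ hσ => ?_
    have h1 := hf.le_exp h hf0 hm σ
    rw [ndef_eq_zero.2 hσ, Nat.cast_zero, mul_zero, Real.exp_zero] at h1
    rw [hg]
    simp only
    rw [max_eq_right (by linarith)]
    norm_num
  have hp := poincare h g
  rw [hgr, mul_zero, add_zero] at hp
  have hE := dirE_posPart_le (β := β) (M / 4) f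
  have hlog : ∀ σ, Real.log (M / 8) / β * g σ ^ 2 ≤ ndef σ * g σ ^ 2 := by
    intro σ
    by_cases hs : f σ ≤ M / 4
    · have : g σ = 0 := max_eq_right (by linarith)
      rw [this]; norm_num
    · refine mul_le_mul_of_nonneg_right ?_ (sq_nonneg _)
      rw [div_le_iff₀ hβ, mul_comm, Real.log_le_iff_le_exp (by linarith)]
      have := hf.le_exp h hf0 hm σ
      linarith
  have hsq : ∀ σ, f σ * f σ - M / 2 * (1 * f σ) ≤ g σ ^ 2 := by
    intro σ
    by_cases hs : f σ ≤ M / 4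
    · have : g σ = 0 := max_eq_right (by linarith)
      rw [this]; nlinarith [hf0 σ]
    · have : g σ = f σ - M / 4 := max_eq_left (by linarith)
      rw [this]; nlinarith [sq_nonneg M]
  have h1 : M * Z / 2 ≤ ∑ σ, wt β σ * g σ ^ 2 := by
    have h2 : ∑ σ, wt β σ * (f σ * f σ - M / 2 * (1 * f σ)) ≤ ∑ σ, wt β σ * g σ ^ 2 :=
      Finset.sum_le_sum fun σ _ => mul_le_mul_of_nonneg_left (hsq σ) (wt_pos β σ).le
    have h3 : ∑ σ, wt β σ * (f σ * f σ - M / 2 * (1 * f σ)) =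
        ip (wt β) f f - M / 2 * ip (wt β) (fun _ => 1) f := by
      simp only [ip, Finset.mul_sum, ← Finset.sum_sub_distrib]
      exact Finset.sum_congr rfl fun σ _ => by ring
    rw [h3, hM, hm] at h2
    linarith
  have hl0 : 0 ≤ Real.log (M / 8) / β := div_nonneg (Real.log_nonneg (by linarith)) hβ.le
  have h2 : Real.log (M / 8) / β * (M * Z / 2) ≤ ∑ σ, wt β σ * ndef σ * g σ ^ 2 := by
    refine (mul_le_mul_of_nonneg_left h1 hl0).trans ?_
    rw [Finset.mul_sum]
    refine Finset.sum_le_sum fun σ _ => ?_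
    have := mul_le_mul_of_nonneg_left (hlog σ) (wt_pos β σ).le
    linarith
  have e : kap β * (60 * Real.exp (7 / 2 * β)) = 1 := by
    rw [kap, div_mul_eq_mul_div, div_eq_iff (by norm_num)]
    have : Real.exp (-(7 / 2 * β)) * Real.exp (7 / 2 * β) = 1 := by
      rw [← Real.exp_add, neg_add_cancel, Real.exp_zero]
    linear_combination 60 * this
  have hk : 0 < kap β := by unfold kap; positivity
  have h3 := mul_le_mul_of_nonneg_left (h2.trans hp) hk.le
  rw [← mul_assoc, ← mul_assoc, ← mul_assoc, mul_assoc (kap β) 60, e, one_mul] at h3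
  calc _ = kap β * Real.log (M / 8) / β * (M * Z / 2) := by ring
    _ ≤ _ := by
      have e2 : kap β * Real.log (M / 8) / β * (M * Z / 2) =
        kap β * (Real.log (M / 8) / β) * (M * Z / 2) := by ring
      rw [e2]; linarith

lemma moment_antitone (β : ℝ) (f : ConfigP n → ℝ) :
    Antitone fun t => ip (wt β) (sgp (genP n β) t f) (sgp (genP n β) t f) := by
  refine antitone_of_deriv_nonpos (fun t => (ip_sgp_sgp_hasDerivAt f t).differentiableAt) fun t => ?_
  rw [(ip_sgp_sgp_hasDerivAt f t).deriv, ip_genP]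
  have := dirE_nonneg β (sgp (genP n β) t f)
  linarith

/-- After time `2β²/κ` the second moment of an invariant density is bounded. -/
lemma moment_le (h : Reg n β) {f : ConfigP n → ℝ} (hf : Sec ∅ ∅ f) (hf0 : ∀ σ, 0 ≤ f σ)
    (hm : ip (wt β) (fun _ => 1) f = ∑ σ : ConfigP n, wt β σ)
    (hb : ip (wt β) f f ≤ 2 * Real.exp (β * Real.exp β) * ∑ σ : ConfigP n, wt β σ) :
    ip (wt β) (sgp (genP n β) (2 * β ^ 2 / kap β) f) (sgp (genP n β) (2 * β ^ 2 / kap β) f) ≤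
      8 * Real.exp 1 * ∑ σ : ConfigP n, wt β σ := by
  set Z := ∑ σ : ConfigP n, wt β σ with hZ
  have hZ0 : 0 < Z := sum_wt_pos n β
  have hβ : 20 ≤ β := h.beta
  have hk : 0 < kap β := by unfold kap; positivity
  set T := 2 * β ^ 2 / kap β with hT
  have hT0 : 0 ≤ T := by positivity
  set m : ℝ → ℝ := fun t => ip (wt β) (sgp (genP n β) t f) (sgp (genP n β) t f) / Z with hmdef
  have hmZ : ∀ t, ip (wt β) (sgp (genP n β) t f) (sgp (genP n β) t f) = m t * Z := by
    intro t; rw [hmdef]; field_simp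
  have hanti : ∀ {s t}, s ≤ t → m t ≤ m s := by
    intro s t hst
    exact div_le_div_of_nonneg_right (moment_antitone β f hst) hZ0.le
  by_contra hcon
  have hmT : 8 * Real.exp 1 < m T := by
    rw [hmZ] at hcon
    exact lt_of_mul_lt_mul_right (not_le.1 hcon) hZ0.le
  have he1 : 1 ≤ Real.exp 1 := Real.one_le_exp (by norm_num)
  have hm8 : ∀ t ≤ T, 8 ≤ m t := fun t ht => by have := hanti ht; linarith
  have hder : ∀ t, HasDerivAt m (-2 * dirE β (sgp (genP n β) t f) / Z) t := by
    intro t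
    have := (ip_sgp_sgp_hasDerivAt (w := wt β) (A := genP n β) f t).div_const Z
    rw [ip_genP] at this
    rwa [show 2 * -dirE β (sgp (genP n β) t f) = -2 * dirE β (sgp (genP n β) t f) by ring] at this
  have hen : ∀ t, 0 ≤ t → t ≤ T →
      -2 * dirE β (sgp (genP n β) t f) / Z ≤ -(kap β / β * Real.log (m t / 8) * m t) := by
    intro t ht0 ht
    have hmt : ip (wt β) (fun _ => 1) (sgp (genP n β) t f) = Z := by
      rw [(revChain n β).ip_sgp, (revChain n β).sgp_one, hm]
    have := (hf.sgp (β := β) t).dirE_ge h ((revChain n β).sgp_nonneg ht0 hf0) hmt (hmZ t) (hm8 t ht)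
    rw [div_le_iff₀ hZ0]
    calc _ ≤ -2 * (kap β * (Real.log (m t / 8) / β) * (m t * Z / 2)) := by
          rw [hZ]; linarith
      _ = _ := by ring
  set φ : ℝ → ℝ := fun t => Real.log (m t / 8) * Real.exp (kap β / β * t) with hφ
  have hφd : ∀ t, 0 ≤ t → t ≤ T → HasDerivAt φ ((-2 * dirE β (sgp (genP n β) t f) / Z / 8) / (m t / 8) *
      Real.exp (kap β / β * t) + Real.log (m t / 8) * (Real.exp (kap β / β * t) * (kap β / β * 1))) t := by
    intro t ht0 ht
    have h8 := hm8 t ht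
    exact (((hder t).div_const 8).log (by positivity)).mul
      (((hasDerivAt_id t).const_mul (kap β / β)).exp)
  have hφanti : AntitoneOn φ (Set.Icc 0 T) := by
    refine antitoneOn_of_deriv_nonpos (convex_Icc 0 T)
      (fun t ht => (hφd t ht.1 ht.2).continuousAt.continuousWithinAt) ?_ ?_
    · intro t ht
      rw [interior_Icc] at ht
      exact (hφd t ht.1.le ht.2.le).differentiableAt.differentiableWithinAt
    · intro t ht
      rw [interior_Icc] at ht
      rw [(hφd t ht.1.le ht.2.le).deriv]
      have h8 := hm8 t ht.2.le
      have h1 := hen t ht.1.le ht.2.le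
      have h2 : -2 * dirE β (sgp (genP n β) t f) / Z / 8 / (m t / 8) ≤ -(kap β / β * Real.log (m t / 8)) := by
        rw [div_div_div_cancel_right₀ (by norm_num), div_le_iff₀ (by linarith)]
        linarith
      have h3 := mul_le_mul_of_nonneg_right h2 (Real.exp_pos (kap β / β * t)).le
      linarith
  have h1 := hφanti (Set.left_mem_Icc.2 hT0) (Set.right_mem_Icc.2 hT0) hT0
  simp only [hφ, mul_zero, Real.exp_zero, mul_one] at h1
  have h2 : 1 ≤ Real.log (m T / 8) := by
    rw [Real.le_log_iff_exp_le (by linarith)]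
    linarith
  have h3 : Real.log (m 0 / 8) ≤ β * Real.exp β := by
    have h80 := hm8 0 hT0
    rw [Real.log_le_iff_le_exp (by linarith)]
    have : m 0 ≤ 2 * Real.exp (β * Real.exp β) := by
      rw [hmdef]
      simp only [sgp_zero]
      rw [div_le_iff₀ hZ0]
      exact hb
    linarith [Real.exp_pos (β * Real.exp β)]
  have h4 : kap β / β * T = 2 * β := by rw [hT]; field_simp
  rw [h4] at h1
  have h5 : Real.exp (2 * β) ≤ β * Real.exp β := by
    refine le_trans ?_ (h1.trans h3)
    exact le_mul_of_one_le_left (Real.exp_pos _).le h2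
  rw [two_mul, Real.exp_add] at h5
  have h6 := le_of_mul_le_mul_right h5 (Real.exp_pos β)
  have h7 := Real.add_one_le_exp β
  linarith

/-- The probability of not being in a ground state. -/
lemma escape_le (h : Reg n β) (σ : ConfigP n) {s : ℝ} (hs : 0 ≤ s) :
    sgp (genP n β) (2 * β ^ 2 / kap β + s) (fun η => if η ∈ Gr n then 0 else 1) σ ≤
      20 * Real.exp (-(2 * β)) + 5 * Real.exp (-(kap β * s)) := by
  set Z := ∑ σ : ConfigP n, wt β σ with hZ
  have hZ0 : 0 < Z := sum_wt_pos n β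
  have hA := revChain n β
  have hk : 0 < kap β := by unfold kap; positivity
  set T := 2 * β ^ 2 / kap β with hT
  set O : Finset (ConfigP n) := Finset.univ.filter fun η => ∀ y, dft σ y = dft η y with hO
  have hmO : ∀ η, η ∈ O ↔ ∀ y, dft σ y = dft η y := fun η => by simp [hO]
  set W := ∑ η ∈ O, wt β η with hW
  have hW0 : 0 < W := Finset.sum_pos (fun η _ => wt_pos β η) ⟨σ, (hmO σ).2 fun _ => rfl⟩
  set f : ConfigP n → ℝ := fun η => if η ∈ O then Z / W else 0 with hf
  have hfsec : Sec ∅ ∅ f := by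
    intro u v η
    have : act u v η ∈ O ↔ η ∈ O := by rw [hmO, hmO]; simp only [dft_act]
    by_cases hη : η ∈ O
    · simp only [hf, if_pos hη, if_pos (this.2 hη)]; simp [chi]
    · simp only [hf, if_neg hη, if_neg (mt this.1 hη)]; simp
  have hf0 : ∀ η, 0 ≤ f η := by
    intro η; simp only [hf]; split_ifs <;> positivity
  have hfip : ∀ k : ConfigP n → ℝ, Sec ∅ ∅ k → ip (wt β) f k = Z * k σ := by
    intro k hksec
    have e : ∀ η, wt β η * (f η * k η) = if η ∈ O then wt β η * (Z / W * k σ) else 0 := by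
      intro η
      by_cases hη : η ∈ O
      · rw [if_pos hη, ← hksec.const_Gr ((hmO η).1 hη)]
        simp only [hf, if_pos hη]
      · rw [if_neg hη]; simp only [hf, if_neg hη]; ring
    rw [ip, Finset.sum_congr rfl fun η _ => e η, Finset.sum_ite_mem, Finset.univ_inter, ← Finset.sum_mul, ← hW]
    field_simp
  have hone : Sec ∅ ∅ (fun _ : ConfigP n => (1 : ℝ)) := fun u v η => by simp [chi]
  have hm : ip (wt β) (fun _ => 1) f = Z := by rw [ip_comm, hfip _ hone, mul_one]
  have hb : ip (wt β) f f ≤ 2 * Real.exp (β * Real.exp β) * Z := by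
    rw [hfip f hfsec, mul_comm]
    refine mul_le_mul_of_nonneg_right ((hfsec.le_exp h hf0 hm σ).trans ?_) hZ0.le
    have hβ := h.beta
    have h1 : (ndef σ : ℝ) ≤ Real.exp β := by
      refine le_trans ?_ h.sq_le
      have h2 : ndef σ ≤ Fintype.card (Fin n × Fin n) := Finset.card_le_univ _
      rw [Fintype.card_prod, Fintype.card_fin] at h2
      exact_mod_cast h2
    gcongr
  have hmom := moment_le h hfsec hf0 hm hb
  rw [← hZ, ← hT] at hmom
  set k : ConfigP n → ℝ := sgp (genP n β) T f with hkdef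
  set k' : ConfigP n → ℝ := k - (1 : ℝ) • (fun _ => (1 : ℝ)) with hk'
  have hsub : ∀ q : ConfigP n → ℝ, ip (wt β) q k' = ip (wt β) q k - ip (wt β) q (fun _ => 1) := by
    intro q
    rw [hk', sub_eq_add_neg, ← neg_smul, ip_add_right, ip_smul_right]; ring
  have hkm : ip (wt β) (fun _ => 1) k = Z := by rw [hkdef, hA.ip_sgp, hA.sgp_one, hm]
  have hZ1 : ip (wt β) (fun _ : ConfigP n => (1 : ℝ)) (fun _ => 1) = Z := by simp [ip, hZ]
  have hkm' : ip (wt β) (fun _ => 1) k' = 0 := by rw [hsub, hkm, hZ1, sub_self]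
  have hksec : Sec ∅ ∅ k' := by
    intro u v η
    have := hfsec.sgp (β := β) T u v η
    rw [← hkdef] at this
    simp only [chi, Finset.prod_empty, one_mul] at this ⊢
    simp [hk', this]
  have hnorm : ip (wt β) k' k' ≤ 25 * Z := by
    have h1 : ip (wt β) k' k' = ip (wt β) k k - Z := by
      rw [hsub, ip_comm _ k' (fun _ => 1), hkm', ip_comm, hsub, ip_comm _ k (fun _ => 1), hkm]; ring
    rw [h1]
    have := Real.exp_one_lt_d9
    nlinarith
  have hdec := invariant_decay h hksec hkm' hs
  set b : ConfigP n → ℝ := fun η => if η ∈ Gr n then 0 else 1 with hbdef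
  have hbsec : Sec ∅ ∅ b := by
    intro u v η
    by_cases hη : η ∈ Gr n
    · simp only [hbdef, if_pos hη, if_pos (act_mem_Gr.2 hη)]; simp
    · simp only [hbdef, if_neg hη, if_neg (mt act_mem_Gr.1 hη)]; simp [chi]
  have hb1 : ip (wt β) (fun _ => 1) b ≤ 20 * Real.exp (-(2 * β)) * Z := by
    have e : ip (wt β) (fun _ => 1) b = ∑ η ∈ (Gr n)ᶜ, wt β η := by
      have := sum_wt_Gr β b
      rw [ip]
      simp only [one_mul]
      rw [this, Finset.sum_eq_zero (s := Gr n) fun η hη => if_pos hη, zero_add]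
      refine Finset.sum_congr rfl fun η hη => ?_
      simp only [hbdef, if_neg (Finset.mem_compl.1 hη), mul_one]
    rw [e]
    refine h.sum_compl_le.trans (mul_le_mul_of_nonneg_left (card_Gr_le_sum β) (by positivity))
  have hbb : ip (wt β) b b ≤ Z := by
    rw [hZ, ip]
    refine Finset.sum_le_sum fun η _ => ?_
    have : b η * b η ≤ 1 := by simp only [hbdef]; split_ifs <;> norm_num
    nlinarith [wt_pos β η]
  have key : Z * sgp (genP n β) (T + s) b σ = ip (wt β) (fun _ => 1) b +
      ip (wt β) (sgp (genP n β) s k') b := by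
    rw [← hfip _ (hbsec.sgp _), hA.ip_sgp, add_comm, ← sgp_sgp, ← hkdef, hk', sgp_sub, sgp_smul, hA.sgp_one,
      one_smul, sub_eq_add_neg, ip_add_left, ← neg_one_smul ℝ, ip_smul_left]
    ring
  have hcs := hA.sq_ip_le (sgp (genP n β) s k') b
  have h5 : ip (wt β) (sgp (genP n β) s k') b ≤ 5 * Real.exp (-(kap β * s)) * Z := by
    refine le_of_abs_le (abs_le_of_sq_le_sq ?_ (by positivity))
    refine hcs.trans ?_
    calc _ ≤ (Real.exp (-(2 * kap β * s)) * (25 * Z)) * Z := by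
          refine mul_le_mul (hdec.trans (by gcongr)) hbb (hA.ip_self_nonneg b) (by positivity)
      _ = _ := by
          have : Real.exp (-(2 * kap β * s)) = Real.exp (-(kap β * s)) ^ 2 := by
            rw [sq, ← Real.exp_add]; congr 1; ring
          rw [this]; ring
  have h6 : Z * sgp (genP n β) (T + s) b σ ≤
      Z * (20 * Real.exp (-(2 * β)) + 5 * Real.exp (-(kap β * s))) := by
    rw [key]; linarith
  exact le_of_mul_le_mul_left h6 hZ0

lemma tv_le_one {t : ℝ} (ht : 0 ≤ t) (β : ℝ) (σ : ConfigP n) :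
    ∑ η, |mexp (t • genP n β) σ η - gibbsP n β η| ≤ 2 := by
  have hA := revChain n β
  have hg0 : ∀ η : ConfigP n, 0 ≤ gibbsP n β η := fun η => by
    rw [gibbsP_eq]; exact div_nonneg (wt_pos β η).le (sum_wt_pos n β).le
  calc _ ≤ ∑ η, (mexp (t • genP n β) σ η + gibbsP n β η) := by
        refine Finset.sum_le_sum fun η _ => (abs_sub _ _).trans ?_
        rw [abs_of_nonneg (hA.mexp_nonneg ht σ η), abs_of_nonneg (hg0 η)]
    _ = 2 := by
        rw [Finset.sum_add_distrib, hA.row_sum]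
        simp only [gibbsP_eq, ← Finset.sum_div]
        rw [div_self (sum_wt_pos n β).ne']
        norm_num

lemma tv_start_le {s t : ℝ} (hs : 0 ≤ s) (ht : 0 ≤ t) {b : ℝ} (σ : ConfigP n)
    (hb : ∀ g ∈ Gr n, tv (mexp (t • genP n β) g) (gibbsP n β) ≤ b) :
    tv (mexp ((s + t) • genP n β) σ) (gibbsP n β) ≤
      b + sgp (genP n β) s (fun η => if η ∈ Gr n then 0 else 1) σ := by
  have hA := revChain n β
  set P := mexp (s • genP n β) σ with hP
  have hP0 : ∀ ζ, 0 ≤ P ζ := fun ζ => hA.mexp_nonneg hs σ ζ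
  have hP1 : ∑ ζ, P ζ = 1 := hA.row_sum s σ
  have h1 : ∀ η, |mexp ((s + t) • genP n β) σ η - gibbsP n β η| ≤
      ∑ ζ, P ζ * |mexp (t • genP n β) ζ η - gibbsP n β η| := by
    intro η
    have e : mexp ((s + t) • genP n β) σ η - gibbsP n β η =
        ∑ ζ, P ζ * (mexp (t • genP n β) ζ η - gibbsP n β η) := by
      rw [mexp_add, Matrix.mul_apply]
      simp only [mul_sub, Finset.sum_sub_distrib, ← Finset.sum_mul, hP1, one_mul]
      rw [hP]
    rw [e]
    refine (Finset.abs_sum_le_sum_abs _ _).trans (Finset.sum_le_sum fun ζ _ => ?_)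
    rw [abs_mul, abs_of_nonneg (hP0 ζ)]
  have hb0 : 0 ≤ b := le_trans (by unfold tv; positivity) (hb _ const_mem_Gr)
  have h2 : ∀ ζ, ∑ η, |mexp (t • genP n β) ζ η - gibbsP n β η| ≤
      2 * (b + if ζ ∈ Gr n then 0 else 1) := by
    intro ζ
    by_cases hζ : ζ ∈ Gr n
    · have := hb ζ hζ
      rw [if_pos hζ]
      unfold tv at this
      linarith
    · rw [if_neg hζ]
      have := tv_le_one ht β ζ
      linarith
  unfold tv
  rw [div_le_iff₀ (by norm_num)]
  calc _ ≤ ∑ η, ∑ ζ, P ζ * |mexp (t • genP n β) ζ η - gibbsP n β η| :=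
        Finset.sum_le_sum fun η _ => h1 η
    _ = ∑ ζ, P ζ * ∑ η, |mexp (t • genP n β) ζ η - gibbsP n β η| := by
        rw [Finset.sum_comm]; simp only [Finset.mul_sum]
    _ ≤ ∑ ζ, P ζ * (2 * (b + if ζ ∈ Gr n then 0 else 1)) :=
        Finset.sum_le_sum fun ζ _ => mul_le_mul_of_nonneg_left (h2 ζ) (hP0 ζ)
    _ = _ := by
        have e : sgp (genP n β) s (fun η => if η ∈ Gr n then 0 else 1) σ =
          ∑ ζ, P ζ * (if ζ ∈ Gr n then 0 else 1) := rfl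
        rw [e, Finset.sum_congr rfl fun ζ _ => show P ζ * (2 * (b + if ζ ∈ Gr n then 0 else 1)) =
          2 * b * P ζ + 2 * (P ζ * if ζ ∈ Gr n then 0 else 1) by ring, Finset.sum_add_distrib,
          ← Finset.mul_sum, ← Finset.mul_sum, hP1]
        ring

end Reaching

/-! ### Two-line test functions -/

section TestFunctions

open Matrix

variable {n : ℕ} [NeZero n] {β : ℝ}

lemma Reg.two_le (h : Reg n β) : 2 ≤ n := by have := h.two; omega

lemma Reg.sum_five_le (h : Reg n β) :
    ∑ σ : ConfigP n, wt β σ * ndef σ * (if 5 ≤ ndef σ then 1 else 0) ≤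
      240 * Real.exp (-(3 * β)) * (Gr n).card := by
  have hn := h.two_le
  set f : ConfigP n → ℝ := fun σ => if 5 ≤ ndef σ then 1 else 0 with hf
  set F : ConfigP n → ℝ := fun σ => if 1 ≤ ndef σ then 1 else 0 with hF
  have hF0 : ∀ σ, 0 ≤ F σ := fun σ => by simp only [hF]; split_ifs <;> norm_num
  have hsq : ∀ σ, f σ ^ 2 = f σ := fun σ => by simp only [hf]; split_ifs <;> norm_num
  have h1 := sum_termPairs_move hn β f
  have h2 : ∑ q ∈ movePairs n, wt β q.1 * (f q.1 - f (push q.1 q.2)) ^ 2 = 0 := by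
    refine Finset.sum_eq_zero fun q hq => ?_
    simp only [hf, ndef_push_move hn hq]
    ring
  have h3 : ∑ q ∈ termPairs n, wt β q.1 * f q.1 ^ 2 ≤ ∑ q ∈ termPairs n, wt β q.1 * F (push q.1 q.2) := by
    refine Finset.sum_le_sum fun q hq => mul_le_mul_of_nonneg_left ?_ (wt_pos β _).le
    rw [hsq]
    by_cases h5 : 5 ≤ ndef q.1
    · have hN := ndef_toggle (tip_ne (mem_termPairs.1 hq).1) (succ_ne hn q.2.2).symm (dft_push q.1 q.2)
      have hg : ∀ y, -1 ≤ gain q.1 y := fun y => by unfold gain; split_ifs <;> norm_num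
      have hge : 1 ≤ ndef (push q.1 q.2) := by
        have a1 := hg (q.2.1, q.2.2)
        have a2 := hg (q.2.1, q.2.2 + 1)
        have a3 := hg (tip q.1 q.2, q.2.2)
        have a4 := hg (tip q.1 q.2, q.2.2 + 1)
        omega
      simp only [hf, hF, if_pos h5, if_pos hge, le_refl]
    · simp only [hf, if_neg h5]
      exact hF0 _
  have h4 := h3.trans (sum_term_le hn β hF0)
  rw [h2, mul_zero, add_zero] at h1
  have h5 : (n : ℝ) * ∑ υ, wt β υ * F υ * (3 * n * ndef υ * Real.exp (-(2 * β)) +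
        (n : ℝ) ^ 3 * Real.exp (-(4 * β))) ≤ 4 * Real.exp (-β) * ∑ υ : ConfigP n, wt β υ * ndef υ := by
    rw [Finset.mul_sum, Finset.mul_sum]
    refine Finset.sum_le_sum fun υ _ => ?_
    have ha := h.absorb_le υ
    have hb : Real.exp (-(2 * β)) ≤ Real.exp (-β) := Real.exp_le_exp.2 (by have := h.beta; linarith)
    have hw := wt_pos β υ
    by_cases hN : 1 ≤ ndef υ
    · have hN' : (1 : ℝ) ≤ ndef υ := by exact_mod_cast hN
      have : F υ = 1 := if_pos hN
      rw [this]
      have hc : n * (3 * n * ndef υ * Real.exp (-(2 * β)) + (n : ℝ) ^ 3 * Real.exp (-(4 * β))) ≤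
          4 * Real.exp (-β) * ndef υ := by nlinarith [Real.exp_pos (-β)]
      have := mul_le_mul_of_nonneg_left hc hw.le
      linarith
    · have : F υ = 0 := if_neg hN
      rw [this]
      have : 0 ≤ 4 * Real.exp (-β) * (wt β υ * ndef υ) := by positivity
      linarith
  have h6 := h.sum_ndef_le
  have e : Real.exp (-(3 * β)) = Real.exp (-β) * Real.exp (-(2 * β)) := by
    rw [← Real.exp_add]; congr 1; ring
  simp only [hsq] at h1
  refine h1.trans ?_
  simp only [hsq] at h4
  have hn0 : (0 : ℝ) ≤ n := Nat.cast_nonneg n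
  calc 3 * (n : ℝ) * ∑ q ∈ termPairs n, wt β q.1 * f q.1
      ≤ 3 * ((n : ℝ) * ∑ υ, wt β υ * F υ * (3 * n * ndef υ * Real.exp (-(2 * β)) +
        (n : ℝ) ^ 3 * Real.exp (-(4 * β)))) := by
        rw [mul_assoc]; gcongr
    _ ≤ 3 * (4 * Real.exp (-β) * ∑ υ : ConfigP n, wt β υ * ndef υ) := by gcongr
    _ ≤ 3 * (4 * Real.exp (-β) * (20 * Real.exp (-(2 * β)) * (Gr n).card)) := by gcongr
    _ = _ := by rw [e]; ring

lemma four_le_ndef {σ : ConfigP n} (h : σ ∉ Gr n) : 4 ≤ ndef σ := by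
  have h1 := ndef_pos h
  obtain ⟨⟨a, j⟩, hy⟩ := Finset.card_pos.1 (show 0 < (Finset.univ.filter fun y => dft σ y = true).card from h1)
  have hy : dft σ (a, j) = true := (Finset.mem_filter.1 hy).2
  obtain ⟨b, hb, hbd⟩ := exists_ne_dft_row hy
  obtain ⟨k, hk, hkd⟩ := exists_ne_dft_col hy
  obtain ⟨l, hl, hld⟩ := exists_ne_dft_col hbd
  have hs : ({(a, j), (b, j), (a, k), (b, l)} : Finset (Fin n × Fin n)) ⊆
      Finset.univ.filter fun y => dft σ y = true := by
    intro y hy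
    simp only [Finset.mem_insert, Finset.mem_singleton] at hy
    rcases hy with rfl | rfl | rfl | rfl <;> simpa
  refine le_trans (le_of_eq ?_) (Finset.card_le_card hs)
  rw [Finset.card_insert_of_notMem, Finset.card_insert_of_notMem, Finset.card_insert_of_notMem,
    Finset.card_singleton]
  · simp [hb.symm]
  · simp [hb, hl.symm]
  · simp [hb.symm, hk.symm]

/-- A four-defect configuration with two defects off a third, isolated column is a box. -/
lemma box_of_four {σ : ConfigP n} (h4 : ndef σ = 4) {y z : Fin n × Fin n} (hyz : y ≠ z)
    (hy : dft σ y = true) (hz : dft σ z = true) {c s : Fin n} (hc : dft σ (c, s) = true)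
    (hyc : y.1 ≠ c) (hzc : z.1 ≠ c) :
    y.1 = z.1 ∧ ∀ p, dft σ p = true ↔ (p.1 = y.1 ∨ p.1 = c) ∧ (p.2 = y.2 ∨ p.2 = z.2) := by
  obtain ⟨s', hs, hc'⟩ := exists_ne_dft_col hc
  have hsub : ({y, z, (c, s), (c, s')} : Finset (Fin n × Fin n)) ⊆
      Finset.univ.filter fun y => dft σ y = true := by
    intro p hp
    simp only [Finset.mem_insert, Finset.mem_singleton] at hp
    rcases hp with rfl | rfl | rfl | rfl <;> simpa
  have hcard : ({y, z, (c, s), (c, s')} : Finset (Fin n × Fin n)).card = 4 := by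
    have hne : ∀ p : Fin n × Fin n, p.1 ≠ c → ∀ r, p ≠ (c, r) := by
      rintro p hp r rfl; exact hp rfl
    rw [Finset.card_insert_of_notMem, Finset.card_insert_of_notMem, Finset.card_insert_of_notMem,
      Finset.card_singleton]
    · simp [hs.symm]
    · simp [hne z hzc]
    · simp [hne y hyc, hyz]
  have hS := Finset.eq_of_subset_of_card_le hsub (by rw [hcard]; exact h4.le)
  have hmem : ∀ p, dft σ p = true ↔ p = y ∨ p = z ∨ p = (c, s) ∨ p = (c, s') := by
    intro p
    have := Finset.ext_iff.1 hS p
    simp only [Finset.mem_insert, Finset.mem_singleton, Finset.mem_filter, Finset.mem_univ, true_and] at this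
    exact this.symm
  obtain ⟨y1, y2⟩ := y
  obtain ⟨z1, z2⟩ := z
  simp only at hyc hzc ⊢
  obtain ⟨k, hk, hkd⟩ := exists_ne_dft_col hy
  obtain ⟨a, ha, had⟩ := exists_ne_dft_row hy
  obtain ⟨b, hb, hbd⟩ := exists_ne_dft_row hz
  rw [hmem] at hkd had hbd
  simp only [Prod.mk.injEq] at hkd had hbd hmem
  have hyz1 : y1 = z1 := by
    rcases hkd with h | h | h | h
    · exact absurd h.2 hk
    · exact h.1
    · exact absurd h.1 hyc
    · exact absurd h.1 hyc
  subst hyz1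
  have hyz2 : y2 ≠ z2 := fun h => hyz (by rw [h])
  refine ⟨rfl, ?_⟩
  have hyrow : y2 = s ∨ y2 = s' := by
    rcases had with h | h | h | h
    · exact absurd h.1 ha
    · exact absurd h.1 ha
    · exact Or.inl h.2
    · exact Or.inr h.2
  have hzrow : z2 = s ∨ z2 = s' := by
    rcases hbd with h | h | h | h
    · exact absurd h.1 hb
    · exact absurd h.1 hb
    · exact Or.inl h.2
    · exact Or.inr h.2
  rintro ⟨p1, p2⟩
  rw [hmem]
  simp only [Prod.mk.injEq]
  rcases hyrow with rfl | rfl <;> rcases hzrow with rfl | rfl <;> grind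

/-- Some plaquette containing `x` is a defect. -/
def Near (σ : ConfigP n) (x : Fin n × Fin n) : Prop :=
  dft σ (x.1 - 1, x.2 - 1) = true ∨ dft σ (x.1 - 1, x.2) = true ∨ dft σ (x.1, x.2 - 1) = true ∨
    dft σ x = true

/-- Four-defect boxes one of whose sides can be moved by a flip at `x`. -/
def SideAt (x : Fin n × Fin n) (σ : ConfigP n) : Prop :=
  ∃ a : Bool, ∃ c : Fin n, ∀ p, dft σ p = true ↔
    (p.1 = (if a = true then x.1 else x.1 - 1) ∨ p.1 = c) ∧ (p.2 = x.2 - 1 ∨ p.2 = x.2)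

lemma ndef_flip (hn : 2 ≤ n) (σ : ConfigP n) (x : Fin n × Fin n) :
    (ndef (flipP n σ x) : ℤ) = ndef σ + (gain σ (x.1 - 1, x.2 - 1) + gain σ (x.1 - 1, x.2) +
      gain σ (x.1, x.2 - 1) + gain σ (x.1, x.2)) :=
  ndef_toggle (pred_ne hn x.1) (pred_ne hn x.2) (dft_flip σ x)

lemma near_or_near_flip (hn : 2 ≤ n) (σ : ConfigP n) (x : Fin n × Fin n) :
    Near σ x ∨ (Near (flipP n σ x) x ∧ ndef σ ≤ ndef (flipP n σ x)) := by
  by_cases h : Near σ x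
  · exact Or.inl h
  right
  have h' := h
  unfold Near at h
  push Not at h
  simp only [Bool.not_eq_true] at h
  obtain ⟨h1, h2, h3, h4⟩ := h
  constructor
  · right; right; right
    rw [dft_flip, h4, duo_right (pred_ne hn _), duo_right (pred_ne hn _)]; rfl
  · have := ndef_flip hn σ x
    rw [gain_false h1, gain_false h2, gain_false h3, gain_false (show dft σ (x.1, x.2) = false from h4)] at this
    omega

lemma sideAt_of_four (hn : 2 ≤ n) {σ : ConfigP n} {x : Fin n × Fin n} (h4 : ndef σ = 4)
    (h4' : ndef (flipP n σ x) = 4) {c s : Fin n} (hc : dft σ (c, s) = true) (hc1 : c ≠ x.1)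
    (hc2 : c ≠ x.1 - 1) : SideAt x σ := by
  obtain ⟨x1, x2⟩ := x
  simp only at hc1 hc2
  have hN := ndef_flip hn σ (x1, x2)
  rw [h4, h4'] at hN
  have hx1 := pred_ne hn x1
  have hx2 := pred_ne hn x2
  have key : ∀ y z : Fin n × Fin n, y ≠ z → dft σ y = true → dft σ z = true → (y.1 = x1 ∨ y.1 = x1 - 1) →
      (z.1 = x1 ∨ z.1 = x1 - 1) → (y.2 = x2 - 1 ∨ y.2 = x2) → (z.2 = x2 - 1 ∨ z.2 = x2) →
      SideAt (x1, x2) σ := by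
    intro y z hyz hy hz hy1 hz1 hy2 hz2
    obtain ⟨e, hb⟩ := box_of_four h4 hyz hy hz hc (by rintro h; rcases hy1 with h' | h' <;> simp_all)
      (by rintro h; rcases hz1 with h' | h' <;> simp_all)
    have hne : y.2 ≠ z.2 := fun h => hyz (Prod.ext e h)
    have hrow : ∀ r, (r = y.2 ∨ r = z.2) ↔ (r = x2 - 1 ∨ r = x2) := by
      intro r
      rcases hy2 with h | h
      · rcases hz2 with h' | h'
        · exact absurd (h.trans h'.symm) hne
        · rw [h, h']
      · rcases hz2 with h' | h'
        · rw [h, h']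
          exact or_comm
        · exact absurd (h.trans h'.symm) hne
    refine ⟨decide (y.1 = x1), c, fun p => ?_⟩
    rw [hb, hrow]
    rcases hy1 with h | h
    · simp [h]
    · simp [h, hx1]
  by_cases a1 : dft σ (x1 - 1, x2 - 1) = true <;> by_cases a2 : dft σ (x1 - 1, x2) = true <;>
  by_cases a3 : dft σ (x1, x2 - 1) = true <;> by_cases a4 : dft σ (x1, x2) = true <;>
  simp only [gain, a1, a2, a3, a4] at hN <;>
  first
  | exact key (x1 - 1, x2 - 1) (x1 - 1, x2) (by simp [hx2]) a1 a2 (by simp) (by simp) (by simp) (by simp)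
  | exact key (x1, x2 - 1) (x1, x2) (by simp [hx2]) a3 a4 (by simp) (by simp) (by simp) (by simp)
  | exact key (x1 - 1, x2 - 1) (x1, x2 - 1) (by simp [hx1]) a1 a3 (by simp) (by simp) (by simp) (by simp)
  | exact key (x1 - 1, x2 - 1) (x1, x2) (by simp [hx1]) a1 a4 (by simp) (by simp) (by simp) (by simp)
  | exact key (x1 - 1, x2) (x1, x2 - 1) (by simp [hx1]) a2 a3 (by simp) (by simp) (by simp) (by simp)
  | exact key (x1 - 1, x2) (x1, x2) (by simp [hx1]) a2 a4 (by simp) (by simp) (by simp) (by simp)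
  | (exfalso; revert hN; norm_num)

lemma dft_xor (σ τ : ConfigP n) (y : Fin n × Fin n) :
    dft (fun p => (σ p ^^ τ p)) y = (dft σ y ^^ dft τ y) := by
  have hx : ∀ a b c d : Bool, ((a ^^ b) ^^ (c ^^ d)) = ((a ^^ c) ^^ (b ^^ d)) := by decide
  simp only [dft]
  rw [hx (σ y) (τ y), hx (σ (y.1, y.2 + 1)) (τ (y.1, y.2 + 1)), hx (σ y ^^ σ (y.1 + 1, y.2))]

/-- Configurations with a prescribed set of defects. -/
def withDft (P : Fin n × Fin n → Prop) : Finset (ConfigP n) :=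
  Finset.univ.filter fun σ => ∀ p, dft σ p = true ↔ P p

lemma mem_withDft {P : Fin n × Fin n → Prop} {σ : ConfigP n} :
    σ ∈ withDft P ↔ ∀ p, dft σ p = true ↔ P p := by
  simp only [withDft, Finset.mem_filter, Finset.mem_univ, true_and]

lemma card_withDft_le (P : Fin n × Fin n → Prop) : (withDft P).card ≤ (Gr n).card := by
  rcases Finset.eq_empty_or_nonempty (withDft P) with h | ⟨τ, hτ⟩
  · rw [h]; simp
  refine Finset.card_le_card_of_injOn (fun σ p => (σ p ^^ τ p)) ?_ ?_
  · intro σ hσ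
    have h1 := mem_withDft.1 hτ
    have h2 := mem_withDft.1 (Finset.mem_coe.1 hσ)
    refine Finset.mem_coe.2 (mem_Gr.2 fun y => ?_)
    rw [dft_xor]
    have : dft σ y = dft τ y := Bool.eq_iff_iff.2 ((h2 y).trans (h1 y).symm)
    rw [this, Bool.xor_self]
  · intro σ _ σ' _ h
    funext y
    exact Bool.xor_left_inj.1 (congrFun h y)

lemma card_sideAt_le (x : Fin n × Fin n) :
    (Finset.univ.filter fun σ : ConfigP n => SideAt x σ).card ≤ 2 * n * (Gr n).card := by
  have hsub : (Finset.univ.filter fun σ : ConfigP n => SideAt x σ) ⊆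
      (Finset.univ : Finset (Bool × Fin n)).biUnion fun q => withDft fun p =>
        (p.1 = (if q.1 = true then x.1 else x.1 - 1) ∨ p.1 = q.2) ∧ (p.2 = x.2 - 1 ∨ p.2 = x.2) := by
    intro σ hσ
    obtain ⟨a, c, h⟩ := (Finset.mem_filter.1 hσ).2
    exact Finset.mem_biUnion.2 ⟨(a, c), Finset.mem_univ _, mem_withDft.2 h⟩
  refine (Finset.card_le_card hsub).trans ?_
  refine (Finset.card_biUnion_le_card_mul _ _ _ fun q _ => card_withDft_le _).trans ?_
  rw [Finset.card_univ, Fintype.card_prod, Fintype.card_bool, Fintype.card_fin]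

end TestFunctions

section PairFunctions

open Matrix

variable {n : ℕ} [NeZero n] {β : ℝ}

/-- Truncation to the interval `[-1, 1]`. -/
def clip (z : ℝ) : ℝ := max (-1) (min 1 z)

lemma abs_clip_le (z : ℝ) : |clip z| ≤ 1 :=
  abs_le.2 ⟨le_max_left _ _, max_le (by norm_num) (min_le_left _ _)⟩

lemma clip_neg (z : ℝ) : clip (-z) = -clip z := by
  unfold clip
  rcases le_total z (-1) with h | h <;> rcases le_total z 1 with h' | h' <;>
  simp only [max_def, min_def] <;> split_ifs <;> linarith

lemma abs_clip_sub_le (a b : ℝ) : |clip a - clip b| ≤ |a - b| :=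
  (abs_max_sub_max_le_max _ _ _ _).trans
    (max_le (by simp) ((abs_min_sub_min_le_max _ _ _ _).trans (max_le (by simp) le_rfl)))

lemma clip_of_one_le {z : ℝ} (h : 1 ≤ z) : clip z = 1 := by
  rw [clip, min_eq_left h]; norm_num

/-- Agreement of the spins of the rows `i` and `i'` in column `c`. -/
def agr (i i' : Fin n) (σ : ConfigP n) (c : Fin n) : ℝ := sval (σ (c, i)) * sval (σ (c, i'))

/-- The truncated overlap of the rows `i` and `i'`. -/
def overlap (i i' : Fin n) (σ : ConfigP n) : ℝ := clip ((∑ c, agr i i' σ c) / (n - 2))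

lemma abs_overlap_le (i i' : Fin n) (σ : ConfigP n) : |overlap i i' σ| ≤ 1 := abs_clip_le _

lemma agr_eq (i i' : Fin n) (σ : ConfigP n) (c : Fin n) : agr i i' σ c = 1 ∨ agr i i' σ c = -1 := by
  unfold agr sval
  cases σ (c, i) <;> cases σ (c, i') <;> simp

lemma sval_xor_mul (a b u v w : Bool) : sval (a ^^ (u ^^ v)) * sval (b ^^ (u ^^ w)) =
    (if v = true then -1 else 1) * (if w = true then -1 else 1) * (sval a * sval b) := by
  cases a <;> cases b <;> cases u <;> cases v <;> cases w <;> norm_num [sval]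

lemma chi_pair {i i' : Fin n} (h : i ≠ i') (v : Fin n → Bool) :
    chi {i, i'} v = (if v i = true then -1 else 1) * (if v i' = true then -1 else 1) :=
  Finset.prod_pair h

lemma agr_act {i i' : Fin n} (h : i ≠ i') (u v : Fin n → Bool) (σ : ConfigP n) (c : Fin n) :
    agr i i' (act u v σ) c = chi {i, i'} v * agr i i' σ c := by
  rw [chi_pair h]
  exact sval_xor_mul _ _ _ _ _

lemma sec_overlap {i i' : Fin n} (h : i ≠ i') : Sec ∅ {i, i'} (overlap (n := n) i i') := by
  intro u v σ
  have h1 : ∑ c, agr i i' (act u v σ) c = chi {i, i'} v * ∑ c, agr i i' σ c := by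
    rw [Finset.mul_sum]
    exact Finset.sum_congr rfl fun c _ => agr_act h u v σ c
  have h2 : chi (∅ : Finset (Fin n)) u = 1 := Finset.prod_empty
  unfold overlap
  rw [h1, h2, one_mul]
  rcases mul_self_eq_one_iff.1 (chi_sq {i, i'} v) with e | e <;> rw [e]
  · rw [one_mul, one_mul]
  · rw [neg_one_mul, neg_one_mul, neg_div, clip_neg]

lemma overlap_flip_of_ne {i i' : Fin n} {x : Fin n × Fin n} (h : x.2 ≠ i) (h' : x.2 ≠ i')
    (σ : ConfigP n) : overlap i i' (flipP n σ x) = overlap i i' σ := by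
  have e : ∀ c, agr i i' (flipP n σ x) c = agr i i' σ c := by
    intro c
    have h1 : flipP n σ x (c, i) = σ (c, i) := if_neg (by rintro rfl; exact h rfl)
    have h2 : flipP n σ x (c, i') = σ (c, i') := if_neg (by rintro rfl; exact h' rfl)
    rw [agr, agr, h1, h2]
  simp only [overlap, e]

lemma agr_flip_of_ne {i i' c : Fin n} {x : Fin n × Fin n} (h : c ≠ x.1) (σ : ConfigP n) :
    agr i i' (flipP n σ x) c = agr i i' σ c := by
  have h1 : ∀ j, flipP n σ x (c, j) = σ (c, j) := fun j => if_neg (by rintro rfl; exact h rfl)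
  rw [agr, agr, h1, h1]

lemma abs_overlap_flip_sub_le (hn : 3 ≤ n) (i i' : Fin n) (σ : ConfigP n) (x : Fin n × Fin n) :
    |overlap i i' (flipP n σ x) - overlap i i' σ| ≤ 2 / (n - 2) := by
  have hn' : (3 : ℝ) ≤ n := by exact_mod_cast hn
  refine (abs_clip_sub_le _ _).trans ?_
  rw [← sub_div, ← Finset.sum_sub_distrib, Finset.sum_eq_single x.1, abs_div,
    abs_of_pos (show (0 : ℝ) < n - 2 by linarith)]
  · have : (0 : ℝ) < n - 2 := by linarith
    gcongr
    rcases agr_eq i i' σ x.1 with h | h <;> rcases agr_eq i i' (flipP n σ x) x.1 with h' | h' <;>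
      rw [h, h'] <;> norm_num
  · intro c _ hc
    rw [agr_flip_of_ne hc, sub_self]
  · intro h; exact absurd (Finset.mem_univ _) h

lemma overlap_of_const (hn : 3 ≤ n) {i i' : Fin n} {σ : ConfigP n} {s : ℝ} (hs : s = 1 ∨ s = -1)
    {x : Fin n} (h : ∀ c, c ≠ x → agr i i' σ c = s) : overlap i i' σ = s := by
  have hn' : (3 : ℝ) ≤ n := by exact_mod_cast hn
  have hsum : ∑ c, agr i i' σ c = agr i i' σ x + (n - 1) * s := by
    rw [← Finset.add_sum_erase _ _ (Finset.mem_univ x)]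
    congr 1
    rw [Finset.sum_congr rfl fun c hc => h c (Finset.ne_of_mem_erase hc), Finset.sum_const,
      Finset.card_erase_of_mem (Finset.mem_univ x), Finset.card_univ, Fintype.card_fin, nsmul_eq_mul,
      Nat.cast_sub (by omega), Nat.cast_one]
  have hx := agr_eq i i' σ x
  unfold overlap
  rw [hsum]
  rcases hs with rfl | rfl
  · apply clip_of_one_le
    rw [le_div_iff₀ (by linarith)]
    rcases hx with hx | hx <;> rw [hx] <;> linarith
  · rw [← neg_neg ((agr i i' σ x + (n - 1) * -1) / ((n : ℝ) - 2)), clip_neg, clip_of_one_le]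
    rw [← neg_div, le_div_iff₀ (by linarith)]
    rcases hx with hx | hx <;> rw [hx] <;> linarith

lemma agr_succ {i i' c : Fin n} {σ : ConfigP n} (h : ∀ j, dft σ (c, j) = false) :
    agr i i' σ (c + 1) = agr i i' σ c := by
  have hb : ∀ a b d e : Bool, ((a ^^ b) ^^ (d ^^ e)) = false → (d ^^ e) = (a ^^ b) := by decide
  have hc : (σ (c, i) ^^ σ (c + 1, i)) = (σ (c, i') ^^ σ (c + 1, i')) :=
    const_of_succ (h := fun j => (σ (c, j) ^^ σ (c + 1, j))) (fun j => hb _ _ _ _ (h j)) i i'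
  unfold agr
  revert hc
  generalize σ (c, i) = a
  generalize σ (c + 1, i) = b
  generalize σ (c, i') = d
  generalize σ (c + 1, i') = e
  cases a <;> cases b <;> cases d <;> cases e <;> norm_num [sval]

lemma overlap_of_mem_Gr (hn : 3 ≤ n) {i i' : Fin n} {σ : ConfigP n} (h : σ ∈ Gr n) :
    overlap i i' σ = agr i i' σ 0 :=
  overlap_of_const hn (agr_eq i i' σ 0) (x := 0) fun c _ =>
    const_of_succ (fun c => agr_succ fun j => mem_Gr.1 h (c, j)) c 0

lemma overlap_flip_of_column (hn : 3 ≤ n) {i i' : Fin n} {σ : ConfigP n} {x : Fin n × Fin n}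
    (h : ∀ c, c ≠ x.1 → c ≠ x.1 - 1 → ∀ j, dft σ (c, j) = false) :
    overlap i i' (flipP n σ x) = overlap i i' σ := by
  have hc : ∀ k, 0 < k → k < n → agr i i' σ (x.1 + k • (1 : Fin n)) = agr i i' σ (x.1 + 1) := by
    intro k hk hkn
    induction k with
    | zero => omega
    | succ k ih =>
      rcases Nat.eq_zero_or_pos k with rfl | hk'
      · simp
      · rw [← ih hk' (by omega), succ_nsmul, ← add_assoc]
        refine agr_succ (h _ (add_nsmul_ne hk' (by omega)) fun e => ?_)
        have : x.1 + (k + 1) • (1 : Fin n) = x.1 := by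
          rw [succ_nsmul, ← add_assoc, e, sub_add_cancel]
        exact add_nsmul_ne hk hkn this
  have hc' : ∀ c, c ≠ x.1 → agr i i' σ c = agr i i' σ (x.1 + 1) := by
    intro c hcx
    obtain ⟨k, hk, hkn, rfl⟩ := exists_add_nsmul hcx
    exact hc k hk hkn
  rw [overlap_of_const hn (agr_eq i i' σ (x.1 + 1)) hc',
    overlap_of_const hn (agr_eq i i' σ (x.1 + 1)) fun c hcx => by rw [agr_flip_of_ne hcx, hc' c hcx]]

/-- The indicator of a proposition. -/
def bit (P : Prop) : ℝ := if P then 1 else 0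

lemma bit_nonneg (P : Prop) : 0 ≤ bit P := by unfold bit; split_ifs <;> norm_num

lemma bit_of {P : Prop} (h : P) : bit P = 1 := if_pos h

lemma bit_not {P : Prop} (h : ¬P) : bit P = 0 := if_neg h

lemma bit_or_le (P Q : Prop) : bit (P ∨ Q) ≤ bit P + bit Q := by
  by_cases hP : P <;> by_cases hQ : Q <;> norm_num [bit, hP, hQ]

lemma sum_bit {α : Type*} [Fintype α] (P : α → Prop) :
    ∑ a, bit (P a) = ((Finset.univ.filter P).card : ℝ) := by
  simp only [bit, Finset.sum_boole]

lemma sum_bit_eq {α : Type*} [Fintype α] (a : α) : ∑ b, bit (b = a) = 1 := by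
  simp [bit]

/-- The weight of edges touching a configuration with at least five defects. -/
def crowd (β : ℝ) (e : ConfigP n × (Fin n × Fin n)) : ℝ :=
  wt β e.1 * bit (5 ≤ ndef e.1) * bit (Near e.1 e.2)

lemma crowd_nonneg (β : ℝ) (e : ConfigP n × (Fin n × Fin n)) : 0 ≤ crowd β e :=
  mul_nonneg (mul_nonneg (wt_pos _ _).le (bit_nonneg _)) (bit_nonneg _)

lemma cond_le_crowd (hn : 2 ≤ n) {σ : ConfigP n} {x : Fin n × Fin n} (h : 5 ≤ ndef σ) :
    cond β σ x ≤ crowd β (σ, x) + crowd β (flipP n σ x, x) := by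
  rcases near_or_near_flip hn σ x with h' | ⟨h', h''⟩
  · have : crowd β (σ, x) = wt β σ := by simp only [crowd, bit_of h, bit_of h', mul_one]
    have := crowd_nonneg β (flipP n σ x, x)
    have : cond β σ x ≤ wt β σ := min_le_left _ _
    linarith
  · have : crowd β (flipP n σ x, x) = wt β (flipP n σ x) := by
      simp only [crowd, bit_of (h.trans h''), bit_of h', mul_one]
    have := crowd_nonneg β (σ, x)
    have : cond β σ x ≤ wt β (flipP n σ x) := min_le_right _ _
    linarith

lemma edge_le (hn : 3 ≤ n) (i i' : Fin n) (σ : ConfigP n) (x : Fin n × Fin n) :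
    cond β σ x * (overlap i i' (flipP n σ x) - overlap i i' σ) ^ 2 ≤
      bit (x.2 = i ∨ x.2 = i') * (2 / ((n : ℝ) - 2)) ^ 2 * (Real.exp (-(4 * β)) * bit (SideAt x σ) +
        (crowd β (σ, x) + crowd β (flipP n σ x, x))) := by
  have hn2 : 2 ≤ n := by omega
  have h0 : 0 ≤ Real.exp (-(4 * β)) * bit (SideAt x σ) := mul_nonneg (Real.exp_pos _).le (bit_nonneg _)
  have h1 := crowd_nonneg β (σ, x)
  have h2 := crowd_nonneg β (flipP n σ x, x)
  have hzero : overlap i i' (flipP n σ x) = overlap i i' σ →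
      cond β σ x * (overlap i i' (flipP n σ x) - overlap i i' σ) ^ 2 ≤
      bit (x.2 = i ∨ x.2 = i') * (2 / ((n : ℝ) - 2)) ^ 2 * (Real.exp (-(4 * β)) * bit (SideAt x σ) +
        (crowd β (σ, x) + crowd β (flipP n σ x, x))) := by
    intro e
    rw [e, sub_self, zero_pow two_ne_zero, mul_zero]
    have := bit_nonneg (x.2 = i ∨ x.2 = i')
    positivity
  by_cases hx : x.2 = i ∨ x.2 = i'
  swap
  · push Not at hx
    exact hzero (overlap_flip_of_ne hx.1 hx.2 σ)
  have hgen : cond β σ x ≤ Real.exp (-(4 * β)) * bit (SideAt x σ) +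
        (crowd β (σ, x) + crowd β (flipP n σ x, x)) →
      cond β σ x * (overlap i i' (flipP n σ x) - overlap i i' σ) ^ 2 ≤
      bit (x.2 = i ∨ x.2 = i') * (2 / ((n : ℝ) - 2)) ^ 2 * (Real.exp (-(4 * β)) * bit (SideAt x σ) +
        (crowd β (σ, x) + crowd β (flipP n σ x, x))) := by
    intro hc
    rw [bit_of hx, one_mul, mul_comm]
    have hd := abs_overlap_flip_sub_le hn i i' σ x
    have hd' : (overlap i i' (flipP n σ x) - overlap i i' σ) ^ 2 ≤ (2 / ((n : ℝ) - 2)) ^ 2 := by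
      rw [← sq_abs]
      exact pow_le_pow_left₀ (abs_nonneg _) hd 2
    exact mul_le_mul hd' hc (cond_nonneg _ _ _) (sq_nonneg _)
  by_cases a : 5 ≤ ndef σ
  · have := cond_le_crowd (β := β) hn2 (x := x) a
    exact hgen (by linarith)
  by_cases a' : 5 ≤ ndef (flipP n σ x)
  · have := cond_le_crowd (β := β) hn2 (x := x) a'
    rw [flip_flip, cond_flip] at this
    exact hgen (by linarith)
  by_cases g : σ ∈ Gr n
  · exact hzero (overlap_flip_of_column hn fun c _ _ j => mem_Gr.1 g _)
  by_cases g' : flipP n σ x ∈ Gr n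
  · have := overlap_flip_of_column (i := i) (i' := i') (x := x) hn fun c _ _ j => mem_Gr.1 g' _
    rw [flip_flip] at this
    exact hzero this.symm
  have b := four_le_ndef g
  have b' := four_le_ndef g'
  by_cases hcol : ∀ c, c ≠ x.1 → c ≠ x.1 - 1 → ∀ j, dft σ (c, j) = false
  · exact hzero (overlap_flip_of_column hn hcol)
  push Not at hcol
  obtain ⟨c, hc1, hc2, j, hj⟩ := hcol
  have hs : SideAt x σ := sideAt_of_four hn2 (by omega) (by omega) ((Bool.not_eq_false _).mp hj) hc1 hc2
  refine hgen ?_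
  have : cond β σ x ≤ wt β σ := min_le_left _ _
  rw [wt_four (by omega)] at this
  rw [bit_of hs]
  linarith

lemma sum_near_le (σ : ConfigP n) : ∑ x, bit (Near σ x) ≤ 4 * ndef σ := by
  have hs : ∀ a b : Fin n, ∑ x : Fin n × Fin n, bit (dft σ (x.1 - a, x.2 - b) = true) = ndef σ := by
    intro a b
    have : ∑ x : Fin n × Fin n, bit (dft σ (x.1 - a, x.2 - b) = true) =
        ∑ x : Fin n × Fin n, bit (dft σ x = true) :=
      Fintype.sum_equiv ((Equiv.subRight a).prodCongr (Equiv.subRight b)) _ _ fun x => rfl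
    rw [this, ndef_cast]
    refine Finset.sum_congr rfl fun x _ => ?_
    unfold bit
    split_ifs <;> rfl
  have h1 := hs 1 1
  have h2 := hs 1 0
  have h3 := hs 0 1
  have h4 := hs 0 0
  simp only [sub_zero] at h2 h3 h4
  have : ∑ x, bit (Near σ x) ≤ ∑ x : Fin n × Fin n, (bit (dft σ (x.1 - 1, x.2 - 1) = true) +
      (bit (dft σ (x.1 - 1, x.2) = true) + (bit (dft σ (x.1, x.2 - 1) = true) +
        bit (dft σ (x.1, x.2) = true)))) := by
    refine Finset.sum_le_sum fun x _ => ?_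
    refine (bit_or_le _ _).trans (add_le_add le_rfl ?_)
    exact (bit_or_le _ _).trans (add_le_add le_rfl (bit_or_le _ _))
  rw [Finset.sum_add_distrib, Finset.sum_add_distrib, Finset.sum_add_distrib, h1, h2, h3, h4] at this
  linarith

lemma Reg.sum_crowd_le (h : Reg n β) :
    ∑ e : ConfigP n × (Fin n × Fin n), crowd β e ≤ 960 * Real.exp (-(3 * β)) * (Gr n).card := by
  rw [Fintype.sum_prod_type]
  have h1 : ∀ σ : ConfigP n, ∑ x, crowd β (σ, x) ≤
      4 * (wt β σ * ndef σ * (if 5 ≤ ndef σ then 1 else 0)) := by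
    intro σ
    simp only [crowd]
    rw [← Finset.mul_sum]
    have := mul_le_mul_of_nonneg_left (sum_near_le σ)
      (mul_nonneg (wt_pos β σ).le (bit_nonneg (5 ≤ ndef σ)))
    refine this.trans (le_of_eq ?_)
    have e : bit (5 ≤ ndef σ) = if 5 ≤ ndef σ then 1 else 0 := by
      unfold bit; split_ifs <;> rfl
    rw [e]
    ring
  refine (Finset.sum_le_sum fun σ _ => h1 σ).trans ?_
  rw [← Finset.mul_sum]
  have := h.sum_five_le
  linarith

lemma sum_row_bit_le (i i' : Fin n) : ∑ x : Fin n × Fin n, bit (x.2 = i ∨ x.2 = i') ≤ 2 * n := by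
  have : ∑ x : Fin n × Fin n, bit (x.2 = i ∨ x.2 = i') ≤
      ∑ x : Fin n × Fin n, (bit (x.2 = i) + bit (x.2 = i')) :=
    Finset.sum_le_sum fun x _ => bit_or_le _ _
  refine this.trans (le_of_eq ?_)
  rw [Finset.sum_add_distrib, Fintype.sum_prod_type, Fintype.sum_prod_type]
  simp only [sum_bit_eq, Finset.sum_const, Finset.card_univ, Fintype.card_fin, nsmul_eq_mul]
  ring

lemma sum_pair_bit_le (I J : Finset (Fin n)) (r : Fin n) :
    ∑ p ∈ I ×ˢ J, bit (r = p.1 ∨ r = p.2) ≤ 2 * n := by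
  refine le_trans (Finset.sum_le_univ_sum_of_nonneg fun p => bit_nonneg _) ?_
  have : ∑ p : Fin n × Fin n, bit (r = p.1 ∨ r = p.2) ≤
      ∑ p : Fin n × Fin n, (bit (p.1 = r) + bit (p.2 = r)) :=
    Finset.sum_le_sum fun p _ => by
      rw [eq_comm (a := p.1), eq_comm (a := p.2)]
      exact bit_or_le _ _
  refine this.trans (le_of_eq ?_)
  rw [Finset.sum_add_distrib, Fintype.sum_prod_type, Fintype.sum_prod_type_right]
  simp only [Finset.sum_const, Finset.card_univ, Fintype.card_fin, nsmul_eq_mul,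
    ← Finset.mul_sum, sum_bit_eq]
  ring

lemma Reg.sum_dirE_overlap_le (h : Reg n β) (I J : Finset (Fin n)) :
    ∑ p ∈ I ×ˢ J, dirE β (overlap (n := n) p.1 p.2) ≤ (2 / ((n : ℝ) - 2)) ^ 2 *
      (2 * (I.card * J.card) * n ^ 2 * Real.exp (-(4 * β)) + 1920 * n * Real.exp (-(3 * β))) *
        (Gr n).card := by
  have hn : 3 ≤ n := by have := h.two; omega
  set D := (2 / ((n : ℝ) - 2)) ^ 2 with hD
  have hD0 : 0 ≤ D := sq_nonneg _
  have hdir : ∀ p : Fin n × Fin n, dirE β (overlap (n := n) p.1 p.2) =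
      (∑ e : ConfigP n × (Fin n × Fin n), cond β e.1 e.2 *
        (overlap p.1 p.2 (flipP n e.1 e.2) - overlap p.1 p.2 e.1) ^ 2) / 2 := by
    intro p
    rw [Fintype.sum_prod_type]
    rfl
  have h1 : ∀ p : Fin n × Fin n, dirE β (overlap (n := n) p.1 p.2) ≤
      (D * Real.exp (-(4 * β)) * ∑ e : ConfigP n × (Fin n × Fin n),
        bit (e.2.2 = p.1 ∨ e.2.2 = p.2) * bit (SideAt e.2 e.1) +
      D * ∑ e : ConfigP n × (Fin n × Fin n), bit (e.2.2 = p.1 ∨ e.2.2 = p.2) *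
        (crowd β e + crowd β (flipP n e.1 e.2, e.2))) / 2 := by
    intro p
    rw [hdir, Finset.mul_sum, Finset.mul_sum, ← Finset.sum_add_distrib]
    gcongr with e
    refine (edge_le hn p.1 p.2 e.1 e.2).trans (le_of_eq ?_)
    ring
  have h2 : ∀ p : Fin n × Fin n, ∑ e : ConfigP n × (Fin n × Fin n),
      bit (e.2.2 = p.1 ∨ e.2.2 = p.2) * bit (SideAt e.2 e.1) ≤ 2 * n * (2 * n * (Gr n).card) := by
    intro p
    rw [Fintype.sum_prod_type_right]
    have : ∀ x : Fin n × Fin n, ∑ σ : ConfigP n, bit (x.2 = p.1 ∨ x.2 = p.2) * bit (SideAt x σ) ≤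
        bit (x.2 = p.1 ∨ x.2 = p.2) * (2 * n * (Gr n).card) := by
      intro x
      rw [← Finset.mul_sum, sum_bit]
      refine mul_le_mul_of_nonneg_left ?_ (bit_nonneg _)
      exact_mod_cast card_sideAt_le x
    refine (Finset.sum_le_sum fun x _ => this x).trans ?_
    rw [← Finset.sum_mul]
    exact mul_le_mul_of_nonneg_right (sum_row_bit_le _ _) (by positivity)
  have h3 : ∑ p ∈ I ×ˢ J, ∑ e : ConfigP n × (Fin n × Fin n), bit (e.2.2 = p.1 ∨ e.2.2 = p.2) *
        (crowd β e + crowd β (flipP n e.1 e.2, e.2)) ≤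
      2 * n * (2 * (960 * Real.exp (-(3 * β)) * (Gr n).card)) := by
    rw [Finset.sum_comm]
    have : ∀ e : ConfigP n × (Fin n × Fin n), ∑ p ∈ I ×ˢ J, bit (e.2.2 = p.1 ∨ e.2.2 = p.2) *
        (crowd β e + crowd β (flipP n e.1 e.2, e.2)) ≤
        2 * n * (crowd β e + crowd β (flipP n e.1 e.2, e.2)) := by
      intro e
      rw [← Finset.sum_mul]
      exact mul_le_mul_of_nonneg_right (sum_pair_bit_le _ _ _)
        (add_nonneg (crowd_nonneg _ _) (crowd_nonneg _ _))
    refine (Finset.sum_le_sum fun e _ => this e).trans ?_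
    rw [← Finset.mul_sum, Finset.sum_add_distrib, sum_edge_flip (fun e => crowd β e)]
    have := h.sum_crowd_le
    gcongr
    linarith
  have h4 : ∑ p ∈ I ×ˢ J, ∑ e : ConfigP n × (Fin n × Fin n),
      bit (e.2.2 = p.1 ∨ e.2.2 = p.2) * bit (SideAt e.2 e.1) ≤
      (I.card * J.card) * (2 * n * (2 * n * (Gr n).card)) := by
    refine (Finset.sum_le_sum fun p _ => h2 p).trans (le_of_eq ?_)
    rw [Finset.sum_const, Finset.card_product, nsmul_eq_mul, Nat.cast_mul]
  calc ∑ p ∈ I ×ˢ J, dirE β (overlap (n := n) p.1 p.2)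
      ≤ ∑ p ∈ I ×ˢ J, _ := Finset.sum_le_sum fun p _ => h1 p
    _ = (D * Real.exp (-(4 * β)) * ∑ p ∈ I ×ˢ J, ∑ e : ConfigP n × (Fin n × Fin n),
        bit (e.2.2 = p.1 ∨ e.2.2 = p.2) * bit (SideAt e.2 e.1) +
      D * ∑ p ∈ I ×ˢ J, ∑ e : ConfigP n × (Fin n × Fin n), bit (e.2.2 = p.1 ∨ e.2.2 = p.2) *
        (crowd β e + crowd β (flipP n e.1 e.2, e.2))) / 2 := by
        rw [← Finset.sum_div, Finset.sum_add_distrib, ← Finset.mul_sum, ← Finset.mul_sum]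
    _ ≤ (D * Real.exp (-(4 * β)) * ((I.card * J.card) * (2 * n * (2 * n * (Gr n).card))) +
      D * (2 * n * (2 * (960 * Real.exp (-(3 * β)) * (Gr n).card)))) / 2 := by gcongr
    _ = _ := by ring

end PairFunctions

/-! ### Lower bound on the total-variation distance -/

section LowerBound

open Matrix

variable {n : ℕ} [NeZero n] {β : ℝ}

lemma Sec.sum_wt_eq_zero {B : Finset (Fin n)} {f : ConfigP n → ℝ} (hf : Sec ∅ B f) {b : Fin n}
    (hb : b ∈ B) : ∑ σ, wt β σ * f σ = 0 := by
  have h1 : ∑ σ, wt β σ * f σ = ∑ σ, wt β σ * -f σ := by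
    rw [← Equiv.sum_comp (actE nul (sing b)) fun σ => wt β σ * f σ]
    refine Finset.sum_congr rfl fun σ _ => ?_
    rw [actE_apply, wt_act, hf, chi_sing hb, chi_nul]
    ring
  simp only [mul_neg, Finset.sum_neg_distrib] at h1
  linarith

lemma ip_self_le_card {f : ConfigP n → ℝ} (hf : ∀ σ, |f σ| ≤ bit (σ ∈ Gr n)) :
    ip (wt β) f f ≤ (Gr n).card := by
  unfold ip
  rw [sum_wt_Gr β fun σ => f σ * f σ]
  have h1 : ∑ σ ∈ Gr n, f σ * f σ ≤ ∑ σ ∈ Gr n, 1 := by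
    refine Finset.sum_le_sum fun σ hσ => ?_
    have := hf σ
    rw [bit_of hσ] at this
    rw [← abs_mul_abs_self]
    nlinarith [abs_nonneg (f σ)]
  have h2 : ∑ σ ∈ (Gr n)ᶜ, wt β σ * (f σ * f σ) = 0 := by
    refine Finset.sum_eq_zero fun σ hσ => ?_
    have := hf σ
    rw [bit_not (Finset.mem_compl.1 hσ)] at this
    rw [abs_nonpos_iff.1 this]
    ring
  rw [h2]
  simpa using h1

lemma sec_sgp_le (h : Reg n β) {A B : Finset (Fin n)} {f : ConfigP n → ℝ} (hs : Sec A B f)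
    (hf : ∀ σ, |f σ| ≤ bit (σ ∈ Gr n)) (hk : 1 ≤ A.card + B.card) {g : ConfigP n} (hg : g ∈ Gr n)
    {t : ℝ} (ht : 0 ≤ t) :
    sgp (genP n β) t f g ≤ Real.exp (-(rate n β (A.card + B.card) * t)) := by
  have h1 := (hs.sgp (β := β) t).sq_mul_card_le (β := β) hg
  have h2 := hs.decay h hk ht
  have h3 := ip_self_le_card (β := β) hf
  have h4 := mul_le_mul_of_nonneg_left h3 (Real.exp_pos (-(2 * rate n β (A.card + B.card) * t))).le
  have h5 := abs_le_of_sector_bound (x := sgp (genP n β) t f g)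
    (e := -(rate n β (A.card + B.card) * t)) (c := 1) (Gr_card_pos (n := n)) zero_le_one (by
      rw [show 2 * -(rate n β (A.card + B.card) * t) = -(2 * rate n β (A.card + B.card) * t) by ring]
      rw [one_pow, mul_one]
      linarith)
  rw [mul_one] at h5
  exact (le_abs_self _).trans h5

/-- The product of the row signs of `i` and `j` on ground states. -/
def pairSign (p : Fin n × Fin n) (σ : ConfigP n) : ℝ := bit (σ ∈ Gr n) * agr p.1 p.2 σ 0

lemma abs_agr (i i' : Fin n) (σ : ConfigP n) (c : Fin n) : |agr i i' σ c| = 1 := by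
  rcases agr_eq i i' σ c with h | h <;> rw [h] <;> norm_num

lemma bit_act (u v : Fin n → Bool) (σ : ConfigP n) : bit (act u v σ ∈ Gr n) = bit (σ ∈ Gr n) := by
  by_cases h : σ ∈ Gr n
  · rw [bit_of h, bit_of (act_mem_Gr.2 h)]
  · rw [bit_not h, bit_not fun h' => h (act_mem_Gr.1 h')]

lemma sec_pairSign {p : Fin n × Fin n} (h : p.1 ≠ p.2) : Sec ∅ {p.1, p.2} (pairSign p) := by
  intro u v σ
  unfold pairSign
  rw [bit_act, agr_act h, show chi (∅ : Finset (Fin n)) u = 1 from Finset.prod_empty]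
  ring

lemma abs_pairSign_le (p : Fin n × Fin n) (σ : ConfigP n) : |pairSign p σ| ≤ bit (σ ∈ Gr n) := by
  rw [pairSign, abs_mul, abs_agr, mul_one, abs_of_nonneg (bit_nonneg _)]

/-- The product of two row overlaps on ground states. -/
def quadSign (i i' j j' : Fin n) (σ : ConfigP n) : ℝ :=
  bit (σ ∈ Gr n) * (agr i i' σ 0 * agr j j' σ 0)

lemma agr_self (i : Fin n) (σ : ConfigP n) (c : Fin n) : agr i i σ c = 1 := by
  unfold agr sval
  cases σ (c, i) <;> norm_num

lemma abs_quadSign_le (i i' j j' : Fin n) (σ : ConfigP n) :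
    |quadSign i i' j j' σ| ≤ bit (σ ∈ Gr n) := by
  rw [quadSign, abs_mul, abs_mul, abs_agr, abs_agr, mul_one, mul_one, abs_of_nonneg (bit_nonneg _)]

lemma pairSign_mul (p r : Fin n × Fin n) (σ : ConfigP n) :
    pairSign p σ * pairSign r σ = quadSign p.1 r.1 p.2 r.2 σ := by
  have hb : bit (σ ∈ Gr n) * bit (σ ∈ Gr n) = bit (σ ∈ Gr n) := by
    by_cases h : σ ∈ Gr n
    · rw [bit_of h, mul_one]
    · rw [bit_not h, mul_zero]
  unfold pairSign quadSign agr
  linear_combination (sval (σ (0, p.1)) * sval (σ (0, r.1)) *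
    (sval (σ (0, p.2)) * sval (σ (0, r.2)))) * hb

lemma quadSign_sec {I J : Finset (Fin n)} (hIJ : Disjoint I J) {i i' j j' : Fin n} (hi : i ∈ I)
    (hi' : i' ∈ I) (hj : j ∈ J) (hj' : j' ∈ J) (hne : i ≠ i' ∨ j ≠ j') :
    ∃ B : Finset (Fin n), Sec ∅ B (quadSign (n := n) i i' j j') ∧
      B.card = (if i = i' then 0 else 2) + (if j = j' then 0 else 2) ∧ ∃ b, b ∈ B := by
  have h0 : ∀ u : Fin n → Bool, chi (∅ : Finset (Fin n)) u = 1 := fun _ => Finset.prod_empty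
  by_cases hii : i = i'
  · have hjj : j ≠ j' := hne.resolve_left fun h => h hii
    subst hii
    refine ⟨{j, j'}, fun u v σ => ?_, ?_, j, by simp⟩
    · unfold quadSign
      rw [bit_act, agr_act hjj, h0, agr_self, agr_self]
      ring
    · rw [if_pos rfl, if_neg hjj, Finset.card_pair hjj]
  · by_cases hjj : j = j'
    · subst hjj
      refine ⟨{i, i'}, fun u v σ => ?_, ?_, i, by simp⟩
      · unfold quadSign
        rw [bit_act, agr_act hii, h0, agr_self, agr_self]
        ring
      · rw [if_pos rfl, if_neg hii, Finset.card_pair hii]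
    · have hI : ({i, i'} : Finset (Fin n)) ⊆ I := by
        simp [Finset.insert_subset_iff, hi, hi']
      have hJ : ({j, j'} : Finset (Fin n)) ⊆ J := by
        simp [Finset.insert_subset_iff, hj, hj']
      have hd : Disjoint ({i, i'} : Finset (Fin n)) {j, j'} :=
        Finset.disjoint_of_subset_left hI (Finset.disjoint_of_subset_right hJ hIJ)
      refine ⟨{i, i'} ∪ {j, j'}, fun u v σ => ?_, ?_, i, by simp⟩
      · have hc : chi ({i, i'} ∪ {j, j'}) v = chi {i, i'} v * chi {j, j'} v := Finset.prod_union hd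
        unfold quadSign
        rw [bit_act, agr_act hii, agr_act hjj, h0, hc]
        ring
      · rw [Finset.card_union_of_disjoint hd, if_neg hii, if_neg hjj, Finset.card_pair hii,
          Finset.card_pair hjj]

/-- The total row-pair correlation. -/
def bigSign (I J : Finset (Fin n)) (σ : ConfigP n) : ℝ := ∑ p ∈ I ×ˢ J, pairSign p σ

lemma bigSign_sq (I J : Finset (Fin n)) (σ : ConfigP n) :
    bigSign I J σ ^ 2 = ∑ q ∈ (I ×ˢ I) ×ˢ (J ×ˢ J), quadSign q.1.1 q.1.2 q.2.1 q.2.2 σ := by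
  rw [sq, bigSign, Finset.sum_mul_sum]
  simp only [pairSign_mul, Finset.sum_product]
  refine Finset.sum_congr rfl fun i _ => ?_
  rw [Finset.sum_comm]

lemma sum_ite_pair (I : Finset (Fin n)) {q : ℝ} (hq : 0 ≤ q) :
    ∑ p ∈ I ×ˢ I, (if p.1 = p.2 then 1 else q) ≤ I.card * (1 + I.card * q) := by
  rw [Finset.sum_product]
  have : ∀ i ∈ I, ∑ i' ∈ I, (if i = i' then 1 else q) ≤ 1 + I.card * q := by
    intro i hi
    have h1 : ∀ i' ∈ I, (if i = i' then 1 else q) ≤ (if i = i' then 1 else 0) + q := by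
      intro i' _
      split_ifs <;> linarith
    refine (Finset.sum_le_sum h1).trans (le_of_eq ?_)
    rw [Finset.sum_add_distrib, Finset.sum_ite_eq, if_pos hi, Finset.sum_const, nsmul_eq_mul]
  refine (Finset.sum_le_sum this).trans (le_of_eq ?_)
  rw [Finset.sum_const, nsmul_eq_mul]

/-- The decay factor per pair of rows. -/
def damp (n : ℕ) (β t : ℝ) : ℝ := Real.exp (-(rate n β 4 / 2 * t))

lemma rate_four_le (hn : 0 < n) (β : ℝ) : rate n β 4 / 2 ≤ rate n β 2 := by
  have hn' : (0 : ℝ) < n := by exact_mod_cast hn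
  unfold rate
  push_cast
  have h1 : (0 : ℝ) < 1 + 247 * 4 / n := by positivity
  have h2 : (0 : ℝ) < 1 + 247 * 2 / n := by positivity
  have h3 : (1 : ℝ) + 247 * 2 / n ≤ 1 + 247 * 4 / n := by gcongr; norm_num
  have h4 : 4 * 4 * Real.exp (-(4 * β)) / (1 + 247 * 4 / (n : ℝ)) / 2 =
      4 * 2 * Real.exp (-(4 * β)) / (1 + 247 * 4 / n) := by ring
  rw [h4]
  gcongr

lemma damp_pos (n : ℕ) (β t : ℝ) : 0 < damp n β t := Real.exp_pos _

lemma exp_rate_two_le (hn : 0 < n) {t : ℝ} (ht : 0 ≤ t) :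
    Real.exp (-(rate n β 2 * t)) ≤ damp n β t := by
  unfold damp
  have := mul_le_mul_of_nonneg_right (rate_four_le hn β) ht
  exact Real.exp_le_exp.2 (by linarith)

lemma sgp_quadSign_le (h : Reg n β) {I J : Finset (Fin n)} (hIJ : Disjoint I J) {i i' j j' : Fin n}
    (hi : i ∈ I) (hi' : i' ∈ I) (hj : j ∈ J) (hj' : j' ∈ J) {g : ConfigP n} (hg : g ∈ Gr n) {t : ℝ}
    (ht : 0 ≤ t) : sgp (genP n β) t (quadSign i i' j j') g ≤
      (if i = i' then 1 else damp n β t) * (if j = j' then 1 else damp n β t) := by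
  have hn : 0 < n := by have := h.two; omega
  by_cases hne : i ≠ i' ∨ j ≠ j'
  · obtain ⟨B, hB, hc, b, hb⟩ := quadSign_sec hIJ hi hi' hj hj' hne
    have h1 := sec_sgp_le h hB (abs_quadSign_le i i' j j') (by
      have := Finset.card_pos.2 ⟨b, hb⟩; omega) hg ht
    rw [Finset.card_empty, zero_add, hc] at h1
    refine h1.trans ?_
    have h2 := exp_rate_two_le (β := β) hn ht
    by_cases hii : i = i'
    · by_cases hjj : j = j'
      · exact absurd hne (by simp [hii, hjj])
      · simp only [if_pos hii, if_neg hjj, zero_add, one_mul]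
        exact h2
    · by_cases hjj : j = j'
      · simp only [if_pos hjj, if_neg hii, add_zero, mul_one]
        exact h2
      · simp only [if_neg hii, if_neg hjj]
        unfold damp
        rw [← Real.exp_add]
        exact le_of_eq (by congr 1; ring)
  · push Not at hne
    rw [if_pos hne.1, if_pos hne.2, mul_one]
    have h1 := (revChain n β).sgp_nonneg ht (f := (fun _ => (1 : ℝ)) - quadSign i i' j j') (fun σ => by
      have := (le_abs_self _).trans (abs_quadSign_le i i' j j' σ)
      have h2 : bit (σ ∈ Gr n) ≤ 1 := by unfold bit; split_ifs <;> norm_num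
      simp only [Pi.sub_apply]
      linarith) g
    rw [sgp_sub, (revChain n β).sgp_one, Pi.sub_apply] at h1
    linarith

lemma sgp_bigSign_sq_le (h : Reg n β) {I J : Finset (Fin n)} (hIJ : Disjoint I J) {g : ConfigP n}
    (hg : g ∈ Gr n) {t : ℝ} (ht : 0 ≤ t) :
    sgp (genP n β) t (fun σ => bigSign I J σ ^ 2) g ≤
      (I.card * (1 + I.card * damp n β t)) * (J.card * (1 + J.card * damp n β t)) := by
  simp only [bigSign_sq]
  rw [sgp_sum]
  have hq := (damp_pos n β t).le
  calc _ ≤ ∑ q ∈ (I ×ˢ I) ×ˢ (J ×ˢ J), (if q.1.1 = q.1.2 then 1 else damp n β t) *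
        (if q.2.1 = q.2.2 then 1 else damp n β t) := by
        refine Finset.sum_le_sum fun q hq' => ?_
        simp only [Finset.mem_product] at hq'
        exact sgp_quadSign_le h hIJ hq'.1.1 hq'.1.2 hq'.2.1 hq'.2.2 hg ht
    _ = (∑ p ∈ I ×ˢ I, if p.1 = p.2 then 1 else damp n β t) *
        ∑ p ∈ J ×ˢ J, if p.1 = p.2 then 1 else damp n β t := by
        rw [Finset.sum_mul_sum, Finset.sum_product]
    _ ≤ _ := by
        have h1 : (0 : ℝ) ≤ ∑ p ∈ J ×ˢ J, if p.1 = p.2 then 1 else damp n β t :=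
          Finset.sum_nonneg fun p _ => by split_ifs <;> linarith
        exact mul_le_mul (sum_ite_pair I hq) (sum_ite_pair J hq) h1 (by positivity)

lemma sum_bigSign_sq_le (β : ℝ) {I J : Finset (Fin n)} (hIJ : Disjoint I J) :
    ∑ σ, wt β σ * bigSign I J σ ^ 2 ≤ I.card * J.card * ∑ σ : ConfigP n, wt β σ := by
  simp only [bigSign_sq, Finset.mul_sum]
  rw [Finset.sum_comm]
  have h1 : ∀ q ∈ (I ×ˢ I) ×ˢ (J ×ˢ J), ∑ σ : ConfigP n, wt β σ * quadSign q.1.1 q.1.2 q.2.1 q.2.2 σ ≤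
      ((if q.1.1 = q.1.2 then 1 else 0) * (if q.2.1 = q.2.2 then 1 else 0)) *
        ∑ σ : ConfigP n, wt β σ := by
    intro q hq
    simp only [Finset.mem_product] at hq
    by_cases hne : q.1.1 ≠ q.1.2 ∨ q.2.1 ≠ q.2.2
    · obtain ⟨B, hB, -, b, hb⟩ := quadSign_sec hIJ hq.1.1 hq.1.2 hq.2.1 hq.2.2 hne
      rw [hB.sum_wt_eq_zero hb]
      rcases hne with e | e
      · rw [if_neg e, zero_mul, zero_mul]
      · rw [if_neg e, mul_zero, zero_mul]
    · push Not at hne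
      rw [if_pos hne.1, if_pos hne.2, mul_one, one_mul]
      refine Finset.sum_le_sum fun σ _ => ?_
      have := (le_abs_self _).trans (abs_quadSign_le q.1.1 q.1.2 q.2.1 q.2.2 σ)
      have h2 : bit (σ ∈ Gr n) ≤ 1 := by unfold bit; split_ifs <;> norm_num
      exact mul_le_of_le_one_right (wt_pos β σ).le (this.trans h2)
  refine (Finset.sum_le_sum h1).trans (le_of_eq ?_)
  have h2 : ∀ K : Finset (Fin n), ∑ p ∈ K ×ˢ K, (if p.1 = p.2 then (1 : ℝ) else 0) = K.card := by
    intro K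
    rw [Finset.sum_product]
    have : ∀ i ∈ K, ∑ i' ∈ K, (if i = i' then (1 : ℝ) else 0) = 1 := fun i hi => by
      rw [Finset.sum_ite_eq, if_pos hi]
    rw [Finset.sum_congr rfl this]
    simp
  rw [← Finset.sum_mul, Finset.sum_product]
  have h3 : ∑ x ∈ I ×ˢ I, ∑ y ∈ J ×ˢ J,
      (if x.1 = x.2 then (1 : ℝ) else 0) * (if y.1 = y.2 then 1 else 0) = I.card * J.card := by
    rw [← Finset.sum_mul_sum, h2, h2]
  rw [← Finset.mul_sum]
  exact congrArg (· * _) h3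

lemma sq_mean_le_tv (h : Reg n β) {I J : Finset (Fin n)} (hIJ : Disjoint I J) {g : ConfigP n}
    (hg : g ∈ Gr n) {t : ℝ} (ht : 0 ≤ t) :
    (∑ p ∈ I ×ˢ J, sgp (genP n β) t (pairSign p) g) ^ 2 ≤
      2 * tv (mexp (t • genP n β) g) (gibbsP n β) *
        ((I.card * (1 + I.card * damp n β t)) * (J.card * (1 + J.card * damp n β t)) +
          I.card * J.card) := by
  set P := mexp (t • genP n β) g with hP
  set π := gibbsP n β with hπ
  set Z := ∑ η : ConfigP n, wt β η with hZ
  have hZ0 : 0 < Z := sum_wt_pos n β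
  have hπe : ∀ η, π η = wt β η / Z := fun η => gibbsP_eq β η
  have hπs : ∀ f : ConfigP n → ℝ, ∑ η, π η * f η = (∑ η, wt β η * f η) / Z := by
    intro f
    rw [Finset.sum_div]
    exact Finset.sum_congr rfl fun η _ => by rw [hπe]; ring
  have hPs : ∀ f : ConfigP n → ℝ, ∑ η, P η * f η = sgp (genP n β) t f g := fun f => rfl
  have hm0 : ∑ η : ConfigP n, wt β η * bigSign I J η = 0 := by
    simp only [bigSign, Finset.mul_sum]
    rw [Finset.sum_comm]
    refine Finset.sum_eq_zero fun p hp => ?_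
    obtain ⟨h1, h2⟩ := Finset.mem_product.1 hp
    exact (sec_pairSign fun e => Finset.disjoint_left.1 hIJ h1 (e ▸ h2)).sum_wt_eq_zero
      (b := p.1) (by simp)
  have hmean : ∑ p ∈ I ×ˢ J, sgp (genP n β) t (pairSign p) g =
      ∑ η, (P η - π η) * bigSign I J η := by
    simp only [sub_mul, Finset.sum_sub_distrib]
    rw [hπs, hm0, zero_div, sub_zero, hPs, ← sgp_sum]
    rfl
  have hcs : (∑ η, (P η - π η) * bigSign I J η) ^ 2 ≤
      (∑ η, |P η - π η|) * ∑ η, |P η - π η| * bigSign I J η ^ 2 := by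
    refine Finset.sum_sq_le_sum_mul_sum_of_sq_le_mul _ (fun η _ => abs_nonneg _)
      (fun η _ => mul_nonneg (abs_nonneg _) (sq_nonneg _)) fun η _ => le_of_eq ?_
    rw [mul_pow, ← sq_abs (P η - π η)]
    ring
  have hP0 : ∀ η, 0 ≤ P η := fun η => (revChain n β).mexp_nonneg ht g η
  have hπ0 : ∀ η, 0 ≤ π η := fun η => by rw [hπe]; exact div_nonneg (wt_pos β η).le hZ0.le
  have hsec : ∑ η, |P η - π η| * bigSign I J η ^ 2 ≤
      (I.card * (1 + I.card * damp n β t)) * (J.card * (1 + J.card * damp n β t)) +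
        I.card * J.card := by
    have h1 : ∑ η, |P η - π η| * bigSign I J η ^ 2 ≤
        ∑ η, (P η * bigSign I J η ^ 2 + π η * bigSign I J η ^ 2) := by
      refine Finset.sum_le_sum fun η _ => ?_
      rw [← add_mul]
      refine mul_le_mul_of_nonneg_right ?_ (sq_nonneg _)
      exact abs_le.2 ⟨by linarith [hP0 η, hπ0 η], by linarith [hP0 η, hπ0 η]⟩
    rw [Finset.sum_add_distrib, hπs fun η => bigSign I J η ^ 2, hPs fun η => bigSign I J η ^ 2] at h1
    have h2 := sgp_bigSign_sq_le h hIJ hg ht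
    have h3 := sum_bigSign_sq_le β hIJ
    have h4 : (∑ η, wt β η * bigSign I J η ^ 2) / Z ≤ I.card * J.card := by
      rw [div_le_iff₀ hZ0]; exact h3
    linarith
  have htv : ∑ η, |P η - π η| = 2 * tv P π := by unfold tv; ring
  rw [hmean, ← htv]
  exact hcs.trans (mul_le_mul_of_nonneg_left hsec (Finset.sum_nonneg fun η _ => abs_nonneg _))

lemma ip_pairSign (β t : ℝ) {p : Fin n × Fin n} (hp : p.1 ≠ p.2) :
    ip (wt β) (pairSign p) (sgp (genP n β) t (pairSign p)) =
      (Gr n).card * sgp (genP n β) t (pairSign p) (fun _ => true) := by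
  have hs := sec_pairSign hp
  have hs' := hs.sgp (β := β) t
  have hss : Sec ∅ ∅ fun σ => pairSign p σ * sgp (genP n β) t (pairSign p) σ := by
    intro u v σ
    simp only [hs u v σ, hs' u v σ]
    have h1 := chi_sq {p.1, p.2} v
    have h0 : ∀ u : Fin n → Bool, chi (∅ : Finset (Fin n)) u = 1 := fun _ => Finset.prod_empty
    simp only [h0]
    linear_combination (pairSign p σ * sgp (genP n β) t (pairSign p) σ) * h1
  unfold ip
  rw [sum_wt_Gr β fun σ => pairSign p σ * sgp (genP n β) t (pairSign p) σ]
  have h1 : ∑ σ ∈ (Gr n)ᶜ, wt β σ * (pairSign p σ * sgp (genP n β) t (pairSign p) σ) = 0 := by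
    refine Finset.sum_eq_zero fun σ hσ => ?_
    rw [pairSign, bit_not (Finset.mem_compl.1 hσ)]
    ring
  have h2 : ∀ σ ∈ Gr n, pairSign p σ * sgp (genP n β) t (pairSign p) σ =
      sgp (genP n β) t (pairSign p) (fun _ => true) := by
    intro σ hσ
    have hc := hss.const_Gr (σ := σ) (τ := fun _ => true) fun y => by
      rw [mem_Gr.1 hσ, mem_Gr.1 const_mem_Gr]
    refine hc.trans ?_
    have : pairSign p (fun _ => true : ConfigP n) = 1 := by
      rw [pairSign, bit_of const_mem_Gr]
      norm_num [agr, sval]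
    simp only [this, one_mul]
  rw [h1, add_zero, Finset.sum_congr rfl h2, Finset.sum_const, nsmul_eq_mul]

lemma Reg.exp_le_exp (h : Reg n β) : 20 * Real.exp (-(2 * β)) ≤ Real.exp (-β) := by
  have h1 : Real.exp (-(2 * β)) = Real.exp (-β) * Real.exp (-β) := by
    rw [← Real.exp_add]; congr 1; ring
  have h2 : Real.exp (-β) ≤ 1 / 20 := by
    have : Real.exp (-β) * Real.exp β = 1 := by rw [← Real.exp_add]; simp
    have h3 : β + 1 ≤ Real.exp β := Real.add_one_le_exp β
    have := h.beta
    nlinarith [Real.exp_pos (-β)]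
  rw [h1]
  nlinarith [Real.exp_pos (-β)]

lemma two_ip_le {w : ConfigP n → ℝ} (hw : ∀ σ, 0 ≤ w σ) (f g : ConfigP n → ℝ) {a : ℝ} (ha : 0 < a) :
    2 * ip w f g ≤ a * ip w f f + ip w g g / a := by
  unfold ip
  rw [Finset.mul_sum, Finset.mul_sum, Finset.sum_div, ← Finset.sum_add_distrib]
  refine Finset.sum_le_sum fun σ _ => ?_
  have h1 : a * (f σ * f σ) + g σ * g σ / a - 2 * (f σ * g σ) = (a * f σ - g σ) ^ 2 / a := by
    field_simp
    ring
  have h2 : 0 ≤ w σ * ((a * f σ - g σ) ^ 2 / a) := mul_nonneg (hw σ) (by positivity)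
  rw [← h1] at h2
  have : w σ * (g σ * g σ) / a = w σ * (g σ * g σ / a) := by ring
  rw [this]
  linarith

lemma Sec.sub {A B : Finset (Fin n)} {f g : ConfigP n → ℝ} (hf : Sec A B f) (hg : Sec A B g) :
    Sec A B (f - g) := by
  intro u v σ
  simp only [Pi.sub_apply, hf u v σ, hg u v σ]
  ring

lemma ip_overlap_le (h : Reg n β) {p : Fin n × Fin n} (hp : p.1 ≠ p.2) {t : ℝ} (ht : 0 ≤ t) :
    ip (wt β) (overlap p.1 p.2) (sgp (genP n β) t (overlap p.1 p.2)) ≤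
      (sgp (genP n β) t (pairSign p) (fun _ => true) + 10 * Real.exp (-β) * damp n β t) *
        (Gr n).card := by
  have hn : 3 ≤ n := by have := h.two; omega
  have hR := revChain n β
  set N : ℝ := ((Gr n).card : ℝ) with hN
  have hN0 : 0 < N := Gr_card_pos
  set φ : ConfigP n → ℝ := overlap p.1 p.2 with hφ
  set ψ := pairSign p with hψ
  set ξ := φ - ψ with hξ
  have hsψ : Sec ∅ {p.1, p.2} ψ := sec_pairSign hp
  have hsξ : Sec ∅ {p.1, p.2} ξ := (sec_overlap hp).sub hsψ
  have hψψ : ip (wt β) ψ ψ ≤ N := ip_self_le_card (abs_pairSign_le p)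
  have hξξ : ip (wt β) ξ ξ ≤ 20 * Real.exp (-(2 * β)) * N := by
    unfold ip
    rw [sum_wt_Gr β fun σ => ξ σ * ξ σ]
    have h1 : ∑ σ ∈ Gr n, ξ σ * ξ σ = 0 := by
      refine Finset.sum_eq_zero fun σ hσ => ?_
      have : ξ σ = 0 := by
        simp only [hξ, Pi.sub_apply, hφ, hψ, pairSign, overlap_of_mem_Gr hn hσ, bit_of hσ, one_mul, sub_self]
      rw [this, mul_zero]
    have h2 : ∑ σ ∈ (Gr n)ᶜ, wt β σ * (ξ σ * ξ σ) ≤ ∑ σ ∈ (Gr n)ᶜ, wt β σ := by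
      refine Finset.sum_le_sum fun σ hσ => ?_
      have h3 : ξ σ = φ σ := by
        simp only [hξ, Pi.sub_apply, hψ, pairSign, bit_not (Finset.mem_compl.1 hσ), zero_mul, sub_zero]
      have h4 : |φ σ| ≤ 1 := abs_overlap_le _ _ _
      refine mul_le_of_le_one_right (wt_pos β σ).le ?_
      rw [h3, ← abs_mul_abs_self]
      nlinarith [abs_nonneg (φ σ)]
    rw [h1, zero_add]
    exact h2.trans h.sum_compl_le
  have hdec : ∀ f : ConfigP n → ℝ, Sec ∅ {p.1, p.2} f →
      ip (wt β) (sgp (genP n β) (t / 2) f) (sgp (genP n β) (t / 2) f) ≤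
        damp n β t * ip (wt β) f f := by
    intro f hf
    have hc : (∅ : Finset (Fin n)).card + ({p.1, p.2} : Finset (Fin n)).card = 2 := by
      rw [Finset.card_empty, Finset.card_pair hp]
    have h1 := hf.decay h (by rw [hc]; norm_num) (t := t / 2) (by linarith)
    rw [hc, show 2 * rate n β 2 * (t / 2) = rate n β 2 * t by ring] at h1
    exact h1.trans (mul_le_mul_of_nonneg_right (exp_rate_two_le (by omega) ht) (hR.ip_self_nonneg f))
  have hφe : φ = ψ + ξ := by rw [hξ]; abel
  have hexp : ip (wt β) φ (sgp (genP n β) t φ) = ip (wt β) ψ (sgp (genP n β) t ψ) +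
      2 * ip (wt β) ξ (sgp (genP n β) t ψ) + ip (wt β) ξ (sgp (genP n β) t ξ) := by
    rw [hφe, sgp_add, ip_add_left, ip_add_right, ip_add_right, hR.ip_sgp t ψ ξ, ip_comm _ _ ξ]
    ring
  have hq := damp_pos n β t
  have hd1 := hdec ψ hsψ
  have hd2 := hdec ξ hsξ
  have e2 : 2 * ip (wt β) ξ (sgp (genP n β) t ψ) ≤ 9 * Real.exp (-β) * damp n β t * N := by
    rw [hR.ip_sgp_self]
    refine (two_ip_le (fun σ => (wt_pos β σ).le) _ _ (a := Real.exp β / 4) (by positivity)).trans ?_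
    have hee : Real.exp β * Real.exp (-(2 * β)) = Real.exp (-β) := by
      rw [← Real.exp_add]; congr 1; ring
    have a1 : Real.exp β / 4 * ip (wt β) (sgp (genP n β) (t / 2) ξ) (sgp (genP n β) (t / 2) ξ) ≤
        Real.exp β / 4 * (damp n β t * (20 * Real.exp (-(2 * β)) * N)) := by
      gcongr
      exact hd2.trans (mul_le_mul_of_nonneg_left hξξ hq.le)
    have a2 : ip (wt β) (sgp (genP n β) (t / 2) ψ) (sgp (genP n β) (t / 2) ψ) / (Real.exp β / 4) ≤
        damp n β t * N / (Real.exp β / 4) := by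
      gcongr
      exact hd1.trans (mul_le_mul_of_nonneg_left hψψ hq.le)
    have a3 : damp n β t * N / (Real.exp β / 4) = 4 * Real.exp (-β) * damp n β t * N := by
      rw [Real.exp_neg]; field_simp
    have a4 : Real.exp β / 4 * (damp n β t * (20 * Real.exp (-(2 * β)) * N)) =
        5 * Real.exp (-β) * damp n β t * N := by rw [← hee]; ring
    linarith
  have e3 : ip (wt β) ξ (sgp (genP n β) t ξ) ≤ Real.exp (-β) * damp n β t * N := by
    rw [hR.ip_sgp_self]
    refine hd2.trans ?_
    have : damp n β t * ip (wt β) ξ ξ ≤ damp n β t * (Real.exp (-β) * N) := by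
      gcongr
      exact hξξ.trans (mul_le_mul_of_nonneg_right h.exp_le_exp hN0.le)
    linarith
  have e1 := ip_pairSign β t hp
  rw [hexp, e1]
  linarith

lemma mean_ge (h : Reg n β) {I J : Finset (Fin n)} (hIJ : Disjoint I J) {t c : ℝ} (ht : 0 ≤ t)
    (hc : ∑ p ∈ I ×ˢ J, dirE β (overlap (n := n) p.1 p.2) ≤ c * (I.card * J.card * (Gr n).card))
    (hc0 : 0 ≤ c) :
    I.card * J.card * (Real.exp (-(c * t)) - 10 * Real.exp (-β) * damp n β t) ≤
      ∑ p ∈ I ×ˢ J, sgp (genP n β) t (pairSign p) (fun _ => true) := by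
  have hn : 3 ≤ n := by have := h.two; omega
  set N : ℝ := ((Gr n).card : ℝ) with hN
  have hN0 : 0 < N := Gr_card_pos
  have hcard : ((I ×ˢ J).card : ℝ) = I.card * J.card := by rw [Finset.card_product]; push_cast; rfl
  have h1 : ∀ p ∈ I ×ˢ J, Real.exp (-(c * t)) * (N + t * (c * N - dirE β (overlap (n := n) p.1 p.2))) ≤
      (sgp (genP n β) t (pairSign p) (fun _ => true) + 10 * Real.exp (-β) * damp n β t) * N := by
    intro p hp
    obtain ⟨hp1, hp2⟩ := Finset.mem_product.1 hp
    have hne : p.1 ≠ p.2 := fun e => Finset.disjoint_left.1 hIJ hp1 (e ▸ hp2)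
    refine le_trans ?_ (ip_overlap_le h hne ht)
    refine le_trans ?_ ((revChain n β).autocorr_ge _ c ht)
    rw [ip_genP]
    have h2 : N ≤ ip (wt β) (overlap p.1 p.2) (overlap p.1 p.2) := by
      unfold ip
      rw [sum_wt_Gr β fun σ => overlap p.1 p.2 σ * overlap p.1 p.2 σ]
      have h3 : ∑ σ ∈ Gr n, overlap p.1 p.2 σ * overlap p.1 p.2 σ = ∑ σ ∈ Gr n, 1 := by
        refine Finset.sum_congr rfl fun σ hσ => ?_
        rw [overlap_of_mem_Gr hn hσ]
        rcases agr_eq p.1 p.2 σ 0 with e | e <;> rw [e] <;> norm_num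
      have h4 : 0 ≤ ∑ σ ∈ (Gr n)ᶜ, wt β σ * (overlap p.1 p.2 σ * overlap p.1 p.2 σ) :=
        Finset.sum_nonneg fun σ _ => mul_nonneg (wt_pos β σ).le (mul_self_nonneg _)
      rw [h3]
      simp only [Finset.sum_const, nsmul_eq_mul, mul_one]
      linarith
    have h5 := mul_le_mul_of_nonneg_left h2 (mul_nonneg ht hc0)
    refine mul_le_mul_of_nonneg_left ?_ (Real.exp_pos _).le
    nlinarith
  have h2 := Finset.sum_le_sum h1
  rw [← Finset.mul_sum, ← Finset.sum_mul, Finset.sum_add_distrib, Finset.sum_add_distrib,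
    ← Finset.mul_sum, Finset.sum_sub_distrib] at h2
  simp only [Finset.sum_const, nsmul_eq_mul, hcard] at h2
  have h3 : 0 ≤ t * (I.card * J.card * (c * N) - ∑ p ∈ I ×ˢ J, dirE β (overlap (n := n) p.1 p.2)) :=
    mul_nonneg ht (by linarith)
  have h4 := mul_nonneg (Real.exp_pos (-(c * t))).le h3
  refine le_of_mul_le_mul_right ?_ hN0
  nlinarith

end LowerBound

/-! ### Lower bound on the mixing time -/

section MixingLower

lemma exists_disjoint_halves (n : ℕ) :
    ∃ I J : Finset (Fin n), Disjoint I J ∧ I.card = n / 2 ∧ J.card = n / 2 := by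
  obtain ⟨I, -, hI⟩ := Finset.exists_subset_card_eq (s := (Finset.univ : Finset (Fin n)))
    (n := n / 2) (by rw [Finset.card_univ, Fintype.card_fin]; omega)
  obtain ⟨J, hJ, hJc⟩ := Finset.exists_subset_card_eq (s := Iᶜ) (n := n / 2)
    (by rw [Finset.card_compl, hI, Fintype.card_fin]; omega)
  exact ⟨I, J, Finset.disjoint_of_subset_right hJ disjoint_compl_right, hI, hJc⟩

lemma half_ge (n : ℕ) : ((n : ℝ) - 1) / 2 ≤ ((n / 2 : ℕ) : ℝ) := by
  have h : n ≤ 2 * (n / 2) + 1 := by omega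
  have h' : (n : ℝ) ≤ 2 * ((n / 2 : ℕ) : ℝ) + 1 := by exact_mod_cast h
  linarith

lemma overlap_rate_le {x m E : ℝ} (hx : 100 ≤ x) (hm : (x - 1) / 2 ≤ m) (hE : E ≤ (x + 1) ^ 2) :
    (2 / (x - 2)) ^ 2 * (2 * x ^ 2 + 1920 * x * E / m ^ 2) ≤
      8 / (1 + 988 / x) + 50000 / x := by
  have hx2 : 0 < x - 2 := by linarith
  have hm0 : 0 < m := by linarith
  have h1 : 8 - 7904 / x ≤ 8 / (1 + 988 / x) := by
    rw [le_div_iff₀ (by positivity)]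
    have : (8 - 7904 / x) * (1 + 988 / x) = 8 - 7904 * 988 / x ^ 2 := by field_simp; ring
    rw [this]
    have : 0 ≤ 7904 * 988 / x ^ 2 := by positivity
    linarith
  have h2 : E / m ^ 2 ≤ 4 * (101 / 99) ^ 2 := by
    rw [div_le_iff₀ (by positivity)]
    have : (x + 1) ≤ 2 * (101 / 99) * m := by nlinarith
    calc E ≤ (x + 1) ^ 2 := hE
      _ ≤ (2 * (101 / 99) * m) ^ 2 := by gcongr
      _ = _ := by ring
  have h3 : 1920 * x * E / m ^ 2 ≤ 8000 * x := by
    have : 1920 * x * E / m ^ 2 = 1920 * x * (E / m ^ 2) := by ring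
    rw [this]
    nlinarith
  have h4 : (2 / (x - 2)) ^ 2 * (2 * x ^ 2 + 8000 * x) ≤ 8 + 42000 / x := by
    rw [div_pow, div_mul_eq_mul_div, div_le_iff₀ (by positivity)]
    have : (8 + 42000 / x) * (x - 2) ^ 2 = (8 * x + 42000) * (x - 2) ^ 2 / x := by
      field_simp
    rw [this, le_div_iff₀ (by positivity)]
    nlinarith [mul_nonneg (sub_nonneg.2 hx) (sub_nonneg.2 hx),
      mul_nonneg (mul_nonneg (sub_nonneg.2 hx) (sub_nonneg.2 hx)) (sub_nonneg.2 hx)]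
  have h5 : (2 / (x - 2)) ^ 2 * (2 * x ^ 2 + 1920 * x * E / m ^ 2) ≤
      (2 / (x - 2)) ^ 2 * (2 * x ^ 2 + 8000 * x) := by gcongr
  have h6 : 50000 / x = 42000 / x + 8000 / x := by ring
  have h7 : 7904 / x ≤ 8000 / x := by gcongr; norm_num
  linarith

open Matrix

variable {n : ℕ} [NeZero n] {β : ℝ}

lemma sq_half_damp_le_tv (h : Reg n β) (hl : Real.exp (β / 2) ≤ n + 1) {t : ℝ} (ht : 0 ≤ t)
    (hr : 10 * Real.exp (-β) ≤ Real.exp (-(50000 / n * Real.exp (-(4 * β)) * t))) :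
    (((n / 2 : ℕ) : ℝ) * damp n β t *
      (Real.exp (-(50000 / n * Real.exp (-(4 * β)) * t)) - 10 * Real.exp (-β))) ^ 2 ≤
      2 * tv (mexp (t • genP n β) (fun _ => true)) (gibbsP n β) *
        ((1 + ((n / 2 : ℕ) : ℝ) * damp n β t) ^ 2 + 1) := by
  obtain ⟨I, J, hIJ, hI, hJ⟩ := exists_disjoint_halves n
  have hx : (100 : ℝ) ≤ n := by exact_mod_cast h.two
  have hm := half_ge n
  set m : ℝ := ((n / 2 : ℕ) : ℝ) with hmdef
  set x : ℝ := (n : ℝ) with hxdef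
  have hm0 : 0 < m := by linarith
  have hE : Real.exp β ≤ (x + 1) ^ 2 := by
    have : Real.exp β = Real.exp (β / 2) ^ 2 := by rw [← Real.exp_nat_mul]; congr 1; push_cast; ring
    rw [this]
    gcongr
  set c : ℝ := (8 / (1 + 988 / x) + 50000 / x) * Real.exp (-(4 * β)) with hcdef
  have hc0 : 0 ≤ c := by positivity
  have hD := h.sum_dirE_overlap_le I J
  have hcI : ((I.card : ℕ) : ℝ) = m := by rw [hI]
  have hcJ : ((J.card : ℕ) : ℝ) = m := by rw [hJ]
  have hc : ∑ p ∈ I ×ˢ J, dirE β (overlap (n := n) p.1 p.2) ≤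
      c * (I.card * J.card * (Gr n).card) := by
    refine hD.trans ?_
    rw [hcI, hcJ]
    have h3 : Real.exp (-(3 * β)) = Real.exp β * Real.exp (-(4 * β)) := by
      rw [← Real.exp_add]; congr 1; ring
    rw [h3]
    have h4 := overlap_rate_le hx hm hE
    calc _ = ((2 / (x - 2)) ^ 2 * (2 * x ^ 2 + 1920 * x * Real.exp β / m ^ 2)) *
          (Real.exp (-(4 * β)) * (m * m * (Gr n).card)) := by
          simp only [← hxdef]; field_simp
      _ ≤ (8 / (1 + 988 / x) + 50000 / x) * (Real.exp (-(4 * β)) * (m * m * (Gr n).card)) := by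
          gcongr
      _ = _ := by rw [hcdef]; ring
  have h1 := mean_ge h hIJ ht hc hc0
  have h2 := sq_mean_le_tv h hIJ const_mem_Gr ht
  rw [hcI, hcJ] at h1 h2
  have hexp : Real.exp (-(c * t)) =
      damp n β t * Real.exp (-(50000 / x * Real.exp (-(4 * β)) * t)) := by
    rw [damp, ← Real.exp_add]
    congr 1
    rw [hcdef, rate]
    push_cast
    simp only [← hxdef]
    field_simp
    ring
  rw [hexp] at h1
  set q := damp n β t with hq
  have hq0 : 0 < q := damp_pos n β t
  set r := Real.exp (-(50000 / x * Real.exp (-(4 * β)) * t)) - 10 * Real.exp (-β) with hrdef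
  have hr0 : 0 ≤ r := sub_nonneg.2 hr
  have h5 : (m * (m * q * r)) ^ 2 ≤ (∑ p ∈ I ×ˢ J, sgp (genP n β) t (pairSign p) fun _ => true) ^ 2 := by
    refine pow_le_pow_left₀ (by positivity) (le_trans (le_of_eq ?_) h1) 2
    rw [hrdef]; ring
  have h6 := h5.trans h2
  have h7 : m ^ 2 * (m * q * r) ^ 2 ≤ m ^ 2 *
      (2 * tv (mexp (t • genP n β) (fun _ => true)) (gibbsP n β) * ((1 + m * q) ^ 2 + 1)) := by
    refine le_trans (le_of_eq (by ring)) (h6.trans (le_of_eq (by ring)))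
  exact le_of_mul_le_mul_left h7 (by positivity)

lemma quarter_le_tv (h : Reg n β) (hl : Real.exp (β / 2) ≤ n + 1) (hb : 62500 * β ≤ n) {δ : ℝ}
    (hδ : δ ≤ 1) (hlarge : 22 ≤ Real.exp (δ * β / 2)) {t : ℝ} (ht : 0 ≤ t)
    (ht' : t ≤ (1 - δ) * (β / 16) * Real.exp (4 * β)) :
    1 / 4 ≤ tv (mexp (t • genP n β) (fun _ => true)) (gibbsP n β) := by
  have hβ := h.beta
  have hx : (100 : ℝ) ≤ n := by exact_mod_cast h.two
  have hδ0 : 0 ≤ δ := by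
    by_contra hc
    have : Real.exp (δ * β / 2) ≤ 1 := Real.exp_le_one_iff.2 (by nlinarith)
    linarith
  have hs : Real.exp (-(4 * β)) * t ≤ (1 - δ) * (β / 16) := by
    calc _ ≤ Real.exp (-(4 * β)) * ((1 - δ) * (β / 16) * Real.exp (4 * β)) := by gcongr
      _ = (1 - δ) * (β / 16) * (Real.exp (-(4 * β)) * Real.exp (4 * β)) := by ring
      _ = _ := by rw [← Real.exp_add]; simp
  have hs0 : 0 ≤ Real.exp (-(4 * β)) * t := by positivity
  have h10 : 10 * Real.exp (-β) ≤ 1 / 20 := by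
    have h1 : (201 : ℝ) ≤ Real.exp β := by
      have := Real.quadratic_le_exp_of_nonneg (by linarith : 0 ≤ β)
      nlinarith
    rw [Real.exp_neg, ← div_eq_mul_inv, div_le_iff₀ (Real.exp_pos _)]
    linarith
  have hr1 : 19 / 20 ≤ Real.exp (-(50000 / n * Real.exp (-(4 * β)) * t)) := by
    have h1 := Real.add_one_le_exp (-(50000 / (n : ℝ) * Real.exp (-(4 * β)) * t))
    have h2 : 50000 / (n : ℝ) * Real.exp (-(4 * β)) * t ≤ 1 / 20 := by
      rw [mul_assoc, div_mul_eq_mul_div, div_le_iff₀ (by linarith)]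
      nlinarith
    linarith
  have key := sq_half_damp_le_tv h hl ht (by linarith)
  have hm := half_ge n
  set m : ℝ := ((n / 2 : ℕ) : ℝ) with hmdef
  have hq : Real.exp (-((1 - δ) * (β / 2))) ≤ damp n β t := by
    refine Real.exp_le_exp.2 (neg_le_neg ?_)
    have h1 : rate n β 4 ≤ 16 * Real.exp (-(4 * β)) := by
      unfold rate
      push_cast
      refine (div_le_self (by positivity) ?_).trans (le_of_eq (by ring))
      have : (0 : ℝ) ≤ 247 * 4 / n := by positivity
      linarith
    nlinarith
  have hx10 : 10 ≤ m * damp n β t := by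
    have h1 : Real.exp (β / 2) * Real.exp (-((1 - δ) * (β / 2))) = Real.exp (δ * β / 2) := by
      rw [← Real.exp_add]; congr 1; ring
    have h2 : Real.exp (-((1 - δ) * (β / 2))) ≤ 1 := Real.exp_le_one_iff.2 (by nlinarith)
    have h3 : (Real.exp (β / 2) - 2) / 2 ≤ m := by linarith
    have h4 : 0 ≤ m := by linarith
    calc (10 : ℝ) ≤ (Real.exp (β / 2) - 2) / 2 * Real.exp (-((1 - δ) * (β / 2))) := by nlinarith
      _ ≤ m * damp n β t := mul_le_mul h3 hq (Real.exp_pos _).le h4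
  by_contra hlt
  push Not at hlt
  set y := m * damp n β t with hy
  set r := Real.exp (-(50000 / n * Real.exp (-(4 * β)) * t)) - 10 * Real.exp (-β) with hr
  have hr9 : 9 / 10 ≤ r := by linarith
  have h1 : (y * (9 / 10)) ^ 2 ≤ (y * r) ^ 2 := by gcongr
  have h2 : 2 * tv (mexp (t • genP n β) (fun _ => true)) (gibbsP n β) * ((1 + y) ^ 2 + 1) ≤
      1 / 2 * ((1 + y) ^ 2 + 1) := by
    have : 0 ≤ (1 + y) ^ 2 + 1 := by positivity
    nlinarith
  nlinarith

end MixingLower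

/-! ### Upper bound on the mixing time -/

section MixingUpper

open Matrix

lemma sum_pow_card_pair (n : ℕ) (q : ℝ) :
    ∑ p : Finset (Fin n) × Finset (Fin n), q ^ (p.1.card + p.2.card) = (1 + q) ^ (2 * n) := by
  have h1 : ∑ A : Finset (Fin n), q ^ A.card = (1 + q) ^ n := by
    have := Fintype.sum_pow_mul_eq_add_pow (Fin n) q 1
    simp only [one_pow, mul_one, Fintype.card_fin] at this
    rw [this, add_comm]
  simp only [pow_add]
  rw [Fintype.sum_prod_type, two_mul, pow_add, ← h1, Finset.sum_mul_sum]

lemma sum_pow_card_pair_erase_le (n : ℕ) {q : ℝ} (hq : 0 ≤ q) (hq1 : 2 * (n * q) ≤ 1) :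
    ∑ p ∈ Finset.univ.erase ((∅, ∅) : Finset (Fin n) × Finset (Fin n)),
      q ^ (p.1.card + p.2.card) ≤ 4 * (n * q) := by
  have h1 := Finset.add_sum_erase Finset.univ
    (fun p : Finset (Fin n) × Finset (Fin n) => q ^ (p.1.card + p.2.card))
    (Finset.mem_univ ((∅, ∅) : Finset (Fin n) × Finset (Fin n)))
  rw [sum_pow_card_pair] at h1
  simp only [Finset.card_empty, add_zero, pow_zero] at h1
  have h2 : (1 + q) ^ (2 * n) ≤ Real.exp (2 * (n * q)) := by
    calc (1 + q) ^ (2 * n) ≤ Real.exp q ^ (2 * n) := by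
          gcongr
          linarith [Real.add_one_le_exp q]
      _ = _ := by rw [← Real.exp_nat_mul]; congr 1; push_cast; ring
  have hy : 0 ≤ 2 * (n * q) := by positivity
  have h3 := Real.abs_exp_sub_one_le (by rw [abs_of_nonneg hy]; exact hq1)
  rw [abs_of_nonneg hy] at h3
  linarith [le_abs_self (Real.exp (2 * (n * q)) - 1)]

lemma exp_neg_le_inv {x : ℝ} (hx : 0 ≤ x) : Real.exp (-x) ≤ 1 / (1 + x) := by
  rw [Real.exp_neg, ← one_div]
  exact one_div_le_one_div_of_le (by linarith) (by linarith [Real.add_one_le_exp x])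

variable {n : ℕ} [NeZero n] {β : ℝ}

lemma exp_rate_le (h : Reg n β) {δ : ℝ} (hδ0 : 0 < δ) (hδ : δ ≤ 1) (hβδ : 3960000 ≤ δ * β)
    {k : ℕ} (hk : k ≤ 2 * n) :
    Real.exp (-(2 * rate n β k * ((1 + δ) * (β / 16) * Real.exp (4 * β)))) ≤
      Real.exp (-((1 + δ / 2) * (β / 2))) ^ k + Real.exp (-(4 * n)) := by
  have hβ := h.beta
  have hn : (100 : ℝ) ≤ n := by exact_mod_cast h.two
  have hk' : (k : ℝ) ≤ 2 * n := by exact_mod_cast hk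
  have hee : Real.exp (-(4 * β)) * Real.exp (4 * β) = 1 := by rw [← Real.exp_add]; simp
  have hD : 0 < 1 + 247 * (k : ℝ) / n := by positivity
  have he : 2 * rate n β k * ((1 + δ) * (β / 16) * Real.exp (4 * β)) =
      k * ((1 + δ) * (β / 2)) / (1 + 247 * k / n) := by
    calc _ = k * ((1 + δ) * (β / 2)) / (1 + 247 * k / n) *
          (Real.exp (-(4 * β)) * Real.exp (4 * β)) := by unfold rate; ring
      _ = _ := by rw [hee, mul_one]
  rw [he]
  by_cases hs : (k : ℝ) ≤ δ / 1000 * n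
  · refine le_trans ?_ (le_add_of_nonneg_right (Real.exp_pos _).le)
    rw [← Real.exp_nat_mul]
    refine Real.exp_le_exp.2 ?_
    rw [mul_neg, neg_le_neg_iff, le_div_iff₀ hD]
    have h1 : 247 * (k : ℝ) / n ≤ δ / 4 := by
      rw [div_le_iff₀ (by linarith)]
      nlinarith
    have h2 : (1 + δ / 2) * (1 + 247 * (k : ℝ) / n) ≤ 1 + δ := by
      calc _ ≤ (1 + δ / 2) * (1 + δ / 4) := by gcongr
        _ ≤ 1 + δ := by nlinarith
    have h3 : 0 ≤ (k : ℝ) * (β / 2) := by positivity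
    nlinarith
  · push Not at hs
    refine le_trans ?_ (le_add_of_nonneg_left (by positivity))
    refine Real.exp_le_exp.2 ?_
    rw [neg_le_neg_iff, le_div_iff₀ hD]
    have h1 : 247 * (k : ℝ) / n ≤ 494 := by
      rw [div_le_iff₀ (by linarith)]
      linarith
    calc 4 * (n : ℝ) * (1 + 247 * k / n) ≤ 4 * n * (1 + 494) := by gcongr
      _ ≤ δ / 1000 * n * (1 * (β / 2)) := by nlinarith
      _ ≤ k * ((1 + δ) * (β / 2)) := by
          have : 1 * (β / 2) ≤ (1 + δ) * (β / 2) := by gcongr; linarith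
          exact mul_le_mul hs.le this (by linarith) (by positivity)

lemma sum_exp_rate_le (h : Reg n β) {δ : ℝ} (hδ0 : 0 < δ) (hδ : δ ≤ 1)
    (hβδ : 3960000 ≤ δ * β) :
    ∑ p ∈ Finset.univ.erase ((∅, ∅) : Finset (Fin n) × Finset (Fin n)),
      Real.exp (-(2 * rate n β (p.1.card + p.2.card) *
        ((1 + δ) * (β / 16) * Real.exp (4 * β)))) ≤ 1 / 150 := by
  have hβ := h.beta
  have hn : (100 : ℝ) ≤ n := by exact_mod_cast h.two
  set q := Real.exp (-((1 + δ / 2) * (β / 2))) with hq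
  have hnq : n * q ≤ 1 / 100000 := by
    calc n * q ≤ Real.exp (β / 2) * q := by gcongr; exact h.le
      _ = Real.exp (-(δ * β / 4)) := by rw [hq, ← Real.exp_add]; congr 1; ring
      _ ≤ 1 / (1 + δ * β / 4) := exp_neg_le_inv (by linarith)
      _ ≤ 1 / 100000 := one_div_le_one_div_of_le (by norm_num) (by linarith)
  have hq0 : 0 ≤ q := (Real.exp_pos _).le
  have h1 := sum_pow_card_pair_erase_le n hq0 (by linarith)
  have hcard : ∀ A : Finset (Fin n), A.card ≤ n := fun A => by
    simpa using Finset.card_le_univ A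
  have h2 : ∑ p ∈ Finset.univ.erase ((∅, ∅) : Finset (Fin n) × Finset (Fin n)),
      Real.exp (-(4 * (n : ℝ))) ≤ 1 / 201 := by
    calc _ ≤ ∑ p : Finset (Fin n) × Finset (Fin n), Real.exp (-(4 * (n : ℝ))) :=
          Finset.sum_le_sum_of_subset_of_nonneg (Finset.erase_subset _ _)
            fun _ _ _ => (Real.exp_pos _).le
      _ = 4 ^ n * Real.exp (-(4 * (n : ℝ))) := by
          rw [Finset.sum_const, nsmul_eq_mul, Finset.card_univ, Fintype.card_prod,
            Fintype.card_finset, Fintype.card_fin]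
          push_cast
          rw [← mul_pow]
          norm_num
      _ ≤ Real.exp 2 ^ n * Real.exp (-(4 * (n : ℝ))) := by
          gcongr
          have := Real.quadratic_le_exp_of_nonneg (by norm_num : (0 : ℝ) ≤ 2)
          linarith
      _ = Real.exp (-(2 * (n : ℝ))) := by
          rw [← Real.exp_nat_mul, ← Real.exp_add]; congr 1; ring
      _ ≤ 1 / (1 + 2 * (n : ℝ)) := exp_neg_le_inv (by linarith)
      _ ≤ 1 / 201 := one_div_le_one_div_of_le (by norm_num) (by linarith)
  refine (Finset.sum_le_sum fun p _ => exp_rate_le h hδ0 hδ hβδ (k := p.1.card + p.2.card)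
    (by have := hcard p.1; have := hcard p.2; omega)).trans ?_
  rw [Finset.sum_add_distrib]
  linarith

/-- The time after which the chain has almost surely been through a ground state. -/
def burnIn (β : ℝ) : ℝ := 2 * β ^ 2 / kap β + 40 / kap β

lemma kap_pos (β : ℝ) : 0 < kap β := by unfold kap; positivity

lemma burnIn_le {δ : ℝ} (hlarge : 960 * (2 * β ^ 2 + 40) ≤ δ * β * Real.exp (β / 2)) :
    burnIn β ≤ δ * (β / 16) * Real.exp (4 * β) := by
  have hk := kap_pos β
  rw [burnIn, ← add_div, div_le_iff₀ hk]
  have : δ * (β / 16) * Real.exp (4 * β) * kap β = δ * β * Real.exp (β / 2) / 960 := by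
    have : Real.exp (β / 2) = Real.exp (4 * β) * Real.exp (-(7 / 2 * β)) := by
      rw [← Real.exp_add]; congr 1; ring
    rw [this, kap]
    ring
  rw [this]
  linarith

lemma tv_lt_quarter (h : Reg n β) {δ : ℝ} (hδ0 : 0 < δ) (hδ : δ ≤ 1) (hβδ : 3960000 ≤ δ * β)
    (hlarge : 960 * (2 * β ^ 2 + 40) ≤ δ * β * Real.exp (β / 2)) (σ : ConfigP n) :
    tv (mexp ((burnIn β + (1 + δ) * (β / 16) * Real.exp (4 * β)) • genP n β) σ)
      (gibbsP n β) < 1 / 4 := by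
  have hβ := h.beta
  have hk := kap_pos β
  set t := (1 + δ) * (β / 16) * Real.exp (4 * β) with ht
  have ht0 : 0 ≤ t := by positivity
  have hb0 : 0 ≤ burnIn β := by unfold burnIn; positivity
  have h40 : Real.exp (-40) ≤ 1 / 500 := by
    rw [Real.exp_neg, ← one_div]
    refine one_div_le_one_div_of_le (by norm_num) ?_
    have := Real.quadratic_le_exp_of_nonneg (by norm_num : (0 : ℝ) ≤ 40)
    linarith
  have hkt : 40 ≤ kap β * t := by
    have h1 : burnIn β ≤ t := (burnIn_le hlarge).trans (by rw [ht]; gcongr; linarith)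
    have h2 : 40 / kap β ≤ burnIn β := le_add_of_nonneg_left (by positivity)
    have h3 := (div_le_iff₀ hk).1 (h2.trans h1)
    linarith
  have hg : ∀ g ∈ Gr n, tv (mexp (t • genP n β) g) (gibbsP n β) ≤ 1 / 8 := by
    intro g hg
    have h1 := (tv_sq_le β hg t).trans (return_le h hg ht0)
    have h2 := sum_exp_rate_le h hδ0 hδ hβδ
    have h3 : Real.exp (-(2 * kap β * t)) ≤ 1 / 500 :=
      (Real.exp_le_exp.2 (by linarith)).trans h40
    have h4 : (2 * tv (mexp (t • genP n β) g) (gibbsP n β)) ^ 2 ≤ (1 / 4) ^ 2 := by linarith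
    have h5 := abs_le_of_sq_le_sq h4 (by norm_num)
    linarith [(abs_le.1 h5).2]
  have h1 := tv_start_le hb0 ht0 σ hg
  have h2 := escape_le h σ (s := 40 / kap β) (by positivity)
  rw [mul_div_cancel₀ _ hk.ne'] at h2
  have h3 : Real.exp (-(2 * β)) ≤ 1 / 500 := (Real.exp_le_exp.2 (by linarith)).trans h40
  have h4 : sgp (genP n β) (burnIn β) (fun η => if η ∈ Gr n then 0 else 1) σ ≤
    20 * Real.exp (-(2 * β)) + 5 * Real.exp (-40) := h2
  linarith

end MixingUpper

/-! ### The mixing time at the critical length -/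

section Asymptotics

open Filter

lemma tmixP_bounds {n : ℕ} [NeZero n] {β : ℝ} (h : Reg n β) (hl : Real.exp (β / 2) ≤ n + 1)
    (hb : 62500 * β ≤ n) {δ : ℝ} (hδ0 : 0 < δ) (hδ : δ ≤ 1) (hβδ : 3960000 ≤ δ * β)
    (hlarge : 960 * (2 * β ^ 2 + 40) ≤ δ * β * Real.exp (β / 2)) :
    (1 - δ) * (β / 16) * Real.exp (4 * β) ≤ tmixP n β (1 / 4) ∧
      tmixP n β (1 / 4) ≤ (1 + 2 * δ) * (β / 16) * Real.exp (4 * β) := by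
  have hβ := h.beta
  set T := burnIn β + (1 + δ) * (β / 16) * Real.exp (4 * β) with hT
  have hT0 : 0 < T := by
    have : 0 < burnIn β := by have := kap_pos β; unfold burnIn; positivity
    positivity
  have hmem : T ∈ {t : ℝ | 0 < t ∧ ∀ σ : ConfigP n,
      tv (mexp (t • genP n β) σ) (gibbsP n β) < 1 / 4} :=
    ⟨hT0, tv_lt_quarter h hδ0 hδ hβδ hlarge⟩
  constructor
  · refine le_csInf ⟨T, hmem⟩ fun t ht => ?_
    by_contra hlt
    push Not at hlt
    have h22 : 22 ≤ Real.exp (δ * β / 2) := by linarith [Real.add_one_le_exp (δ * β / 2)]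
    exact absurd (ht.2 fun _ => true) (not_lt.2 (quarter_le_tv h hl hb hδ h22 ht.1.le hlt.le))
  · refine (csInf_le ⟨0, fun t ht => ht.1.le⟩ hmem).trans ?_
    have := burnIn_le hlarge
    rw [hT]
    nlinarith

lemma eventually_tmixP_bounds {δ : ℝ} (hδ0 : 0 < δ) (hδ : δ ≤ 1) :
    ∀ᶠ β : ℝ in atTop,
      (1 - δ) / 16 ≤ tmixP (Lc β) β (1 / 4) / (β * Real.exp (4 * β)) ∧
        tmixP (Lc β) β (1 / 4) / (β * Real.exp (4 * β)) ≤ (1 + 2 * δ) / 16 := by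
  have hlim : Tendsto (fun β : ℝ => β / 2) atTop atTop :=
    tendsto_id.atTop_div_const (by norm_num)
  have e1 : ∀ᶠ β : ℝ in atTop, 960 * 10 * 16 / δ ≤ Real.exp (β / 2) / (β / 2) ^ 1 :=
    ((Real.tendsto_exp_div_pow_atTop 1).comp hlim).eventually_ge_atTop _
  have e2 : ∀ᶠ β : ℝ in atTop, 200000 ≤ Real.exp (β / 2) / (β / 2) ^ 1 :=
    ((Real.tendsto_exp_div_pow_atTop 1).comp hlim).eventually_ge_atTop _
  filter_upwards [e1, e2, eventually_ge_atTop (3960000 / δ), eventually_ge_atTop 20]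
    with β h1 h2 h3 h4
  have hb0 : 0 < β := by linarith
  rw [pow_one, le_div_iff₀ (by positivity)] at h1 h2
  rw [div_le_iff₀ hδ0] at h3
  rw [div_mul_eq_mul_div, div_le_iff₀ hδ0] at h1
  have hle : (Lc β : ℝ) ≤ Real.exp (β / 2) := Nat.floor_le (Real.exp_pos _).le
  have hlt : Real.exp (β / 2) < Lc β + 1 := Nat.lt_floor_add_one _
  have h100 : (100 : ℝ) ≤ Lc β := by linarith
  have h100' : 100 ≤ Lc β := by exact_mod_cast h100
  have : NeZero (Lc β) := ⟨by omega⟩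
  have hR : Reg (Lc β) β := ⟨h4, h100', hle⟩
  obtain ⟨hlo, hup⟩ := tmixP_bounds hR hlt.le (by linarith) hδ0 hδ (by linarith) (by nlinarith)
  have hpos : 0 < β * Real.exp (4 * β) := by positivity
  constructor
  · rw [le_div_iff₀ hpos]
    linarith
  · rw [div_le_iff₀ hpos]
    linarith

lemma tendsto_tmixP :
    Tendsto (fun β : ℝ => tmixP (Lc β) β (1 / 4) / (β * Real.exp (4 * β))) atTop
      (nhds (1 / 16)) := by
  rw [Metric.tendsto_nhds]
  intro ε hε
  have hδ0 : 0 < min 1 ε := lt_min one_pos hε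
  filter_upwards [eventually_tmixP_bounds hδ0 (min_le_left 1 ε)] with β hβ
  rw [Real.dist_eq, abs_lt]
  have := min_le_right 1 ε
  constructor <;> linarith [hβ.1, hβ.2]

end Asymptotics

end SPMP

/-- Theorem `ThmMainResPer`, sharp asymptotics: there is a constant
`0 < C < ∞` such that `T_mix^per(L_c) = C β e^{4β} (1+o(1))` as `β → ∞`, i.e.
`T_mix^per(L_c)/(β e^{4β}) → C`. -/
theorem spm_periodic_mixing_asymptotics :
    ∃ C : ℝ, 0 < C ∧
      Filter.Tendsto (fun β : ℝ => tmixP (Lc β) β (1 / 4) / (β * Real.exp (4 * β)))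
        Filter.atTop (nhds C) := by
  exact ⟨1 / 16, by norm_num, tendsto_tmixP⟩

end
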